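/- Let 0 < σ < 1 and fix 0 < c̃ < min{σ/2, (1−σ)/2}. Let δ > 0 and let A ⊂ [1,2] be a (δ,σ)-set which is approximately closed under multiplication (i.e. N_δ(A·A) ≲ |A|) or approximately closed under division (i.e. N_δ(A/A) ≲ |A|). Then N_δ(A+A) ≥ C(c̃,σ) · δ^{-c̃} · |A| and N_δ(A−A) ≥ C(c̃,σ) · δ^{-c̃} · |A|. -/

import Mathlib

open Pointwise

/-- The least number of closed intervals of length `δ` needed to cover `S ⊆ ℝ`. -/
noncomputable def coveringNumber (δ : ℝ) (S : Set ℝ) : ℕ :=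
  sInf {n : ℕ | ∃ t : Finset ℝ, t.card = n ∧ S ⊆ ⋃ x ∈ t, Set.Icc x (x + δ)}

/-- The quotient set `A/B = {a/b : a ∈ A, b ∈ B, b ≠ 0}`. -/
def divSet (A B : Set ℝ) : Set ℝ := {x | ∃ a ∈ A, ∃ b ∈ B, b ≠ 0 ∧ x = a / b}

/-- `A` is a `(δ,σ)`-set with (multiplicative) constant `K`: it is `δ`-separated,
`|A|` is comparable to `δ^{-σ}`, and it satisfies the Frostman condition. -/
def IsDeltaSigmaSet (K δ σ : ℝ) (A : Finset ℝ) : Prop :=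
  (∀ x ∈ A, ∀ y ∈ A, x ≠ y → δ ≤ |x - y|) ∧
  (A.card : ℝ) ≤ K * δ ^ (-σ) ∧
  δ ^ (-σ) ≤ K * (A.card : ℝ) ∧
  ∀ (x r : ℝ), δ ≤ r →
    ((A.filter (fun a => |a - x| ≤ r)).card : ℝ) ≤ K * r ^ σ * (A.card : ℝ)

lemma card_nsmul_le (X : Finset ℤ) (j : ℕ) : (j • X).card ≤ (j + 1) ^ X.card := by
  classical
  have key : ∀ j : ℕ, ∀ y ∈ j • X, ∃ m : ℤ → ℕ, (∀ x, m x ≤ j) ∧ y = ∑ x ∈ X, (m x : ℤ) * x := by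
    intro j
    induction j with
    | zero =>
      intro y hy
      refine ⟨fun _ => 0, fun _ => le_refl _, ?_⟩
      simp at hy
      simp [hy]
    | succ k ih =>
      intro y hy
      rw [succ_nsmul] at hy
      obtain ⟨z, hz, x, hx, rfl⟩ := Finset.mem_add.1 hy
      obtain ⟨m, hm, rfl⟩ := ih z hz
      refine ⟨fun w => m w + if w = x then 1 else 0, fun w => ?_, ?_⟩
      · have := hm w
        dsimp only
        split_ifs <;> omega
      · push_cast
        simp only [add_mul, Finset.sum_add_distrib]
        simp [hx]
  have : j • X ⊆ (Finset.univ : Finset (X → Fin (j+1))).image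
      (fun m => ∑ x : X, ((m x : ℕ) : ℤ) * (x : ℤ)) := by
    intro y hy
    obtain ⟨m, hm, rfl⟩ := key j y hy
    refine Finset.mem_image.2 ⟨fun x => ⟨m x, Nat.lt_succ_of_le (hm x)⟩, Finset.mem_univ _, ?_⟩
    rw [← Finset.sum_coe_sort X]
  calc (j • X).card ≤ _ := Finset.card_le_card this
    _ ≤ _ := Finset.card_image_le
    _ = _ := by simp

lemma plun (Λ : ℕ) (S : Finset ℤ) (hS : S.Nonempty) (h : (S + S).card ≤ Λ * S.card) (m n : ℕ) :
    (m • S - n • S).card ≤ Λ ^ (m + n) * S.card := by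
  have := Finset.pluennecke_ruzsa_inequality_nsmul_sub_nsmul_add hS S m n
  have h0 : (0 : ℚ≥0) < S.card := by exact_mod_cast hS.card_pos
  have h1 : ((S + S).card / S.card : ℚ≥0) ≤ Λ := by
    rw [div_le_iff₀ h0]; exact_mod_cast h
  have h2 : ((m • S - n • S).card : ℚ≥0) ≤ (Λ : ℚ≥0) ^ (m + n) * S.card := by
    refine this.trans ?_
    gcongr
  exact_mod_cast h2

lemma poly_growth (Λ : ℕ) (S : Finset ℤ) (hS : S.Nonempty) (h : (S + S).card ≤ Λ * S.card)
    (M : ℕ) : ((M + 1) • S).card ≤ (M + 1) ^ (Λ ^ 4) * Λ ^ 2 * S.card := by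
  classical
  have h31 : ((2 • S - S + S).card : ℝ) ≤ (Λ ^ 4 : ℕ) * S.card := by
    have h1 := plun Λ S hS h 3 1
    have : 2 • S - S + S = 3 • S - 1 • S := by
      rw [one_nsmul, succ_nsmul S 2, sub_add_eq_add_sub]
    rw [this]
    exact_mod_cast h1
  obtain ⟨X, hX, hXc, hcov⟩ := Finset.ruzsa_covering_add hS h31
  have hXc' : X.card ≤ Λ ^ 4 := by exact_mod_cast hXc
  have hind : ∀ j : ℕ, (j + 1) • S - S ⊆ j • X + (S - S) := by
    intro j
    induction j with
    | zero => simp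
    | succ k ih =>
      have e1 : (k + 1 + 1) • S - S = S + ((k + 1) • S - S) := by
        rw [succ_nsmul', add_sub_assoc]
      have e2 : S + (k • X + (S - S)) = k • X + (2 • S - S) := by
        rw [two_nsmul]; rw [add_left_comm, add_sub_assoc]
      rw [e1]
      calc S + ((k + 1) • S - S) ⊆ S + (k • X + (S - S)) := Finset.add_subset_add_left ih
        _ = k • X + (2 • S - S) := e2
        _ ⊆ k • X + (X + (S - S)) := Finset.add_subset_add_left hcov
        _ = _ := by rw [← add_assoc, succ_nsmul]
  have hsub : (S - S).card ≤ Λ ^ 2 * S.card := by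
    have := plun Λ S hS h 1 1
    simpa using this
  calc ((M + 1) • S).card ≤ ((M+1) • S - S).card := Finset.card_le_card_sub_right hS
    _ ≤ (M • X + (S - S)).card := Finset.card_le_card (hind M)
    _ ≤ (M • X).card * (S - S).card := Finset.card_add_le
    _ ≤ (M + 1) ^ (Λ ^ 4) * (Λ ^ 2 * S.card) := by
        gcongr
        exact (card_nsmul_le X M).trans (Nat.pow_le_pow_right (by omega) hXc')
    _ = _ := by ring

/-- number of cells of length `T` met by `S` -/
def cells (T : ℕ) (S : Finset ℤ) : ℕ := (S.image (fun s => s / (T : ℤ))).card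

lemma pigeon {α β : Type*} [DecidableEq β] (s : Finset α) (hs : s.Nonempty) (g : α → β) :
    ∃ y ∈ s.image g, s.card ≤ (s.filter (fun x => g x = y)).card * (s.image g).card := by
  by_contra! hcon
  have hne : (s.image g).Nonempty := hs.image g
  have h1 : ∑ y ∈ s.image g, (s.filter (fun x => g x = y)).card * (s.image g).card
      < ∑ y ∈ s.image g, s.card := Finset.sum_lt_sum_of_nonempty hne hcon
  rw [← Finset.sum_mul, ← Finset.card_eq_sum_card_image g s, Finset.sum_const, smul_eq_mul,
    mul_comm] at h1
  exact lt_irrefl _ h1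

lemma sep_sums (P : Finset ℤ) (hP : P.Nonempty) (w : ℤ) (hw : 0 < w)
    (hsep : ∀ x ∈ P, ∀ y ∈ P, x ≠ y → w ≤ |x - y|) (n : ℕ) :
    ∃ Q : Finset ℤ, Q ⊆ n • P ∧ Q.Nonempty ∧ (∀ x ∈ Q, ∀ y ∈ Q, x ≠ y → w ≤ |x - y|) ∧
      n * (P.card - 1) + 1 ≤ Q.card := by
  classical
  induction n with
  | zero =>
    refine ⟨{0}, by simp, by simp, ?_, by simp⟩
    intro x hx y hy hxy
    simp at hx hy
    omega
  | succ k ih =>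
    obtain ⟨Q, hQs, hQn, hQsep, hQc⟩ := ih
    set a := P.min' hP with ha
    set b := Q.max' hQn with hb
    have haP : a ∈ P := Finset.min'_mem _ _
    have hbQ : b ∈ Q := Finset.max'_mem _ _
    have hPa : ∀ x ∈ P, x ≠ a → a + w ≤ x := by
      intro x hx hxa
      have h1 : a ≤ x := Finset.min'_le _ _ hx
      have h2 := hsep x hx a haP hxa
      rw [abs_of_nonneg (by omega)] at h2
      omega
    have hQb : ∀ x ∈ Q, x ≤ b := fun x hx => Finset.le_max' _ _ hx
    refine ⟨Q.image (fun x => x + a) ∪ (P.erase a).image (fun x => b + x), ?_, ?_, ?_, ?_⟩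
    · rw [succ_nsmul]
      intro y hy
      rcases Finset.mem_union.1 hy with hy | hy
      · obtain ⟨x, hx, rfl⟩ := Finset.mem_image.1 hy
        exact Finset.add_mem_add (hQs hx) haP
      · obtain ⟨x, hx, rfl⟩ := Finset.mem_image.1 hy
        exact Finset.add_mem_add (hQs hbQ) (Finset.mem_of_mem_erase hx)
    · exact (hQn.image _).mono Finset.subset_union_left
    · intro y hy z hz hyz
      simp only [Finset.mem_union, Finset.mem_image, Finset.mem_erase] at hy hz
      rcases hy with ⟨x, hx, rfl⟩ | ⟨x, ⟨hxa, hx⟩, rfl⟩ <;>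
      rcases hz with ⟨x', hx', rfl⟩ | ⟨x', ⟨hxa', hx'⟩, rfl⟩
      · have := hQsep x hx x' hx' (by rintro rfl; exact hyz rfl)
        rwa [add_sub_add_right_eq_sub]
      · have h1 := hPa x' hx' hxa'
        have h2 := hQb x hx
        rw [abs_sub_comm, abs_of_nonneg (by omega)]; omega
      · have h1 := hPa x hx hxa
        have h2 := hQb x' hx'
        rw [abs_of_nonneg (by omega)]; omega
      · have := hsep x hx x' hx' (by rintro rfl; exact hyz rfl)
        rwa [add_sub_add_left_eq_sub]
    · rw [Finset.card_union_of_disjoint, Finset.card_image_of_injective _ (add_left_injective a),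
        Finset.card_image_of_injective _ (add_right_injective b), Finset.card_erase_of_mem haP]
      · have : (k + 1) * (P.card - 1) = k * (P.card - 1) + (P.card - 1) := by ring
        omega
      · rw [Finset.disjoint_left]
        intro y hy hy'
        simp only [Finset.mem_image, Finset.mem_erase] at hy hy'
        obtain ⟨x, hx, rfl⟩ := hy
        obtain ⟨x', ⟨hxa', hx'⟩, he⟩ := hy'
        have h1 := hPa x' hx' hxa'
        have h2 := hQb x hx
        omega

lemma diam_nsmul (P : Finset ℤ) (d : ℤ) (hd : ∀ x ∈ P, ∀ y ∈ P, |x - y| ≤ d) (n : ℕ) :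
    ∀ x ∈ n • P, ∀ y ∈ n • P, |x - y| ≤ n * d := by
  induction n with
  | zero => intro x hx y hy; simp at hx hy; simp [hx, hy]
  | succ k ih =>
    intro x hx y hy
    rw [succ_nsmul] at hx hy
    obtain ⟨a, ha, b, hb, rfl⟩ := Finset.mem_add.1 hx
    obtain ⟨a', ha', b', hb', rfl⟩ := Finset.mem_add.1 hy
    have h1 := ih a ha a' ha'
    have h2 := hd b hb b' hb'
    have : a + b - (a' + b') = (a - a') + (b - b') := by ring
    rw [this]
    push_cast
    linarith [abs_add_le (a - a') (b - b')]

lemma cut_step (S Z : Finset ℤ) (hS : S.Nonempty) (m n : ℕ) (hn : 2 ≤ n) (T U : ℕ) (hT : 0 < T)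
    (hTU : T ∣ U) (hU : 0 < U) (hZ : Z ⊆ m • S)
    (hd : ∀ z ∈ Z, ∀ z' ∈ Z, |z - z'| < 2 * T) (h4 : 4 * cells U S ≤ cells T S) :
    ∃ Z' : Finset ℤ, Z' ⊆ (n + m) • S ∧ (∀ z ∈ Z', ∀ z' ∈ Z', |z - z'| < 2 * (n * U : ℕ)) ∧
      n * cells T S * Z.card ≤ 6 * (Z'.card * cells U S) := by
  classical
  obtain ⟨q, rfl⟩ := hTU
  have hq : 0 < q := Nat.pos_of_mul_pos_left hU
  have hTz : (0 : ℤ) < T := by exact_mod_cast hT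
  have hqz : (0 : ℤ) < q := by exact_mod_cast hq
  have hUz : (0 : ℤ) < (T * q : ℕ) := by exact_mod_cast hU
  set B := S.image (fun s => s / (T : ℤ)) with hB
  have hBne : B.Nonempty := hS.image _
  -- coarse cells
  have hUimg : B.image (fun b => b / (q : ℤ)) = S.image (fun s => s / ((T * q : ℕ) : ℤ)) := by
    rw [hB, Finset.image_image]
    apply Finset.image_congr
    intro s _
    simp only [Function.comp]
    push_cast
    rw [Int.ediv_ediv_of_nonneg hTz.le]
  obtain ⟨I, hI, hIc⟩ := pigeon B hBne (fun b => b / (q : ℤ))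
  rw [hUimg] at hIc
  set BI := B.filter (fun b => b / (q : ℤ) = I) with hBI
  have hfU : 0 < cells (T * q) S := by
    unfold cells; exact (hS.image _).card_pos
  have hIc' : cells T S ≤ BI.card * cells (T * q) S := hIc
  have hν : 4 ≤ BI.card := by
    have := h4.trans hIc'
    exact Nat.le_of_mul_le_mul_right this hfU
  have hBIne : BI.Nonempty := Finset.card_pos.1 (by omega)
  obtain ⟨ρ, hρ, hρc⟩ := pigeon BI hBIne (fun b => b % 3)
  have himg3 : (BI.image (fun b => b % 3)).card ≤ 3 := by
    have : BI.image (fun b => b % 3) ⊆ Finset.Ico 0 3 := by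
      intro x hx
      obtain ⟨b, _, rfl⟩ := Finset.mem_image.1 hx
      simp only [Finset.mem_Ico]; omega
    exact (Finset.card_le_card this).trans (by simp)
  set BP := BI.filter (fun b => b % 3 = ρ) with hBP
  have hp3 : BI.card ≤ BP.card * 3 := hρc.trans (Nat.mul_le_mul_left _ himg3)
  -- choose representatives
  have hrep : ∀ b ∈ B, ∃ s ∈ S, s / (T : ℤ) = b := by
    intro b hb; simpa [hB] using hb
  choose! rep hrepS hrepT using hrep
  set P := BP.image rep with hPdef
  have hBPB : ∀ b ∈ BP, b ∈ B := fun b hb =>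
    (Finset.mem_filter.1 (Finset.mem_filter.1 hb).1).1
  have hinj : Set.InjOn rep (BP : Set ℤ) := by
    intro b hb b' hb' h
    rw [← hrepT b (hBPB b hb), ← hrepT b' (hBPB b' hb'), h]
  have hPc : P.card = BP.card := Finset.card_image_of_injOn hinj
  have hPne : P.Nonempty := Finset.card_pos.1 (by omega)
  have hPS : P ⊆ S := by
    intro x hx
    obtain ⟨b, hb, rfl⟩ := Finset.mem_image.1 hx
    exact hrepS b (hBPB b hb)
  have hb_bounds : ∀ b ∈ B, (T : ℤ) * b ≤ rep b ∧ rep b < T * b + T := by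
    intro b hb
    have h1 := Int.mul_ediv_add_emod (rep b) T
    have h2 := Int.emod_nonneg (rep b) hTz.ne'
    have h3 := Int.emod_lt_of_pos (rep b) hTz
    rw [hrepT b hb] at h1
    constructor <;> linarith
  have hsep : ∀ x ∈ P, ∀ y ∈ P, x ≠ y → (2 * T : ℤ) ≤ |x - y| := by
    have aux : ∀ b ∈ BP, ∀ b' ∈ BP, b < b' → (2 * T : ℤ) ≤ |rep b - rep b'| := by
      intro b hb b' hb' hlt
      have h1 := (Finset.mem_filter.1 hb).2
      have h2 := (Finset.mem_filter.1 hb').2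
      have h3 : b + 3 ≤ b' := by omega
      obtain ⟨_, h5⟩ := hb_bounds b (hBPB b hb)
      obtain ⟨h6, _⟩ := hb_bounds b' (hBPB b' hb')
      have h7 : (T : ℤ) * (b + 3) ≤ T * b' := mul_le_mul_of_nonneg_left h3 hTz.le
      rw [abs_sub_comm]
      refine le_trans ?_ (le_abs_self _)
      linarith
    intro x hx y hy hxy
    obtain ⟨b, hb, rfl⟩ := Finset.mem_image.1 hx
    obtain ⟨b', hb', rfl⟩ := Finset.mem_image.1 hy
    rcases lt_trichotomy b b' with h | h | h
    · exact aux b hb b' hb' h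
    · exact absurd (by rw [h]) hxy
    · rw [abs_sub_comm]; exact aux b' hb' b hb h
  have hPd : ∀ x ∈ P, ∀ y ∈ P, |x - y| ≤ (T * q : ℕ) := by
    have cellb : ∀ b ∈ BP, ((T * q : ℕ) : ℤ) * I ≤ rep b ∧ rep b < (T * q : ℕ) * I + (T * q : ℕ) := by
      intro b hb
      have h1 : rep b / ((T * q : ℕ) : ℤ) = I := by
        have := (Finset.mem_filter.1 (Finset.mem_filter.1 hb).1).2
        rw [← hrepT b (hBPB b hb), Int.ediv_ediv_of_nonneg hTz.le] at this
        push_cast; exact this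
      have h2 := Int.mul_ediv_add_emod (rep b) (T * q : ℕ)
      have h3 := Int.emod_nonneg (rep b) hUz.ne'
      have h4 := Int.emod_lt_of_pos (rep b) hUz
      rw [h1] at h2
      constructor <;> linarith
    intro x hx y hy
    obtain ⟨b, hb, rfl⟩ := Finset.mem_image.1 hx
    obtain ⟨b', hb', rfl⟩ := Finset.mem_image.1 hy
    have h1 := cellb b hb
    have h2 := cellb b' hb'
    rw [abs_le]; constructor <;> linarith
  obtain ⟨Q, hQs, hQne, hQsep, hQc⟩ := sep_sums P hPne (2 * T) (by positivity) hsep n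
  have hQd := diam_nsmul P _ hPd n
  refine ⟨Q + Z, ?_, ?_, ?_⟩
  · rw [add_nsmul]
    exact Finset.add_subset_add (hQs.trans (Finset.nsmul_subset_nsmul_left hPS)) hZ
  · intro z hz z' hz'
    obtain ⟨a, ha, b, hb, rfl⟩ := Finset.mem_add.1 hz
    obtain ⟨a', ha', b', hb', rfl⟩ := Finset.mem_add.1 hz'
    have h1 := hQd a (hQs ha) a' (hQs ha')
    have h2 := hd b hb b' hb'
    have : a + b - (a' + b') = (a - a') + (b - b') := by ring
    rw [this]
    have h3 := abs_add_le (a - a') (b - b')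
    have h4 : (2 * T : ℤ) ≤ n * (T * q : ℕ) := by
      have : 2 * T ≤ n * (T * q) := by
        calc 2 * T = 2 * (T * 1) := by ring
          _ ≤ n * (T * q) := by gcongr; omega
      exact_mod_cast this
    push_cast at *
    linarith
  · have hcard : (Q + Z).card = Q.card * Z.card := by
      rw [Finset.card_add_iff]
      rintro ⟨a, b⟩ hab ⟨a', b'⟩ hab' he
      simp only [Set.mem_prod, Finset.mem_coe] at hab hab'
      simp only at he
      by_cases haa : a = a'
      · subst haa; simp at he; rw [he]
      · exfalso
        have h1 := hQsep a hab.1 a' hab'.1 haa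
        have h2 := hd b' hab'.2 b hab.2
        have h3 : a - a' = b' - b := by linarith
        rw [h3] at h1
        linarith
    rw [hcard]
    have hQ2 : n * BI.card ≤ 6 * Q.card := by
      rw [hPc] at hQc
      obtain ⟨p', hp'⟩ : ∃ p', BP.card = p' + 2 := ⟨BP.card - 2, by omega⟩
      rw [hp'] at hQc hp3
      have h1 : n * BI.card ≤ n * ((p' + 2) * 3) := Nat.mul_le_mul_left _ hp3
      have h2 : p' + 2 - 1 = p' + 1 := by omega
      rw [h2] at hQc
      nlinarith
    calc n * cells T S * Z.card ≤ n * (BI.card * cells (T * q) S) * Z.card := by gcongr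
      _ = (n * BI.card) * (cells (T * q) S * Z.card) := by ring
      _ ≤ (6 * Q.card) * (cells (T * q) S * Z.card) := by gcongr
      _ = _ := by ring

lemma cut_iter (S : Finset ℤ) (hS : S.Nonempty) (n J : ℕ) (hn : 2 ≤ n)
    (hSJ : ∀ s ∈ S, 0 ≤ s ∧ s < (n : ℤ) ^ J) (R : ℝ) (hR : 0 < R)
    (l : ℕ) (e : ℕ → ℕ) (he0 : e 0 = 0) (hlt : ∀ i < l, e i < e (i + 1)) (heJ : ∀ i ≤ l, e i ≤ J)
    (hcut : ∀ i < l, (cells (n ^ (J - e (i + 1))) S : ℝ) ≤ R * cells (n ^ (J - (e (i + 1) - 1))) S)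
    (h4 : ∀ i < l, 4 * cells (n ^ (J - e i)) S ≤ cells (n ^ (J - (e (i + 1) - 1))) S) :
    (n / (6 * R)) ^ l * (S.card : ℝ) ≤ ((n * l + 1) • S).card := by
  classical
  have key : ∀ k ≤ l, ∃ Z : Finset ℤ, Z ⊆ (n * k + 1) • S ∧
      (∀ z ∈ Z, ∀ z' ∈ Z, |z - z'| < 2 * (n * n ^ (J - e (l - k)) : ℕ)) ∧
      (n / (6 * R)) ^ k * (S.card : ℝ) ≤ Z.card * cells (n ^ (J - e (l - k))) S := by
    intro k
    induction k with
    | zero =>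
      intro _
      obtain ⟨y, hy, hyc⟩ := pigeon S hS (fun s => s / ((n ^ (J - e l) : ℕ) : ℤ))
      refine ⟨S.filter (fun x => x / ((n ^ (J - e l) : ℕ) : ℤ) = y), ?_, ?_, ?_⟩
      · simp [Finset.filter_subset]
      · intro z hz z' hz'
        have h1 := (Finset.mem_filter.1 hz).2
        have h2 := (Finset.mem_filter.1 hz').2
        rw [Nat.sub_zero]
        set U := n ^ (J - e l) with hU
        have hUp : (0 : ℤ) < (U : ℤ) := by
          have : 0 < U := by positivity
          exact_mod_cast this
        have a1 := Int.mul_ediv_add_emod z U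
        have a2 := Int.emod_nonneg z hUp.ne'
        have a3 := Int.emod_lt_of_pos z hUp
        have b1 := Int.mul_ediv_add_emod z' U
        have b2 := Int.emod_nonneg z' hUp.ne'
        have b3 := Int.emod_lt_of_pos z' hUp
        rw [h1] at a1
        rw [h2] at b1
        have h5 : (U : ℤ) ≤ (n * U : ℕ) := by
          have : U ≤ n * U := Nat.le_mul_of_pos_left _ (by omega)
          exact_mod_cast this
        rw [abs_lt]; constructor <;> linarith
      · simp only [pow_zero, one_mul, Nat.sub_zero]
        exact_mod_cast hyc
    | succ k ih =>
      intro hk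
      obtain ⟨Z, hZs, hZd, hZc⟩ := ih (by omega)
      set i := l - (k + 1) with hi
      have hik : l - k = i + 1 := by omega
      rw [hik] at hZd hZc
      have hil : i < l := by omega
      have h1 := hlt i hil
      have h2 := heJ (i + 1) (by omega)
      have hTe : n * n ^ (J - e (i + 1)) = n ^ (J - (e (i + 1) - 1)) := by
        rw [← pow_succ']; congr 1; omega
      rw [hTe] at hZd
      obtain ⟨Z', hZs', hZd', hZc'⟩ := cut_step S Z hS (n * k + 1) n hn
        (n ^ (J - (e (i + 1) - 1))) (n ^ (J - e i)) (by positivity)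
        (pow_dvd_pow _ (by omega)) (by positivity) hZs hZd (h4 i hil)
      refine ⟨Z', ?_, hZd', ?_⟩
      · convert hZs' using 2; ring
      · have hc := hcut i hil
        have hZr : (n : ℝ) * cells (n ^ (J - (e (i + 1) - 1))) S * Z.card ≤
            6 * (Z'.card * cells (n ^ (J - e i)) S) := by exact_mod_cast hZc'
        rw [pow_succ]
        calc (n / (6 * R)) ^ k * (n / (6 * R)) * (S.card : ℝ)
            = (n / (6 * R)) * ((n / (6 * R)) ^ k * (S.card : ℝ)) := by ring
          _ ≤ (n / (6 * R)) * (Z.card * cells (n ^ (J - e (i + 1))) S) := by gcongr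
          _ ≤ (n / (6 * R)) * (Z.card * (R * cells (n ^ (J - (e (i + 1) - 1))) S)) := by gcongr
          _ = (n * cells (n ^ (J - (e (i + 1) - 1))) S * Z.card) / 6 := by field_simp
          _ ≤ _ := by linarith
  obtain ⟨Z, hZs, _, hZc⟩ := key l le_rfl
  rw [Nat.sub_self, he0, Nat.sub_zero] at hZc
  have h1 : cells (n ^ J) S ≤ 1 := by
    unfold cells
    refine Finset.card_le_one.2 ?_
    intro a ha b hb
    obtain ⟨x, hx, rfl⟩ := Finset.mem_image.1 ha
    obtain ⟨y, hy, rfl⟩ := Finset.mem_image.1 hb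
    have hx' := hSJ x hx
    have hy' := hSJ y hy
    push_cast
    rw [Int.ediv_eq_zero_of_lt hx'.1 hx'.2, Int.ediv_eq_zero_of_lt hy'.1 hy'.2]
  calc _ ≤ _ := hZc
    _ ≤ (Z.card : ℝ) * 1 := by gcongr; exact_mod_cast h1
    _ ≤ _ := by rw [mul_one]; exact_mod_cast Finset.card_le_card hZs

lemma cells_mono (T q : ℕ) (S : Finset ℤ) : cells (T * q) S ≤ cells T S := by
  classical
  unfold cells
  have : S.image (fun s => s / ((T * q : ℕ) : ℤ)) =
      (S.image (fun s => s / (T : ℤ))).image (fun b => b / (q : ℤ)) := by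
    rw [Finset.image_image]
    apply Finset.image_congr
    intro s _
    simp only [Function.comp]
    push_cast
    rw [Int.ediv_ediv_of_nonneg (by positivity)]
  rw [this]
  exact Finset.card_image_le

lemma cells_step (T q : ℕ) (hq : 0 < q) (S : Finset ℤ) : cells T S ≤ q * cells (T * q) S := by
  classical
  unfold cells
  have hqz : (0 : ℤ) < q := by exact_mod_cast hq
  have : S.image (fun s => s / ((T * q : ℕ) : ℤ)) =
      (S.image (fun s => s / (T : ℤ))).image (fun b => b / (q : ℤ)) := by
    rw [Finset.image_image]
    apply Finset.image_congr
    intro s _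
    simp only [Function.comp]
    push_cast
    rw [Int.ediv_ediv_of_nonneg (by positivity)]
  rw [this]
  refine Finset.card_le_mul_card_image _ _ ?_
  intro b _
  have : (S.image (fun s => s / (T : ℤ))).filter (fun x => x / (q : ℤ) = b) ⊆
      Finset.Ico (q * b : ℤ) (q * b + q) := by
    intro x hx
    have h1 := (Finset.mem_filter.1 hx).2
    have a1 := Int.mul_ediv_add_emod x q
    have a2 := Int.emod_nonneg x hqz.ne'
    have a3 := Int.emod_lt_of_pos x hqz
    rw [h1] at a1
    rw [Finset.mem_Ico]; constructor <;> linarith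
  refine (Finset.card_le_card this).trans ?_
  simp

lemma top_lemma (f : ℕ → ℕ) (n J l B M j0 : ℕ) (σ ε K' : ℝ) (hn : 2 ≤ n) (_hσ : 0 < σ)
    (hε0 : 0 < ε) (hε1 : ε < 1) (hK' : 0 < K')
    (hmono : ∀ i j, i ≤ j → j ≤ J → f i ≤ f j) (hup : ∀ j ≤ J, f j ≤ n ^ j)
    (hlow : ∀ j ≤ J, (n : ℝ) ^ (σ * j) ≤ K' * n * f j)
    (hno : ¬ ∃ e : ℕ → ℕ, e 0 = 0 ∧ (∀ i < l, e i < e (i + 1)) ∧ (∀ i ≤ l, e i ≤ J) ∧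
      (∀ i < l, (f (e (i + 1)) : ℝ) ≤ (n : ℝ) ^ (1 - ε / 2) * f (e (i + 1) - 1)) ∧
      (∀ i < l, 4 * f (e i) ≤ f (e (i + 1) - 1)))
    (hj0 : 1 ≤ j0) (hBJ : B ^ l * j0 ≤ J) (hM : 4 ≤ σ * M) (hM1 : 1 ≤ M)
    (hMB : (M : ℝ) ≤ ε / 2 * B) (hnK : 4 * K' ≤ (n : ℝ) ^ 2) :
    ∃ i, 1 ≤ i ∧ i ≤ l ∧ (n : ℝ) ^ ((1 - ε) * (B ^ i * j0 : ℕ)) ≤ f (B ^ i * j0) := by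
  by_contra! hcon
  apply hno
  have hn0 : (0 : ℝ) < n := by positivity
  have hn1 : (1 : ℝ) ≤ n := by exact_mod_cast (by omega : 1 ≤ n)
  have hMBn : M < B := by
    have : (M : ℝ) < B := by
      have hB0 : (0 : ℝ) < B := by
        by_contra h
        have h1 : (1 : ℝ) ≤ M := by exact_mod_cast hM1
        nlinarith
      nlinarith
    exact_mod_cast this
  have hBpos : 1 ≤ B := by omega
  have hjJ : ∀ i ≤ l, B ^ i * j0 ≤ J := fun i hi =>
    (Nat.mul_le_mul_right _ (Nat.pow_le_pow_right hBpos hi)).trans hBJ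
  have hj1 : ∀ i, 1 ≤ B ^ i * j0 := fun i => Nat.mul_pos (Nat.pow_pos (by omega)) hj0
  -- cut existence
  have hex : ∀ i < l, ∃ e, M * (B ^ i * j0) < e ∧ e ≤ B ^ (i + 1) * j0 ∧
      (f e : ℝ) ≤ (n : ℝ) ^ (1 - ε / 2) * f (e - 1) := by
    intro i hi
    by_contra! hno2
    set a := M * (B ^ i * j0) with ha
    have hb : B ^ (i + 1) * j0 = B * (B ^ i * j0) := by ring
    have hab : a ≤ B ^ (i + 1) * j0 := by rw [hb, ha]; gcongr
    have hind : ∀ d, a + d ≤ B ^ (i + 1) * j0 → ((n : ℝ) ^ (1 - ε / 2)) ^ d * 1 ≤ f (a + d) := by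
      intro d
      induction d with
      | zero =>
        intro h
        simp only [pow_zero, one_mul, add_zero]
        have h2 := hlow a (by have := hjJ (i+1) (by omega); omega)
        have : 0 < f a := by
          rcases Nat.eq_zero_or_pos (f a) with h0 | h0
          · rw [h0] at h2
            have : (0 : ℝ) < (n : ℝ) ^ (σ * a) := by positivity
            simp at h2; linarith
          · exact h0
        exact_mod_cast this
      | succ d ih =>
        intro h
        have h1 := ih (by omega)
        have h2 := hno2 (a + (d + 1)) (by omega) h
        have e1 : a + (d + 1) - 1 = a + d := by omega
        rw [e1] at h2
        calc ((n : ℝ) ^ (1 - ε / 2)) ^ (d + 1) * 1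
            = (n : ℝ) ^ (1 - ε / 2) * (((n : ℝ) ^ (1 - ε / 2)) ^ d * 1) := by ring
          _ ≤ (n : ℝ) ^ (1 - ε / 2) * f (a + d) := by gcongr
          _ ≤ _ := h2.le
    have h1 := hind (B ^ (i + 1) * j0 - a) (by omega)
    have e1 : a + (B ^ (i + 1) * j0 - a) = B ^ (i + 1) * j0 := by omega
    rw [e1, mul_one] at h1
    have h2 := hcon (i + 1) (by omega) (by omega)
    have h3 : (n : ℝ) ^ ((1 - ε) * (B ^ (i + 1) * j0 : ℕ)) ≤
        ((n : ℝ) ^ (1 - ε / 2)) ^ (B ^ (i + 1) * j0 - a) := by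
      rw [← Real.rpow_natCast, ← Real.rpow_mul hn0.le]
      apply Real.rpow_le_rpow_of_exponent_le hn1
      rw [Nat.cast_sub hab, hb, ha]
      push_cast
      set x : ℝ := (B : ℝ) ^ i * j0 with hx
      have hx0 : 0 ≤ x := by positivity
      have : (M : ℝ) * x ≤ ε / 2 * B * x := by gcongr
      have hBx : 0 ≤ (B : ℝ) * x := by positivity
      nlinarith [mul_nonneg hBx (sq_nonneg ε)]
    linarith
  choose! c hc1 hc2 hc3 using hex
  let e : ℕ → ℕ := fun i => if i = 0 then 0 else c (i - 1)
  have he0 : e 0 = 0 := by simp [e]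
  have hes : ∀ i, e (i + 1) = c i := by intro i; simp [e]
  have heup : ∀ i ≤ l, e i ≤ B ^ i * j0 := by
    intro i hi
    rcases i with _ | i
    · rw [he0]; omega
    · rw [hes]; exact hc2 i (by omega)
  refine ⟨e, he0, ?_, fun i hi => (heup i hi).trans (hjJ i hi), ?_, ?_⟩
  · intro i hi
    rw [hes]
    have h1 := heup i hi.le
    have h2 := hc1 i hi
    have h3 : B ^ i * j0 ≤ M * (B ^ i * j0) := Nat.le_mul_of_pos_left _ (by omega)
    omega
  · intro i hi; rw [hes]; exact hc3 i hi
  · intro i hi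
    rw [hes]
    have h1 := heup i hi.le
    have h2 := hc1 i hi
    have h2' := hc2 i hi
    have hJ := hjJ (i + 1) (by omega)
    have h3 : f (e i) ≤ n ^ (B ^ i * j0) := (hup (e i) (h1.trans (hjJ i hi.le))).trans
      (Nat.pow_le_pow_right (by omega) h1)
    have h4 : f (M * (B ^ i * j0)) ≤ f (c i - 1) := hmono _ _ (by omega) (by omega)
    have h5 := hlow (M * (B ^ i * j0)) (by omega)
    set x := B ^ i * j0 with hx
    have hx1 : 1 ≤ x := hj1 i
    have h6 : (n : ℝ) ^ (4 * x) ≤ (n : ℝ) ^ (σ * (M * x : ℕ)) := by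
      rw [← Real.rpow_natCast]
      apply Real.rpow_le_rpow_of_exponent_le hn1
      push_cast
      have : (0 : ℝ) ≤ x := by positivity
      nlinarith
    have h7 : (n : ℝ) ^ (x + 3) ≤ (n : ℝ) ^ (4 * x) := pow_le_pow_right₀ hn1 (by omega)
    have h8 : (n : ℝ) ^ (x + 3) ≤ K' * n * f (M * x) := h7.trans (h6.trans h5)
    have h9 : (n : ℝ) ^ (x + 3) = n ^ x * n ^ 2 * n := by ring
    rw [h9] at h8
    have h10 : (n : ℝ) ^ x * n ^ 2 ≤ K' * f (M * x) := by
      have : (n : ℝ) ^ x * n ^ 2 * n ≤ K' * f (M * x) * n := by linarith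
      exact le_of_mul_le_mul_right this hn0
    have h11 : (n : ℝ) ^ x * (4 * K') ≤ K' * f (M * x) :=
      le_trans (by gcongr) h10
    have h12 : 4 * (n : ℝ) ^ x ≤ f (M * x) := by
      have : (4 * (n : ℝ) ^ x) * K' ≤ f (M * x) * K' := by linarith
      exact le_of_mul_le_mul_right this hK'
    have h13 : 4 * n ^ x ≤ f (M * x) := by exact_mod_cast h12
    omega

lemma minimizer (f : ℕ → ℕ) (n J ja C6 : ℕ) (σ σ' ε K' : ℝ) (hn : 2 ≤ n) (hσ' : 0 < σ')
    (hσσ : σ' < σ) (hε0 : 0 < ε) (hK' : 0 < K')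
    (hstep : ∀ j < J, f (j + 1) ≤ n * f j) (hup : ∀ j ≤ J, f j ≤ n ^ j)
    (hlow : ∀ j ≤ J, (n : ℝ) ^ (σ * j) ≤ K' * n * f j)
    (hja : 1 ≤ ja) (hjb : C6 * ja ≤ J) (hC6 : 3 / (σ - σ') ≤ C6) (hC61 : 1 ≤ C6)
    (hnK : K' ≤ n)
    (hb : (n : ℝ) ^ ((1 - ε / C6) * (C6 * ja : ℕ)) ≤ f (C6 * ja)) :
    ∃ j, ja ≤ j ∧ j ≤ C6 * ja ∧ (n : ℝ) ^ ((1 - ε) * j) ≤ f j ∧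
      ∀ j', j ≤ j' → j' ≤ J → (f j : ℝ) * (n : ℝ) ^ (σ' * ((j' : ℝ) - j)) ≤ f j' := by
  have hn0 : (0 : ℝ) < n := by positivity
  have hn1 : (1 : ℝ) < n := by exact_mod_cast (by omega : 1 < n)
  have hjaJ : ja ≤ J := le_trans (Nat.le_mul_of_pos_left _ (by omega)) hjb
  obtain ⟨j, hj, hmin⟩ := Finset.exists_min_image (Finset.Icc ja J)
    (fun j => (f j : ℝ) * (n : ℝ) ^ (-σ' * j)) ⟨ja, Finset.mem_Icc.2 ⟨le_rfl, hjaJ⟩⟩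
  rw [Finset.mem_Icc] at hj
  have hjub : j ≤ C6 * ja := by
    have h1 := hmin ja (Finset.mem_Icc.2 ⟨le_rfl, hjaJ⟩)
    have h2 := hlow j hj.2
    have h3 : (f ja : ℝ) ≤ (n : ℝ) ^ (ja : ℝ) := by
      rw [Real.rpow_natCast]; exact_mod_cast hup ja hjaJ
    have h4 : (f ja : ℝ) * (n : ℝ) ^ (-σ' * ja) ≤ (n : ℝ) ^ (ja : ℝ) := by
      calc _ ≤ (n : ℝ) ^ (ja : ℝ) * 1 := by
            gcongr
            apply Real.rpow_le_one_of_one_le_of_nonpos hn1.le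
            have : (0 : ℝ) ≤ ja := by positivity
            nlinarith
        _ = _ := mul_one _
    have h5 : (n : ℝ) ^ ((σ - σ') * j) ≤ (n : ℝ) ^ (3 * (ja : ℝ)) := by
      calc (n : ℝ) ^ ((σ - σ') * j) = (n : ℝ) ^ (σ * j) * (n : ℝ) ^ (-σ' * j) := by
            rw [← Real.rpow_add hn0]; ring_nf
        _ ≤ (K' * n * f j) * (n : ℝ) ^ (-σ' * j) := by gcongr
        _ = K' * n * (f j * (n : ℝ) ^ (-σ' * j)) := by ring
        _ ≤ n * n * (n : ℝ) ^ (ja : ℝ) := by gcongr; exact h1.trans h4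
        _ = (n : ℝ) ^ (2 + (ja : ℝ)) := by
            rw [Real.rpow_add hn0, Real.rpow_two]; ring
        _ ≤ _ := by
            apply Real.rpow_le_rpow_of_exponent_le hn1.le
            have : (1 : ℝ) ≤ ja := by exact_mod_cast hja
            linarith
    have h6 := (Real.rpow_le_rpow_left_iff hn1).1 h5
    have hs : 0 < σ - σ' := by linarith
    have h7 : (j : ℝ) ≤ 3 / (σ - σ') * ja := by
      rw [div_mul_eq_mul_div, le_div_iff₀ hs]; linarith
    have h8 : (j : ℝ) ≤ C6 * ja := h7.trans (by gcongr)
    exact_mod_cast h8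
  refine ⟨j, hj.1, hjub, ?_, ?_⟩
  · have hd : ∀ d, j + d ≤ J → f (j + d) ≤ n ^ d * f j := by
      intro d
      induction d with
      | zero => intro _; simp
      | succ d ih =>
        intro h
        have h1 := ih (by omega)
        have h2 := hstep (j + d) (by omega)
        calc f (j + (d + 1)) ≤ n * f (j + d) := h2
          _ ≤ n * (n ^ d * f j) := by gcongr
          _ = _ := by ring
    have h1 := hd (C6 * ja - j) (by omega)
    rw [show j + (C6 * ja - j) = C6 * ja by omega] at h1
    have h2 : (f (C6 * ja) : ℝ) ≤ (n : ℝ) ^ (((C6 * ja : ℕ) : ℝ) - j) * f j := by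
      rw [← Nat.cast_sub hjub, Real.rpow_natCast]; exact_mod_cast h1
    have h3 := hb.trans h2
    have h4 : (n : ℝ) ^ ((1 - ε / C6) * (C6 * ja : ℕ) - (((C6 * ja : ℕ) : ℝ) - j)) ≤ f j := by
      rw [Real.rpow_sub hn0, div_le_iff₀ (by positivity)]
      linarith
    refine le_trans ?_ h4
    apply Real.rpow_le_rpow_of_exponent_le hn1.le
    push_cast
    have hC : (C6 : ℝ) ≠ 0 := by positivity
    have h5 : (ja : ℝ) ≤ j := by exact_mod_cast hj.1
    have h6 : ε / C6 * (C6 * ja) = ε * ja := by field_simp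
    nlinarith
  · intro j' h1 h2
    have h3 := hmin j' (Finset.mem_Icc.2 ⟨hj.1.trans h1, h2⟩)
    have h4 : (n : ℝ) ^ (σ' * ((j' : ℝ) - j)) = (n : ℝ) ^ (-σ' * j) * (n : ℝ) ^ (σ' * j') := by
      rw [← Real.rpow_add hn0]; ring_nf
    have h5 : (n : ℝ) ^ (-σ' * j') * (n : ℝ) ^ (σ' * j') = 1 := by
      rw [← Real.rpow_add hn0]; ring_nf; simp
    calc (f j : ℝ) * (n : ℝ) ^ (σ' * ((j' : ℝ) - j))
        = (f j * (n : ℝ) ^ (-σ' * j)) * (n : ℝ) ^ (σ' * j') := by rw [h4]; ring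
      _ ≤ (f j' * (n : ℝ) ^ (-σ' * j')) * (n : ℝ) ^ (σ' * j') := by gcongr
      _ = f j' := by rw [mul_assoc, h5, mul_one]

lemma prop1 (σ σ' ε K' : ℝ) (Λ : ℕ) (hσ' : 0 < σ') (hσσ : σ' < σ)
    (hε0 : 0 < ε) (hε1 : ε < 1) (hK' : 0 < K') :
    ∃ n m0 : ℕ, 2 ≤ n ∧ 1 ≤ m0 ∧ ∀ J : ℕ, m0 ≤ J → ∀ S : Finset ℤ, S.Nonempty →
      (∀ s ∈ S, 0 ≤ s ∧ s < (n : ℤ) ^ J) → (S + S).card ≤ Λ * S.card →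
      (∀ j ≤ J, (n : ℝ) ^ (σ * j) ≤ K' * n * cells (n ^ (J - j)) S) →
      ∃ j, 1 ≤ j ∧ j < J ∧ J ≤ m0 * j ∧
        (n : ℝ) ^ ((1 - ε) * j) ≤ cells (n ^ (J - j)) S ∧
        ∀ j', j ≤ j' → j' ≤ J → (cells (n ^ (J - j)) S : ℝ) * (n : ℝ) ^ (σ' * ((j' : ℝ) - j))
          ≤ cells (n ^ (J - j')) S := by
  have hσ : 0 < σ := hσ'.trans hσσ
  obtain ⟨C6, hC6⟩ := exists_nat_ge (max 1 (3 / (σ - σ')))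
  have hC61 : 1 ≤ C6 := by exact_mod_cast (le_max_left _ _).trans hC6
  have hC6' := (le_max_right _ _).trans hC6
  set ε2 := ε / C6 with hε2
  have hC6r : (1 : ℝ) ≤ C6 := by exact_mod_cast hC61
  have hε20 : 0 < ε2 := by positivity
  have hε21 : ε2 < 1 := lt_of_le_of_lt (div_le_self hε0.le hC6r) hε1
  set D := Λ ^ 4 with hD
  obtain ⟨l, hl⟩ := exists_nat_ge (2 * (D + 1) / ε2)
  obtain ⟨M, hM⟩ := exists_nat_ge (max 1 (4 / σ))
  have hM1 : 1 ≤ M := by exact_mod_cast (le_max_left _ _).trans hM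
  have hM4 : 4 ≤ σ * M := by
    have := (le_max_right _ _).trans hM
    rw [div_le_iff₀ hσ] at this; linarith
  obtain ⟨B, hB⟩ := exists_nat_ge (max 1 (2 * M / ε2))
  have hB1 : 1 ≤ B := by exact_mod_cast (le_max_left _ _).trans hB
  have hMB : (M : ℝ) ≤ ε2 / 2 * B := by
    have := (le_max_right _ _).trans hB
    rw [div_le_iff₀ hε20] at this; linarith
  obtain ⟨n, hn⟩ := exists_nat_ge (max (2 : ℝ) (max (4 * K') (6 ^ l * (l + 1) ^ D * Λ ^ 2 + 1)))
  have hn2 : 2 ≤ n := by exact_mod_cast (le_max_left _ _).trans hn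
  have hnK : 4 * K' ≤ n := (le_max_left _ _).trans ((le_max_right _ _).trans hn)
  have hnb : (6 ^ l * (l + 1) ^ D * Λ ^ 2 + 1 : ℝ) ≤ n :=
    (le_max_right _ _).trans ((le_max_right _ _).trans hn)
  have hn0 : (0 : ℝ) < n := by positivity
  have hn1 : (1 : ℝ) ≤ n := by exact_mod_cast (by omega : 1 ≤ n)
  set W := 2 * (B ^ l * C6) with hW
  have hW0 : 1 ≤ B ^ l * C6 := Nat.mul_pos (Nat.pow_pos hB1) hC61
  have hW1 : 1 ≤ W := by omega
  refine ⟨n, 2 * W, hn2, by omega, ?_⟩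
  intro J hJ S hS hSJ hSS hlow
  set f : ℕ → ℕ := fun j => cells (n ^ (J - j)) S with hf
  have hstep : ∀ j < J, f (j + 1) ≤ n * f j := by
    intro j hj
    have := cells_step (n ^ (J - (j + 1))) n (by omega) S
    rw [← pow_succ, show J - (j + 1) + 1 = J - j by omega] at this
    exact this
  have hmono : ∀ i j, i ≤ j → j ≤ J → f i ≤ f j := by
    intro i j hij hj
    have := cells_mono (n ^ (J - j)) (n ^ (j - i)) S
    rw [← pow_add, show J - j + (j - i) = J - i by omega] at this
    exact this
  have hup : ∀ j ≤ J, f j ≤ n ^ j := by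
    intro j
    induction j with
    | zero =>
      intro _
      simp only [hf, pow_zero, Nat.sub_zero]
      unfold cells
      refine Finset.card_le_one.2 ?_
      intro a ha b hb
      obtain ⟨x, hx, rfl⟩ := Finset.mem_image.1 ha
      obtain ⟨y, hy, rfl⟩ := Finset.mem_image.1 hb
      have hx' := hSJ x hx
      have hy' := hSJ y hy
      push_cast
      rw [Int.ediv_eq_zero_of_lt hx'.1 hx'.2, Int.ediv_eq_zero_of_lt hy'.1 hy'.2]
    | succ j ih =>
      intro hj
      calc f (j + 1) ≤ n * f j := hstep j (by omega)
        _ ≤ n * n ^ j := by gcongr; exact ih (by omega)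
        _ = _ := by ring
  set j00 := J / W with hj00
  have hj001 : 1 ≤ j00 := (Nat.one_le_div_iff (by omega)).2 (by omega)
  have hj00J : W * j00 ≤ J := Nat.mul_div_le J W
  have hJub : J ≤ 2 * W * j00 := by
    have h1 := Nat.lt_mul_div_succ J (by omega : 0 < W)
    have h2 : W * (J / W + 1) = W * j00 + W := by rw [hj00]; ring
    have h3 : W * 1 ≤ W * j00 := by gcongr
    rw [h2] at h1
    have : 2 * W * j00 = W * j00 + W * j00 := by ring
    omega
  have hSpos : (0 : ℝ) < S.card := by exact_mod_cast hS.card_pos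
  have hno : ¬ ∃ e : ℕ → ℕ, e 0 = 0 ∧ (∀ i < l, e i < e (i + 1)) ∧ (∀ i ≤ l, e i ≤ J) ∧
      (∀ i < l, (f (e (i + 1)) : ℝ) ≤ (n : ℝ) ^ (1 - ε2 / 2) * f (e (i + 1) - 1)) ∧
      (∀ i < l, 4 * f (e i) ≤ f (e (i + 1) - 1)) := by
    rintro ⟨e, he0, hlt, heJ, hcut, h4⟩
    have h1 := cut_iter S hS n J hn2 hSJ ((n : ℝ) ^ (1 - ε2 / 2)) (by positivity) l e he0 hlt heJ
      hcut h4
    have h2 := poly_growth Λ S hS hSS (n * l)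
    have h2' : (((n * l + 1) • S).card : ℝ) ≤ ((n * l + 1) ^ D * Λ ^ 2 : ℝ) * S.card := by
      exact_mod_cast h2
    have h3 := le_of_mul_le_mul_right (h1.trans h2') hSpos
    have h4 : (n : ℝ) / (6 * (n : ℝ) ^ (1 - ε2 / 2)) = (n : ℝ) ^ (ε2 / 2) / 6 := by
      have : (n : ℝ) = (n : ℝ) ^ (ε2 / 2) * (n : ℝ) ^ (1 - ε2 / 2) := by
        rw [← Real.rpow_add hn0]; norm_num
      have h0 : (n : ℝ) ^ (1 - ε2 / 2) ≠ 0 := by positivity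
      nth_rewrite 1 [this]
      field_simp
    rw [h4, div_pow, div_le_iff₀ (by positivity)] at h3
    have h5 : (n : ℝ) ^ (D + 1) ≤ ((n : ℝ) ^ (ε2 / 2)) ^ l := by
      rw [← Real.rpow_natCast, ← Real.rpow_natCast _ l, ← Real.rpow_mul hn0.le]
      apply Real.rpow_le_rpow_of_exponent_le hn1
      rw [div_le_iff₀ hε20] at hl
      push_cast
      have : (D : ℝ) = ((D : ℕ) : ℝ) := rfl
      linarith
    have h6 : ((n : ℝ) * l + 1) ^ D ≤ (n : ℝ) ^ D * (l + 1) ^ D := by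
      rw [← mul_pow]
      gcongr
      nlinarith
    have h7 : (n : ℝ) ^ D * n ≤ (n : ℝ) ^ D * (6 ^ l * (l + 1) ^ D * Λ ^ 2) := by
      calc (n : ℝ) ^ D * n = (n : ℝ) ^ (D + 1) := by ring
        _ ≤ _ := h5.trans h3
        _ ≤ (n : ℝ) ^ D * (l + 1) ^ D * Λ ^ 2 * 6 ^ l := by gcongr
        _ = _ := by ring
    have h8 := le_of_mul_le_mul_left h7 (by positivity)
    linarith
  have hjl : B ^ l * (C6 * j00) < J := by
    have h1 : W * j00 = 2 * (B ^ l * (C6 * j00)) := by rw [hW]; ring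
    have h2 : 1 ≤ B ^ l * (C6 * j00) :=
      Nat.mul_pos (Nat.pow_pos hB1) (Nat.mul_pos hC61 hj001)
    omega
  have hji : ∀ i ≤ l, B ^ i * (C6 * j00) < J := fun i hi =>
    lt_of_le_of_lt (Nat.mul_le_mul_right _ (Nat.pow_le_pow_right hB1 hi)) hjl
  have hnK2 : 4 * K' ≤ (n : ℝ) ^ 2 := by nlinarith
  obtain ⟨i, hi1, hil, hi⟩ := top_lemma f n J l B M (C6 * j00) σ ε2 K' hn2 hσ hε20 hε21 hK' hmono hup
    hlow hno (Nat.mul_pos hC61 hj001) hjl.le hM4 hM1 hMB hnK2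
  have eji : B ^ i * (C6 * j00) = C6 * (B ^ i * j00) := by ring
  rw [eji] at hi
  obtain ⟨j, hj1, hjJ, hjf, hjm⟩ := minimizer f n J (B ^ i * j00) C6 σ σ' ε K' hn2 hσ' hσσ hε0 hK'
    hstep hup hlow (Nat.mul_pos (Nat.pow_pos hB1) hj001)
    (by rw [← eji]; exact (hji i hil).le) hC6' hC61 (by linarith) hi
  have hj00j : j00 ≤ j := le_trans (Nat.le_mul_of_pos_left _ (Nat.pow_pos hB1)) hj1
  exact ⟨j, by omega, lt_of_le_of_lt hjJ (by rw [← eji]; exact hji i hil), hJub.trans (Nat.mul_le_mul_left _ hj00j), hjf, hjm⟩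

noncomputable def key (δ a : ℝ) : ℤ := ⌊Real.log a / δ⌋

lemma log_sub_le {a b : ℝ} (ha : 1 ≤ a) (hb : 1 ≤ b) : |Real.log a - Real.log b| ≤ |a - b| := by
  have aux : ∀ a b : ℝ, 1 ≤ a → a ≤ b → Real.log b - Real.log a ≤ b - a := by
    intro a b ha hab
    have ha0 : 0 < a := by linarith
    have hb0 : 0 < b := by linarith
    rw [← Real.log_div hb0.ne' ha0.ne']
    have h1 := Real.log_le_sub_one_of_pos (div_pos hb0 ha0)
    have h2 : b / a - 1 ≤ b - a := by
      rw [div_sub_one ha0.ne', div_le_iff₀ ha0]; nlinarith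
    linarith
  rcases le_total a b with h | h
  · have h1 := Real.log_le_log (by linarith) h
    rw [abs_sub_comm, abs_of_nonneg (by linarith), abs_sub_comm, abs_of_nonneg (by linarith)]
    exact aux a b ha h
  · have h1 := Real.log_le_log (by linarith) h
    rw [abs_of_nonneg (by linarith), abs_of_nonneg (by linarith)]
    exact aux b a hb h

lemma sub_le_log {a b : ℝ} (ha : 1 ≤ a) (hb : 1 ≤ b) (ha2 : a ≤ 2) (hb2 : b ≤ 2) :
    |a - b| ≤ 2 * |Real.log a - Real.log b| := by
  have aux : ∀ a b : ℝ, 1 ≤ a → a ≤ b → b ≤ 2 → b - a ≤ 2 * (Real.log b - Real.log a) := by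
    intro a b ha hab hb
    have ha0 : 0 < a := by linarith
    have hb0 : 0 < b := by linarith
    have h1 := Real.log_le_sub_one_of_pos (div_pos ha0 hb0)
    rw [Real.log_div ha0.ne' hb0.ne'] at h1
    have h2 : (b - a) / 2 ≤ 1 - a / b := by
      rw [one_sub_div hb0.ne', div_le_div_iff₀ (by norm_num) hb0]; nlinarith
    linarith
  rcases le_total a b with h | h
  · have h1 := Real.log_le_log (by linarith) h
    rw [abs_sub_comm, abs_of_nonneg (by linarith), abs_sub_comm, abs_of_nonneg (by linarith)]
    exact aux a b ha h hb2
  · have h1 := Real.log_le_log (by linarith) h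
    rw [abs_of_nonneg (by linarith), abs_of_nonneg (by linarith)]
    exact aux b a hb h ha2

lemma key_close {δ a b : ℝ} (hδ : 0 < δ) (ha : a ∈ Set.Icc (1:ℝ) 2) (hb : b ∈ Set.Icc (1:ℝ) 2) (m : ℝ)
    (h : |(key δ a : ℝ) - key δ b| ≤ m) : |a - b| ≤ 2 * (m + 1) * δ := by
  have h1 := sub_le_log ha.1 hb.1 ha.2 hb.2
  have h2 : |Real.log a - Real.log b| ≤ (m + 1) * δ := by
    have a1 := Int.floor_le (Real.log a / δ)
    have a2 := Int.lt_floor_add_one (Real.log a / δ)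
    have b1 := Int.floor_le (Real.log b / δ)
    have b2 := Int.lt_floor_add_one (Real.log b / δ)
    unfold key at h
    rw [abs_le] at h
    have : |Real.log a / δ - Real.log b / δ| ≤ m + 1 := by
      rw [abs_le]; constructor <;> linarith
    rw [← sub_div, abs_div, abs_of_pos hδ, div_le_iff₀ hδ] at this
    exact this
  linarith

lemma key_diff_le {δ a b : ℝ} (hδ : 0 < δ) (ha : 1 ≤ a) (hb : 1 ≤ b) :
    |(key δ a : ℝ) - key δ b| ≤ |a - b| / δ + 1 := by
  have h1 := log_sub_le ha hb
  have a1 := Int.floor_le (Real.log a / δ)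
  have a2 := Int.lt_floor_add_one (Real.log a / δ)
  have b1 := Int.floor_le (Real.log b / δ)
  have b2 := Int.lt_floor_add_one (Real.log b / δ)
  have h3 : |Real.log a / δ - Real.log b / δ| ≤ |a - b| / δ := by
    rw [← sub_div, abs_div, abs_of_pos hδ]; gcongr
  rw [abs_le] at h3 
  unfold key
  rw [abs_le]; constructor <;> linarith

def IsSep (δ : ℝ) (A : Finset ℝ) : Prop := ∀ x ∈ A, ∀ y ∈ A, x ≠ y → δ ≤ |x - y|

lemma sep_count {δ : ℝ} (hδ : 0 < δ) {A : Finset ℝ} (hA : IsSep δ A) (P : Finset ℝ) (hP : P ⊆ A)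
    (x : ℝ) (m : ℕ) (h : ∀ a ∈ P, |a - x| ≤ m * δ) : P.card ≤ 2 * m + 1 := by
  have h1 : P.card ≤ (Finset.Icc (-(m:ℤ)) m).card := by
    apply Finset.card_le_card_of_injOn (fun a => ⌊(a - x) / δ⌋)
    · intro a ha
      have := h a ha
      have h2 : |(a - x) / δ| ≤ m := by
        rw [abs_div, abs_of_pos hδ, div_le_iff₀ hδ]; exact this
      rw [abs_le] at h2
      simp only [Finset.coe_Icc, Set.mem_Icc]
      constructor
      · rw [Int.le_floor]; push_cast; exact h2.1
      · have := (Int.floor_le ((a - x) / δ)).trans h2.2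
        exact_mod_cast this
    · intro a ha b hb hab
      by_contra hne
      have h2 := hA a (hP ha) b (hP hb) hne
      simp only at hab
      have h3 := Int.abs_sub_lt_one_of_floor_eq_floor hab
      rw [← sub_div, abs_div, abs_of_pos hδ, div_lt_one hδ, sub_sub_sub_cancel_right] at h3
      linarith
  simpa [Int.card_Icc] using h1.trans_eq (by simp; omega)

lemma cov_exists (δ : ℝ) (hδ : 0 ≤ δ) (X : Set ℝ) (hX : X.Finite) : ∃ t : Finset ℝ,
    t.card = sInf {n : ℕ | ∃ t : Finset ℝ, t.card = n ∧ X ⊆ ⋃ x ∈ t, Set.Icc x (x + δ)} ∧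
      ∀ y ∈ X, ∃ x ∈ t, x ≤ y ∧ y ≤ x + δ := by
  have hne : {n : ℕ | ∃ t : Finset ℝ, t.card = n ∧ X ⊆ ⋃ x ∈ t, Set.Icc x (x + δ)}.Nonempty := by
    refine ⟨hX.toFinset.card, hX.toFinset, rfl, ?_⟩
    intro y hy
    simp only [Set.mem_iUnion]
    exact ⟨y, by simpa using hy, by simp [hδ]⟩
  obtain ⟨t, ht, hcov⟩ := Nat.sInf_mem hne
  refine ⟨t, ht, fun y hy => ?_⟩
  have := hcov hy
  simp only [Set.mem_iUnion, Set.mem_Icc, exists_prop] at this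
  exact this

noncomputable def keys (δ : ℝ) (A : Finset ℝ) : Finset ℤ := A.image (key δ)

lemma card_keys_le (δ : ℝ) (A : Finset ℝ) : (keys δ A).card ≤ A.card := Finset.card_image_le

lemma key_fiber {δ : ℝ} (hδ : 0 < δ) {A : Finset ℝ} (hA : IsSep δ A)
    (hA12 : ∀ a ∈ A, a ∈ Set.Icc (1:ℝ) 2) (z : ℤ) : (A.filter (fun a => key δ a = z)).card ≤ 5 := by
  rcases (A.filter (fun a => key δ a = z)).eq_empty_or_nonempty with h | ⟨b, hb⟩
  · rw [h]; simp
  · have hb' := Finset.mem_filter.1 hb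
    refine sep_count hδ hA _ (Finset.filter_subset _ _) b 2 ?_
    intro a ha
    have ha' := Finset.mem_filter.1 ha
    have := key_close hδ (hA12 a ha'.1) (hA12 b hb'.1) 0 (by rw [ha'.2, hb'.2]; simp)
    simpa using this

lemma card_le_keys {δ : ℝ} (hδ : 0 < δ) {A : Finset ℝ} (hA : IsSep δ A)
    (hA12 : ∀ a ∈ A, a ∈ Set.Icc (1:ℝ) 2) : A.card ≤ 5 * (keys δ A).card :=
  Finset.card_le_mul_card_image _ _ (fun z _ => key_fiber hδ hA hA12 z)

lemma keys_mul {δ : ℝ} (hδ : 0 < δ) {A : Finset ℝ} (hA12 : ∀ a ∈ A, a ∈ Set.Icc (1:ℝ) 2)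
    (t : Finset ℝ) (ht : ∀ a ∈ A, ∀ b ∈ A, ∃ x ∈ t, x ≤ a * b ∧ a * b ≤ x + δ) :
    (keys δ A + keys δ A).card ≤ 3 * t.card := by
  classical
  have hsub : keys δ A + keys δ A ⊆ t.biUnion (fun x =>
      Finset.Icc (⌊Real.log (max x 1) / δ⌋ - 1) (⌊Real.log (max x 1) / δ⌋ + 1)) := by
    intro v hv
    obtain ⟨u, hu, w, hw, rfl⟩ := Finset.mem_add.1 hv
    obtain ⟨a, ha, rfl⟩ := Finset.mem_image.1 hu
    obtain ⟨b, hb, rfl⟩ := Finset.mem_image.1 hw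
    obtain ⟨x, hx, hx1, hx2⟩ := ht a ha b hb
    refine Finset.mem_biUnion.2 ⟨x, hx, ?_⟩
    set x' := max x 1 with hx'
    have ha1 := (hA12 a ha).1
    have hb1 := (hA12 b hb).1
    have hab1 : 1 ≤ a * b := by nlinarith
    have h1 : x' ≤ a * b := max_le hx1 hab1
    have h2 : a * b ≤ x' + δ := hx2.trans (by gcongr; exact le_max_left _ _)
    have h3 : 1 ≤ x' := le_max_right _ _
    have h4 := log_sub_le hab1 h3
    have h5 : Real.log x' ≤ Real.log (a * b) := Real.log_le_log (by linarith) h1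
    rw [abs_of_nonneg (by linarith), abs_of_nonneg (by linarith),
      Real.log_mul (by linarith) (by linarith)] at h4
    rw [Real.log_mul (by linarith) (by linarith)] at h5
    have a1 := Int.floor_le (Real.log a / δ)
    have a2 := Int.lt_floor_add_one (Real.log a / δ)
    have b1 := Int.floor_le (Real.log b / δ)
    have b2 := Int.lt_floor_add_one (Real.log b / δ)
    have c1 := Int.floor_le (Real.log x' / δ)
    have c2 := Int.lt_floor_add_one (Real.log x' / δ)
    have h6 : Real.log a / δ + Real.log b / δ ≤ Real.log x' / δ + 1 := by
      rw [← add_div, div_add_one hδ.ne', div_le_div_iff_of_pos_right hδ]; linarith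
    have h7 : Real.log x' / δ ≤ Real.log a / δ + Real.log b / δ := by
      rw [← add_div, div_le_div_iff_of_pos_right hδ]; linarith
    unfold key
    rw [Finset.mem_Icc]
    constructor
    · have : ((⌊Real.log x' / δ⌋ : ℤ) : ℝ) - 2 < (⌊Real.log a / δ⌋ : ℤ) + (⌊Real.log b / δ⌋ : ℤ) := by
        linarith
      have : ⌊Real.log x' / δ⌋ - 2 < ⌊Real.log a / δ⌋ + ⌊Real.log b / δ⌋ := by exact_mod_cast this
      omega
    · have : ((⌊Real.log a / δ⌋ : ℤ) : ℝ) + (⌊Real.log b / δ⌋ : ℤ) < (⌊Real.log x' / δ⌋ : ℤ) + 2 := by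
        linarith
      have : ⌊Real.log a / δ⌋ + ⌊Real.log b / δ⌋ < ⌊Real.log x' / δ⌋ + 2 := by exact_mod_cast this
      omega
  refine (Finset.card_le_card hsub).trans ?_
  rw [mul_comm]
  refine Finset.card_biUnion_le_card_mul _ _ _ ?_
  intro x _
  rw [Int.card_Icc]; omega

lemma keys_div {δ : ℝ} (hδ : 0 < δ) {A : Finset ℝ} (hA12 : ∀ a ∈ A, a ∈ Set.Icc (1:ℝ) 2)
    (t : Finset ℝ) (ht : ∀ a ∈ A, ∀ b ∈ A, ∃ x ∈ t, x ≤ a / b ∧ a / b ≤ x + δ) :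
    (keys δ A - keys δ A).card ≤ 6 * t.card := by
  classical
  have hsub : keys δ A - keys δ A ⊆ t.biUnion (fun x =>
      Finset.Icc (⌊Real.log (max x (1/2)) / δ⌋ - 1) (⌊Real.log (max x (1/2)) / δ⌋ + 4)) := by
    intro v hv
    obtain ⟨u, hu, w, hw, rfl⟩ := Finset.mem_sub.1 hv
    obtain ⟨a, ha, rfl⟩ := Finset.mem_image.1 hu
    obtain ⟨b, hb, rfl⟩ := Finset.mem_image.1 hw
    obtain ⟨x, hx, hx1, hx2⟩ := ht a ha b hb
    refine Finset.mem_biUnion.2 ⟨x, hx, ?_⟩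
    set x' := max x (1/2) with hx'
    have ha1 := (hA12 a ha).1
    have hb1 := (hA12 b hb).1
    have hb2 := (hA12 b hb).2
    have hab1 : 1/2 ≤ a / b := by rw [div_le_div_iff₀ (by norm_num) (by linarith)]; linarith
    have h1 : x' ≤ a / b := max_le hx1 hab1
    have h2 : a / b ≤ x' + δ := hx2.trans (by gcongr; exact le_max_left _ _)
    have h3 : 1/2 ≤ x' := le_max_right _ _
    have h4 := log_sub_le (a := 2 * (a / b)) (b := 2 * x') (by linarith) (by linarith)
    rw [Real.log_mul (by norm_num) (by positivity), Real.log_mul (by norm_num) (by positivity)] at h4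
    have h5 : Real.log x' ≤ Real.log (a / b) := Real.log_le_log (by linarith) h1
    rw [abs_of_nonneg (by linarith), abs_of_nonneg (by linarith),
      Real.log_div (by linarith) (by linarith)] at h4
    rw [Real.log_div (by linarith) (by linarith)] at h5
    have a1 := Int.floor_le (Real.log a / δ)
    have a2 := Int.lt_floor_add_one (Real.log a / δ)
    have b1 := Int.floor_le (Real.log b / δ)
    have b2 := Int.lt_floor_add_one (Real.log b / δ)
    have c1 := Int.floor_le (Real.log x' / δ)
    have c2 := Int.lt_floor_add_one (Real.log x' / δ)
    have h6 : Real.log a / δ - Real.log b / δ ≤ Real.log x' / δ + 2 := by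
      rw [← sub_div, div_add' _ _ _ hδ.ne', div_le_div_iff_of_pos_right hδ]; linarith
    have h7 : Real.log x' / δ ≤ Real.log a / δ - Real.log b / δ := by
      rw [← sub_div, div_le_div_iff_of_pos_right hδ]; linarith
    unfold key
    rw [Finset.mem_Icc]
    constructor
    · have : ((⌊Real.log x' / δ⌋ : ℤ) : ℝ) - 1 < (⌊Real.log a / δ⌋ : ℤ) - (⌊Real.log b / δ⌋ : ℤ) := by
        linarith
      have : ⌊Real.log x' / δ⌋ - 1 < ⌊Real.log a / δ⌋ - ⌊Real.log b / δ⌋ := by exact_mod_cast this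
      omega
    · have : ((⌊Real.log a / δ⌋ : ℤ) : ℝ) - (⌊Real.log b / δ⌋ : ℤ) < (⌊Real.log x' / δ⌋ : ℤ) + 4 := by
        linarith
      have : ⌊Real.log a / δ⌋ - ⌊Real.log b / δ⌋ < ⌊Real.log x' / δ⌋ + 4 := by exact_mod_cast this
      omega
  refine (Finset.card_le_card hsub).trans ?_
  rw [mul_comm]
  refine Finset.card_biUnion_le_card_mul _ _ _ ?_
  intro x _
  rw [Int.card_Icc]; omega

lemma doubling {δ : ℝ} (hδ : 0 < δ) {A : Finset ℝ} (hA : IsSep δ A) (hne : A.Nonempty)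
    (hA12 : ∀ a ∈ A, a ∈ Set.Icc (1:ℝ) 2) (L : ℕ) (hL : 1 ≤ L) (t : Finset ℝ)
    (htc : t.card ≤ L * A.card)
    (ht : (∀ a ∈ A, ∀ b ∈ A, ∃ x ∈ t, x ≤ a * b ∧ a * b ≤ x + δ) ∨
      (∀ a ∈ A, ∀ b ∈ A, ∃ x ∈ t, x ≤ a / b ∧ a / b ≤ x + δ)) :
    (keys δ A + keys δ A).card ≤ (30 * L) ^ 2 * (keys δ A).card := by
  have h5 := card_le_keys hδ hA hA12
  have hSne : (keys δ A).Nonempty := hne.image _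
  rcases ht with ht | ht
  · have h1 := keys_mul hδ hA12 t ht
    calc _ ≤ 3 * t.card := h1
      _ ≤ 3 * (L * (5 * (keys δ A).card)) := by gcongr; exact htc.trans (by gcongr)
      _ ≤ _ := by nlinarith [Nat.zero_le ((keys δ A).card), Nat.mul_le_mul_right ((keys δ A).card) (Nat.mul_le_mul hL hL)]
  · have h1 := keys_div hδ hA12 t ht
    have h2 : (keys δ A - keys δ A).card ≤ 30 * L * (keys δ A).card := by
      calc _ ≤ 6 * t.card := h1
        _ ≤ 6 * (L * (5 * (keys δ A).card)) := by gcongr; exact htc.trans (by gcongr)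
        _ = _ := by ring
    have := Finset.pluennecke_ruzsa_inequality_nsmul_sub_nsmul_sub hSne (keys δ A) 2 0
    have h0 : (0 : ℚ≥0) < (keys δ A).card := by exact_mod_cast hSne.card_pos
    have h3 : ((keys δ A - keys δ A).card / (keys δ A).card : ℚ≥0) ≤ (30 * L : ℕ) := by
      rw [div_le_iff₀ h0]; exact_mod_cast h2
    have h4 : ((2 • keys δ A - 0 • keys δ A).card : ℚ≥0) ≤ ((30 * L : ℕ) : ℚ≥0) ^ (2 + 0) * (keys δ A).card := by
      refine this.trans ?_
      gcongr
    have h6 : 2 • keys δ A - 0 • keys δ A = keys δ A + keys δ A := by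
      rw [zero_nsmul, sub_zero, two_nsmul]
    rw [h6] at h4
    exact_mod_cast h4

lemma homog (S : Finset ℤ) (T : ℕ) (hT : 0 < T) (I : ℤ) :
    (S.filter (fun s => s / (T : ℤ) = I)).card * cells T S ≤ 2 * (S + S).card := by
  classical
  have hTz : (0 : ℤ) < T := by exact_mod_cast hT
  set B := S.image (fun s => s / (T : ℤ)) with hB
  have hrep : ∀ b ∈ B, ∃ s ∈ S, s / (T : ℤ) = b := by
    intro b hb; simpa [hB] using hb
  choose! rep hrepS hrepT using hrep
  have hcells : cells T S = B.card := rfl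
  rw [hcells, ← Finset.card_product]
  refine Finset.card_le_mul_card_image_of_maps_to (f := fun p : ℤ × ℤ => p.1 + rep p.2) ?_ 2 ?_
  · intro p hp
    rw [Finset.mem_product] at hp
    exact Finset.add_mem_add (Finset.mem_filter.1 hp.1).1 (hrepS _ hp.2)
  · intro v _
    have : ((S.filter (fun s => s / (T : ℤ) = I) ×ˢ B).filter (fun p => p.1 + rep p.2 = v)).card ≤
        (Finset.Icc (v / (T : ℤ) - I - 1) (v / (T : ℤ) - I)).card := by
      apply Finset.card_le_card_of_injOn (fun p => p.2)
      · rintro ⟨s, b⟩ hp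
        simp only [Finset.coe_filter, Finset.mem_product, Set.mem_ofPred_eq, Finset.mem_filter] at hp
        obtain ⟨⟨⟨hs, hsI⟩, hb⟩, hv⟩ := hp
        have e1 : rep b = v - s := by linarith
        have e2 := hrepT b hb
        have a1 := Int.mul_ediv_add_emod s T
        have a2 := Int.emod_nonneg s hTz.ne'
        have a3 := Int.emod_lt_of_pos s hTz
        rw [hsI] at a1
        simp only [Finset.coe_Icc, Set.mem_Icc]
        rw [← e2, e1]
        constructor
        · rw [Int.le_ediv_iff_mul_le hTz]
          have := Int.ediv_mul_le v hTz.ne'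
          nlinarith
        · rw [← Int.lt_add_one_iff, Int.ediv_lt_iff_lt_mul hTz]
          have := Int.lt_ediv_add_one_mul_self v hTz
          nlinarith
      · rintro ⟨s, b⟩ hp ⟨s', b'⟩ hp' h
        simp only [Finset.coe_filter, Finset.mem_product, Set.mem_ofPred_eq, Finset.mem_filter] at hp hp'
        simp only at h
        subst h
        have := hp.2.trans hp'.2.symm
        simp at this
        rw [this]
    refine this.trans ?_
    rw [Int.card_Icc]; omega

lemma cell_count {δ : ℝ} (hδ : 0 < δ) {A : Finset ℝ} (hA : IsSep δ A)
    (hA12 : ∀ a ∈ A, a ∈ Set.Icc (1:ℝ) 2) (T : ℕ) (I : ℤ) :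
    (A.filter (fun a => key δ a / (T : ℤ) = I)).card ≤
      5 * ((keys δ A).filter (fun s => s / (T : ℤ) = I)).card := by
  refine Finset.card_le_mul_card_image_of_maps_to (f := key δ) ?_ 5 ?_
  · intro a ha
    have ha' := Finset.mem_filter.1 ha
    exact Finset.mem_filter.2 ⟨Finset.mem_image_of_mem _ ha'.1, ha'.2⟩
  · intro z _
    refine le_trans (Finset.card_le_card ?_) (key_fiber hδ hA hA12 z)
    intro a ha
    have ha' := Finset.mem_filter.1 ha
    exact Finset.mem_filter.2 ⟨(Finset.mem_filter.1 ha'.1).1, ha'.2⟩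

lemma low_bound {δ σ K : ℝ} (hδ : 0 < δ) (hσ0 : 0 < σ) (hσ1 : σ ≤ 1) (hK : 0 < K) {A : Finset ℝ}
    (hne : A.Nonempty)
    (hA12 : ∀ a ∈ A, a ∈ Set.Icc (1:ℝ) 2)
    (hF : ∀ (x r : ℝ), δ ≤ r →
      ((A.filter (fun a => |a - x| ≤ r)).card : ℝ) ≤ K * r ^ σ * (A.card : ℝ))
    (n J j : ℕ) (hn : 2 ≤ n) (hj : j ≤ J) (hJ : δ * (n : ℝ) ^ J ≤ n) :
    (n : ℝ) ^ (σ * j) ≤ (2 * K) * n * cells (n ^ (J - j)) (keys δ A) := by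
  classical
  have hn0 : (0 : ℝ) < n := by positivity
  have hn1 : (1 : ℝ) ≤ n := by exact_mod_cast (by omega : 1 ≤ n)
  set T := n ^ (J - j) with hT
  have hT1 : 1 ≤ T := Nat.pow_pos (by omega)
  have hTz : (0 : ℤ) < T := by exact_mod_cast hT1
  have hT1r : (1 : ℝ) ≤ T := by exact_mod_cast hT1
  have hTδ : T * δ ≤ n / (n : ℝ) ^ j := by
    rw [le_div_iff₀ (by positivity)]
    have : (T : ℝ) * (n : ℝ) ^ j = (n : ℝ) ^ J := by
      rw [hT]; push_cast; rw [← pow_add]; congr 1; omega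
    nlinarith
  have hN : (0 : ℝ) < A.card := by exact_mod_cast hne.card_pos
  have hcell : ∀ I ∈ (keys δ A).image (fun s => s / (T : ℤ)),
      ((A.filter (fun a => key δ a / (T : ℤ) = I)).card : ℝ) ≤ K * (2 * (n / (n : ℝ) ^ j)) ^ σ * A.card := by
    intro I hI
    rcases (A.filter (fun a => key δ a / (T : ℤ) = I)).eq_empty_or_nonempty with h | ⟨b, hb⟩
    · rw [h]; simp; positivity
    · have hb' := Finset.mem_filter.1 hb
      have h1 := hF b (2 * (T * δ)) (by nlinarith)
      calc ((A.filter (fun a => key δ a / (T : ℤ) = I)).card : ℝ)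
          ≤ ((A.filter (fun a => |a - b| ≤ 2 * (T * δ))).card : ℝ) := by
            norm_cast
            apply Finset.card_le_card
            intro a ha
            have ha' := Finset.mem_filter.1 ha
            refine Finset.mem_filter.2 ⟨ha'.1, ?_⟩
            have h3 : |(key δ a : ℝ) - key δ b| ≤ T - 1 := by
              have a1 := Int.mul_ediv_add_emod (key δ a) T
              have a2 := Int.emod_nonneg (key δ a) hTz.ne'
              have a3 := Int.emod_lt_of_pos (key δ a) hTz
              have b1 := Int.mul_ediv_add_emod (key δ b) T
              have b2 := Int.emod_nonneg (key δ b) hTz.ne'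
              have b3 := Int.emod_lt_of_pos (key δ b) hTz
              rw [ha'.2] at a1
              rw [hb'.2] at b1
              have : |key δ a - key δ b| ≤ T - 1 := by
                rw [abs_le]; constructor <;> linarith
              exact_mod_cast this
            have := key_close hδ (hA12 a ha'.1) (hA12 b hb'.1) _ h3
            linarith
        _ ≤ _ := h1
        _ ≤ _ := by gcongr
  have hsum : (A.card : ℝ) ≤ cells T (keys δ A) * (K * (2 * (n / (n : ℝ) ^ j)) ^ σ * A.card) := by
    have hm : ∀ a ∈ A, key δ a / (T : ℤ) ∈ (keys δ A).image (fun s => s / (T : ℤ)) := by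
      intro a ha
      exact Finset.mem_image_of_mem (fun s => s / (T : ℤ)) (Finset.mem_image_of_mem (key δ) ha)
    have hcs : (A.card : ℝ) = ∑ I ∈ (keys δ A).image (fun s => s / (T : ℤ)),
        ((A.filter (fun a => key δ a / (T : ℤ) = I)).card : ℝ) := by
      rw [Finset.card_eq_sum_card_fiberwise hm]; push_cast; rfl
    calc (A.card : ℝ) = _ := hcs
      _ ≤ ∑ _I ∈ (keys δ A).image (fun s => s / (T : ℤ)),
          (K * (2 * (n / (n : ℝ) ^ j)) ^ σ * A.card) := by
          refine Finset.sum_le_sum fun I hI => ?_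
          have := hcell I hI
          exact this
      _ = _ := by rw [Finset.sum_const, nsmul_eq_mul]; rfl
  have h1 : (1 : ℝ) ≤ cells T (keys δ A) * (K * (2 * (n / (n : ℝ) ^ j)) ^ σ) := by
    have : 1 * (A.card : ℝ) ≤ (cells T (keys δ A) * (K * (2 * (n / (n : ℝ) ^ j)) ^ σ)) * A.card := by
      linarith
    exact le_of_mul_le_mul_right this hN
  have h2 : (2 * (n / (n : ℝ) ^ j)) ^ σ ≤ 2 * n / (n : ℝ) ^ (σ * j) := by
    rw [← mul_div_assoc, Real.div_rpow (by positivity) (by positivity)]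
    have e : ((n : ℝ) ^ j) ^ σ = (n : ℝ) ^ (σ * j) := by
      rw [← Real.rpow_natCast, ← Real.rpow_mul hn0.le, mul_comm]
    rw [e]
    gcongr
    calc (2 * (n : ℝ)) ^ σ ≤ (2 * (n : ℝ)) ^ (1 : ℝ) :=
          Real.rpow_le_rpow_of_exponent_le (by linarith) hσ1
      _ = _ := Real.rpow_one _
  have h3 : (1 : ℝ) ≤ cells T (keys δ A) * (K * (2 * n / (n : ℝ) ^ (σ * j))) := h1.trans (by gcongr)
  have h4 : cells T (keys δ A) * (K * (2 * n / (n : ℝ) ^ (σ * j))) =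
      ((2 * K) * n * cells T (keys δ A)) / (n : ℝ) ^ (σ * j) := by ring
  rw [h4, one_le_div (by positivity)] at h3
  exact h3

lemma ball_count {δ : ℝ} (hδ : 0 < δ) {A : Finset ℝ} (hA : IsSep δ A)
    (hA12 : ∀ a ∈ A, a ∈ Set.Icc (1:ℝ) 2) (T Λ : ℕ) (hT : 1 ≤ T)
    (hΛ : (keys δ A + keys δ A).card ≤ Λ * (keys δ A).card) (x t : ℝ) (ht : t ≤ T * δ) :
    (A.filter (fun a => |a - x| ≤ t)).card * cells T (keys δ A) ≤ 70 * Λ * A.card := by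
  classical
  have hTz : (0 : ℤ) < T := by exact_mod_cast hT
  have hT1r : (1 : ℝ) ≤ T := by exact_mod_cast hT
  rcases (A.filter (fun a => |a - x| ≤ t)).eq_empty_or_nonempty with h | ⟨b, hb⟩
  · rw [h]; simp
  have hb' := Finset.mem_filter.1 hb
  set c0 := key δ b / (T : ℤ) with hc0
  have hsub : A.filter (fun a => |a - x| ≤ t) ⊆ (Finset.Icc (c0 - 3) (c0 + 3)).biUnion
      (fun I => A.filter (fun a => key δ a / (T : ℤ) = I)) := by
    intro a ha
    have ha' := Finset.mem_filter.1 ha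
    refine Finset.mem_biUnion.2 ⟨key δ a / (T : ℤ), ?_, Finset.mem_filter.2 ⟨ha'.1, rfl⟩⟩
    have h1 : |a - b| ≤ 2 * t := by
      have e : a - b = (a - x) - (b - x) := by ring
      rw [e]
      linarith [abs_sub (a - x) (b - x), ha'.2, hb'.2]
    have h2 := key_diff_le hδ (hA12 a ha'.1).1 (hA12 b hb'.1).1
    have h3 : |a - b| / δ ≤ 2 * T := by rw [div_le_iff₀ hδ]; nlinarith
    have h4 : |(key δ a : ℝ) - key δ b| ≤ 3 * T := by linarith
    have h5 : |key δ a - key δ b| ≤ 3 * T := by exact_mod_cast h4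
    rw [abs_le] at h5
    rw [Finset.mem_Icc]
    constructor
    · rw [Int.le_ediv_iff_mul_le hTz]
      have := Int.ediv_mul_le (key δ b) hTz.ne'
      nlinarith
    · rw [← Int.lt_add_one_iff, Int.ediv_lt_iff_lt_mul hTz]
      have := Int.lt_ediv_add_one_mul_self (key δ b) hTz
      nlinarith
  have h1 : ∀ I, (A.filter (fun a => key δ a / (T : ℤ) = I)).card * cells T (keys δ A) ≤
      10 * Λ * A.card := by
    intro I
    calc _ ≤ (5 * ((keys δ A).filter (fun s => s / (T : ℤ) = I)).card) * cells T (keys δ A) := by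
          gcongr; exact cell_count hδ hA hA12 T I
      _ = 5 * (((keys δ A).filter (fun s => s / (T : ℤ) = I)).card * cells T (keys δ A)) := by ring
      _ ≤ 5 * (2 * (Λ * (keys δ A).card)) := by
          exact Nat.mul_le_mul_left _ ((homog _ T hT I).trans (by gcongr))
      _ ≤ 5 * (2 * (Λ * A.card)) := by gcongr; exact card_keys_le δ A
      _ = _ := by ring
  calc _ ≤ (∑ I ∈ Finset.Icc (c0 - 3) (c0 + 3), (A.filter (fun a => key δ a / (T : ℤ) = I)).card)
        * cells T (keys δ A) := by
        gcongr
        exact (Finset.card_le_card hsub).trans Finset.card_biUnion_le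
    _ = ∑ I ∈ Finset.Icc (c0 - 3) (c0 + 3), (A.filter (fun a => key δ a / (T : ℤ) = I)).card
        * cells T (keys δ A) := by rw [Finset.sum_mul]
    _ ≤ ∑ _I ∈ Finset.Icc (c0 - 3) (c0 + 3), 10 * Λ * A.card := Finset.sum_le_sum fun I _ => h1 I
    _ = 7 * (10 * Λ * A.card) := by
        rw [Finset.sum_const, Int.card_Icc, smul_eq_mul]; congr 1; omega
    _ = _ := by ring

lemma prop2 (σ σ' ε K : ℝ) (Λ : ℕ) (hσ' : 0 < σ') (hσσ : σ' < σ) (hσ1 : σ ≤ 1)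
    (hε0 : 0 < ε) (hε1 : ε < 1) (hK : 0 < K) :
    ∃ C1 δ0 : ℝ, ∃ I0 : ℕ, 1 ≤ C1 ∧ 0 < δ0 ∧ 1 ≤ I0 ∧ ∀ δ : ℝ, 0 < δ → δ < δ0 →
      ∀ A : Finset ℝ, IsSep δ A → A.Nonempty → (∀ a ∈ A, a ∈ Set.Icc (1:ℝ) 2) →
      (∀ (x r : ℝ), δ ≤ r →
        ((A.filter (fun a => |a - x| ≤ r)).card : ℝ) ≤ K * r ^ σ * (A.card : ℝ)) →
      (keys δ A + keys δ A).card ≤ Λ * (keys δ A).card →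
      ∃ r : ℝ, δ ≤ r ∧ r < 1 ∧ r ^ I0 ≤ δ ∧ ∀ x t : ℝ, δ ≤ t → t ≤ r →
        ((A.filter (fun a => |a - x| ≤ t)).card : ℝ) ≤
          C1 * r ^ (1 - ε) * (t / r) ^ σ' * A.card := by
  obtain ⟨n, m0, hn, hm0, H⟩ := prop1 σ σ' ε (2 * K) Λ hσ' hσσ hε0 hε1 (by positivity)
  have hn0 : (0 : ℝ) < n := by positivity
  have hn1 : (1 : ℝ) < n := by exact_mod_cast (by omega : 1 < n)
  refine ⟨70 * Λ * n + 1, ((n : ℝ) ^ m0)⁻¹, m0, ?_, by positivity, hm0, ?_⟩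
  · have : (0 : ℝ) ≤ 70 * Λ * n := by positivity
    linarith
  intro δ hδ hδ0 A hA hne hA12 hF hdbl
  classical
  have hex : ∃ J : ℕ, 1 / δ ≤ (n : ℝ) ^ J := by
    obtain ⟨J, hJ⟩ := pow_unbounded_of_one_lt (1 / δ) hn1
    exact ⟨J, hJ.le⟩
  set J := Nat.find hex with hJdef
  have hJ1 : 1 / δ ≤ (n : ℝ) ^ J := Nat.find_spec hex
  have hJm : m0 < J := by
    have h1 : (n : ℝ) ^ m0 < 1 / δ := by
      rw [lt_one_div (by positivity) hδ, one_div]; exact hδ0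
    exact (pow_lt_pow_iff_right₀ hn1).1 (h1.trans_le hJ1)
  have hJ2 : (n : ℝ) ^ (J - 1) < 1 / δ := by
    have := Nat.find_min hex (m := J - 1) (by omega)
    exact not_le.1 this
  have hJ1' : 1 ≤ (n : ℝ) ^ J * δ := by rwa [div_le_iff₀ hδ] at hJ1
  have hJ2' : (n : ℝ) ^ (J - 1) * δ < 1 := by rwa [lt_div_iff₀ hδ] at hJ2
  have hJ3 : δ * (n : ℝ) ^ J ≤ n := by
    have : (n : ℝ) ^ J = (n : ℝ) ^ (J - 1) * n := by rw [← pow_succ]; congr 1; omega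
    rw [this]; nlinarith
  have hSne : (keys δ A).Nonempty := hne.image _
  obtain ⟨j, hj1, hjJ, hJj, hjf, hjm⟩ := H J hJm.le (keys δ A) hSne (by
    intro s hs
    obtain ⟨a, ha, rfl⟩ := Finset.mem_image.1 hs
    have ha' := hA12 a ha
    have hl0 : 0 ≤ Real.log a := Real.log_nonneg ha'.1
    have hl1 : Real.log a ≤ Real.log 2 := Real.log_le_log (by linarith [ha'.1]) ha'.2
    have hl2 : Real.log a < 1 := by linarith [Real.log_two_lt_d9]
    refine ⟨Int.floor_nonneg.2 (by positivity), ?_⟩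
    have h1 : Real.log a / δ < (n : ℝ) ^ J := by
      refine lt_of_lt_of_le ?_ hJ1
      gcongr
    unfold key
    rw [Int.floor_lt]
    push_cast
    exact h1) hdbl (fun j hj => low_bound hδ (hσ'.trans hσσ) hσ1 hK hne hA12 hF n J j hn hj hJ3)
  set r : ℝ := ((n : ℝ) ^ j)⁻¹ with hr
  have hr0 : 0 < r := by positivity
  refine ⟨r, ?_, ?_, ?_, ?_⟩
  · rw [hr, le_inv_comm₀ hδ (by positivity), ← one_div]
    exact le_trans (pow_le_pow_right₀ hn1.le (by omega)) hJ2.le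
  · rw [hr]
    exact inv_lt_one_of_one_lt₀ (one_lt_pow₀ hn1 (by omega))
  · rw [hr, inv_pow, inv_le_comm₀ (by positivity) hδ, ← one_div, ← pow_mul]
    refine hJ1.trans (pow_le_pow_right₀ hn1.le ?_)
    rw [mul_comm]; exact hJj
  · intro x t ht1 ht2
    -- choose the level
    have ht0 : 0 < t := by linarith
    obtain ⟨j', hj'1, hj'2, hj'3, hj'4⟩ : ∃ j', j ≤ j' ∧ j' ≤ J ∧ t ≤ ((n : ℝ) ^ j')⁻¹ ∧
        ((n : ℝ) ^ j')⁻¹ ≤ n * t := by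
      set P := (Finset.Icc j J).filter (fun i => t ≤ ((n : ℝ) ^ i)⁻¹) with hP
      have hPne : P.Nonempty := ⟨j, Finset.mem_filter.2 ⟨Finset.mem_Icc.2 ⟨le_rfl, hjJ.le⟩, ht2⟩⟩
      have hmem := P.max'_mem hPne
      set i := P.max' hPne with hi
      have h1 := Finset.mem_filter.1 hmem
      have h2 := Finset.mem_Icc.1 h1.1
      refine ⟨i, h2.1, h2.2, h1.2, ?_⟩
      rw [inv_le_iff_one_le_mul₀ (by positivity)]
      by_cases hiJ : i = J
      · rw [hiJ]
        have : (n : ℝ) ^ J * δ ≤ n * t * (n : ℝ) ^ J := by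
          have h3 : δ ≤ n * t := by nlinarith
          have h4 : (0 : ℝ) < (n : ℝ) ^ J := by positivity
          nlinarith
        linarith
      · by_contra hcon
        push Not at hcon
        have h3 : i + 1 ∈ P := by
          refine Finset.mem_filter.2 ⟨Finset.mem_Icc.2 ⟨by omega, by omega⟩, ?_⟩
          rw [le_inv_comm₀ ht0 (by positivity), le_inv_comm₀ (by positivity) ht0]
          rw [inv_eq_one_div, le_div_iff₀ (by positivity), pow_succ]
          linarith
        have := Finset.le_max' P _ h3
        omega
    set T := n ^ (J - j') with hT
    have hT1 : 1 ≤ T := Nat.pow_pos (by omega)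
    have hTt : t ≤ T * δ := by
      refine hj'3.trans ?_
      rw [inv_le_iff_one_le_mul₀ (by positivity)]
      have : (T : ℝ) * (n : ℝ) ^ j' = (n : ℝ) ^ J := by
        rw [hT]; push_cast; rw [← pow_add]; congr 1; omega
      nlinarith
    have h1 := ball_count hδ hA hA12 T Λ hT1 hdbl x t hTt
    have h1r : ((A.filter (fun a => |a - x| ≤ t)).card : ℝ) * cells T (keys δ A) ≤ 70 * Λ * A.card := by
      exact_mod_cast h1
    have h2 := hjm j' hj'1 hj'2
    have hq : 0 < r ^ (1 - ε) * (t / r) ^ σ' := by positivity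
    -- lower bound for the number of cells
    have h3 : 1 ≤ n * (r ^ (1 - ε) * (t / r) ^ σ') * cells T (keys δ A) := by
      have e1 : (n : ℝ) ^ ((1 - ε) * j) = (r ^ (1 - ε))⁻¹ := by
        rw [hr, Real.inv_rpow (by positivity), inv_inv, ← Real.rpow_natCast, ← Real.rpow_mul hn0.le,
          mul_comm]
      have e2 : ((n : ℝ) ^ (σ' * ((j' : ℝ) - j))) * (n * (t / r) ^ σ') ≥ 1 := by
        have e3 : (n : ℝ) ^ (σ' * ((j' : ℝ) - j)) = ((n : ℝ) ^ j' / (n : ℝ) ^ j) ^ σ' := by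
          rw [mul_comm, Real.rpow_mul hn0.le, Real.rpow_sub hn0, Real.rpow_natCast, Real.rpow_natCast]
        have e4 : (1 : ℝ) ≤ (n : ℝ) ^ j' / (n : ℝ) ^ j * (n * (t / r)) := by
          rw [hr, div_inv_eq_mul]
          have : (n : ℝ) ^ j' / (n : ℝ) ^ j * (n * (t * (n : ℝ) ^ j)) = n * t * (n : ℝ) ^ j' := by
            field_simp
          rw [this]
          rwa [inv_le_iff_one_le_mul₀ (by positivity)] at hj'4
        have e5 : (n : ℝ) ^ σ' ≤ n := by
          calc (n : ℝ) ^ σ' ≤ (n : ℝ) ^ (1 : ℝ) :=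
                Real.rpow_le_rpow_of_exponent_le hn1.le (by linarith)
            _ = _ := Real.rpow_one _
        rw [e3]
        calc (1 : ℝ) ≤ ((n : ℝ) ^ j' / (n : ℝ) ^ j * (n * (t / r))) ^ σ' :=
              Real.one_le_rpow e4 hσ'.le
          _ = ((n : ℝ) ^ j' / (n : ℝ) ^ j) ^ σ' * ((n : ℝ) ^ σ' * (t / r) ^ σ') := by
              rw [Real.mul_rpow (by positivity) (by positivity),
                Real.mul_rpow (by positivity) (by positivity)]
          _ ≤ _ := by gcongr
      have h4 : (r ^ (1 - ε))⁻¹ * (n : ℝ) ^ (σ' * ((j' : ℝ) - j)) ≤ cells T (keys δ A) := by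
        refine le_trans ?_ h2
        rw [← e1]; gcongr
      calc (1 : ℝ) ≤ ((n : ℝ) ^ (σ' * ((j' : ℝ) - j))) * (n * (t / r) ^ σ') := e2
        _ = n * (r ^ (1 - ε) * (t / r) ^ σ') * ((r ^ (1 - ε))⁻¹ * (n : ℝ) ^ (σ' * ((j' : ℝ) - j))) := by
            have : r ^ (1 - ε) ≠ 0 := by positivity
            field_simp
        _ ≤ _ := by gcongr
    calc ((A.filter (fun a => |a - x| ≤ t)).card : ℝ)
        ≤ (A.filter (fun a => |a - x| ≤ t)).card * (n * (r ^ (1 - ε) * (t / r) ^ σ') * cells T (keys δ A)) :=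
          le_mul_of_one_le_right (by positivity) h3
      _ = n * (r ^ (1 - ε) * (t / r) ^ σ') * ((A.filter (fun a => |a - x| ≤ t)).card * cells T (keys δ A)) := by
          ring
      _ ≤ n * (r ^ (1 - ε) * (t / r) ^ σ') * (70 * Λ * A.card) := by gcongr
      _ = 70 * Λ * n * r ^ (1 - ε) * (t / r) ^ σ' * A.card := by ring
      _ ≤ _ := by gcongr; linarith

noncomputable def qq (y x : ℝ × ℝ) : ℝ := (y.1 - x.1) / (y.2 - x.2)

lemma qq_comm (y x : ℝ × ℝ) : qq y x = qq x y := by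
  unfold qq
  rw [← neg_sub x.1, ← neg_sub x.2, neg_div_neg_eq]

noncomputable def rcell (r : ℝ) (y : ℝ × ℝ) : ℤ × ℤ := (⌊y.1 / r⌋, ⌊y.2 / r⌋)

noncomputable def tdist (δ : ℝ) (y y' : ℝ × ℝ) : ℝ := max (max |y.1 - y'.1| |y.2 - y'.2|) δ

lemma tdist_le {δ r : ℝ} (hr : 0 < r) (hδr : δ ≤ r) {y y' : ℝ × ℝ} (h : rcell r y' = rcell r y) :
    tdist δ y y' ≤ r := by
  unfold rcell at h
  rw [Prod.mk.injEq] at h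
  have h1 := Int.abs_sub_lt_one_of_floor_eq_floor h.1
  have h2 := Int.abs_sub_lt_one_of_floor_eq_floor h.2
  rw [← sub_div, abs_div, abs_of_pos hr, div_lt_one hr, abs_sub_comm] at h1 h2
  exact max_le (max_le h1.le h2.le) hδr

open Classical in
lemma pairs_bound (G : Finset ((ℝ × ℝ) × (ℝ × ℝ))) (δ r ρ β H N2 : ℝ) (Q0 : ℕ) (hQ0 : 1 ≤ Q0)
    (hδ : 0 < δ) (hδr : δ ≤ r) (hβ : 0 ≤ β) (hH : 1 ≤ H) (hN2 : 0 ≤ N2)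
    (hG : ∀ g ∈ G, |g.1.2 - g.2.2| ≤ 4 ∧ g.1.2 - g.2.2 ≠ 0 ∧ |qq g.1 g.2| ≤ Q0)
    (hGy : ∀ y, ((G.filter (fun g => g.1 = y)).card : ℝ) ≤ N2)
    (inv : ∀ y θ s, ρ ≤ s → s ≤ 1 →
      ((G.filter (fun g => g.1 = y ∧ |qq g.1 g.2 - θ| ≤ s)).card : ℝ) ≤ H * s ^ β * N2)
    (y y' : ℝ × ℝ) (hyy : rcell r y' = rcell r y) (s : ℝ) (hs1 : r * ρ ≤ s) (hs2 : δ ≤ s) :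
    ((G.filter (fun g => g.1 = y ∧ (y', g.2) ∈ G ∧ |qq y' g.2 - qq g.1 g.2| ≤ 2 * s)).card : ℝ) ≤
      H * (16 * Q0 * s) ^ β * (tdist δ y y') ^ (-β) * N2 := by
  have hr : 0 < r := by linarith
  have hs : 0 < s := by linarith
  have hQr : (1 : ℝ) ≤ Q0 := by exact_mod_cast hQ0
  set t := tdist δ y y' with ht
  have htr : t ≤ r := tdist_le hr hδr hyy
  have htδ : δ ≤ t := le_max_right _ _
  have ht0 : 0 < t := by linarith
  have e0 : H * (16 * Q0 * s) ^ β * t ^ (-β) * N2 = H * (16 * Q0 * s / t) ^ β * N2 := by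
    rw [Real.div_rpow (by positivity) ht0.le, Real.rpow_neg ht0.le]
    ring
  rw [e0]
  by_cases hbig : 1 ≤ 16 * Q0 * s / t
  · have h1 : (1 : ℝ) ≤ (16 * Q0 * s / t) ^ β := Real.one_le_rpow hbig hβ
    have h2 : ((G.filter (fun g => g.1 = y ∧ (y', g.2) ∈ G ∧ |qq y' g.2 - qq g.1 g.2| ≤ 2 * s)).card : ℝ)
        ≤ N2 := by
      refine le_trans ?_ (hGy y)
      norm_cast
      apply Finset.card_le_card
      intro g hg
      rw [Finset.mem_filter] at hg ⊢
      exact ⟨hg.1, hg.2.1⟩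
    have h3 : (1 : ℝ) ≤ H * (16 * Q0 * s / t) ^ β := one_le_mul_of_one_le_of_one_le hH h1
    nlinarith
  push Not at hbig
  have hlt : 16 * Q0 * s < t := by rwa [div_lt_one ht0] at hbig
  refine le_trans ?_ (inv y ((y.1 - y'.1) / (y.2 - y'.2)) (16 * Q0 * s / t) ?_ hbig.le)
  · refine Nat.cast_le.2 ?_
    apply Finset.card_le_card
    intro g hg
    rw [Finset.mem_filter] at hg ⊢
    obtain ⟨hgG, hgy, hg', hq⟩ := hg
    refine ⟨hgG, hgy, ?_⟩
    obtain ⟨h41, h01, hQ1⟩ := hG g hgG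
    obtain ⟨h42, h02, hQ2⟩ := hG _ hg'
    rw [hgy] at h41 h01 hQ1 hq ⊢
    simp only at h42 h02 hQ2
    set x := g.2 with hx
    have i1 : y.1 - x.1 = qq y x * (y.2 - x.2) := by unfold qq; field_simp
    have i2 : y'.1 - x.1 = qq y' x * (y'.2 - x.2) := by unfold qq; field_simp
    have i3 : y.1 - y'.1 = qq y x * (y.2 - y'.2) - (qq y' x - qq y x) * (y'.2 - x.2) := by
      linear_combination i1 - i2
    have i4 : |(qq y' x - qq y x) * (y'.2 - x.2)| ≤ 8 * s := by
      rw [abs_mul]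
      calc _ ≤ (2 * s) * 4 := by gcongr
        _ = _ := by ring
    have i5 : |y.1 - y'.1| ≤ Q0 * |y.2 - y'.2| + 8 * s := by
      rw [i3]
      refine (abs_sub _ _).trans ?_
      rw [abs_mul (qq y x)]
      gcongr
    -- t is attained by a coordinate
    have i6 : t ≤ Q0 * |y.2 - y'.2| + 8 * s := by
      have hc : |y.2 - y'.2| ≤ Q0 * |y.2 - y'.2| + 8 * s := by
        have := abs_nonneg (y.2 - y'.2)
        nlinarith
      refine max_le (max_le i5 hc) ?_
      have := abs_nonneg (y.2 - y'.2)
      nlinarith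
    have i7 : t ≤ 2 * Q0 * |y.2 - y'.2| := by nlinarith
    have i8 : 0 < |y.2 - y'.2| := by
      by_contra hcon
      have : |y.2 - y'.2| ≤ 0 := not_lt.1 hcon
      nlinarith
    have i9 : y.2 - y'.2 ≠ 0 := abs_pos.1 i8
    have i10 : qq y x - (y.1 - y'.1) / (y.2 - y'.2) =
        ((qq y' x - qq y x) * (y'.2 - x.2)) / (y.2 - y'.2) := by
      rw [i3]; field_simp; ring
    rw [i10, abs_div]
    rw [div_le_div_iff₀ i8 ht0]
    calc _ ≤ (8 * s) * (2 * Q0 * |y.2 - y'.2|) := by gcongr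
      _ = _ := by ring
  · rw [le_div_iff₀ ht0]
    have : 0 ≤ s := hs.le
    by_cases hρ : 0 ≤ ρ
    · nlinarith
    · nlinarith

open Classical in
/-- number of partners in the same cell with close direction -/
noncomputable def Zc (Y : Finset (ℝ × ℝ)) (G : Finset ((ℝ × ℝ) × (ℝ × ℝ))) (r s : ℝ)
    (g : (ℝ × ℝ) × (ℝ × ℝ)) : ℕ :=
  (Y.filter (fun y' => rcell r y' = rcell r g.1 ∧ (y', g.2) ∈ G ∧
    |qq y' g.2 - qq g.1 g.2| ≤ 2 * s)).card

open Classical in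
lemma sum_Z (Y : Finset (ℝ × ℝ)) (G : Finset ((ℝ × ℝ) × (ℝ × ℝ))) (δ r ρ β H N2 W : ℝ) (Q0 : ℕ)
    (hQ0 : 1 ≤ Q0)
    (hδ : 0 < δ) (hδr : δ ≤ r) (hβ : 0 ≤ β) (hH : 1 ≤ H) (hN2 : 0 ≤ N2) (hWn : 0 ≤ W)
    (hGY : ∀ g ∈ G, g.1 ∈ Y)
    (hG : ∀ g ∈ G, |g.1.2 - g.2.2| ≤ 4 ∧ g.1.2 - g.2.2 ≠ 0 ∧ |qq g.1 g.2| ≤ Q0)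
    (hGy : ∀ y, ((G.filter (fun g => g.1 = y)).card : ℝ) ≤ N2)
    (hYc : (Y.card : ℝ) ≤ N2)
    (hW : ∀ y ∈ Y, ∑ y' ∈ Y.filter (fun y' => rcell r y' = rcell r y), (tdist δ y y') ^ (-β) ≤ W * N2)
    (inv : ∀ y θ s, ρ ≤ s → s ≤ 1 →
      ((G.filter (fun g => g.1 = y ∧ |qq g.1 g.2 - θ| ≤ s)).card : ℝ) ≤ H * s ^ β * N2)
    (s : ℝ) (hs1 : r * ρ ≤ s) (hs2 : δ ≤ s) :
    ∑ g ∈ G, (Zc Y G r s g : ℝ) ≤ H * (16 * Q0 * s) ^ β * W * N2 * N2 ^ 2 := by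
  have hs : 0 < s := by linarith
  have e1 : ∑ g ∈ G, (Zc Y G r s g : ℝ) = ∑ y ∈ Y, ∑ y' ∈ Y.filter (fun y' => rcell r y' = rcell r y),
      ((G.filter (fun g => g.1 = y ∧ (y', g.2) ∈ G ∧ |qq y' g.2 - qq g.1 g.2| ≤ 2 * s)).card : ℝ) := by
    rw [← Finset.sum_fiberwise_of_maps_to hGY]
    refine Finset.sum_congr rfl fun y hy => ?_
    have : ∀ g ∈ G.filter (fun g => g.1 = y), (Zc Y G r s g : ℝ) =
        ∑ y' ∈ Y.filter (fun y' => rcell r y' = rcell r y),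
          if ((y', g.2) ∈ G ∧ |qq y' g.2 - qq g.1 g.2| ≤ 2 * s) then (1 : ℝ) else 0 := by
      intro g hg
      have hgy := (Finset.mem_filter.1 hg).2
      unfold Zc
      rw [← Finset.filter_filter, hgy, Finset.card_filter]
      push_cast
      rfl
    rw [Finset.sum_congr rfl this, Finset.sum_comm]
    refine Finset.sum_congr rfl fun y' hy' => ?_
    rw [← Finset.filter_filter, Finset.card_filter]
    push_cast
    rfl
  rw [e1]
  calc _ ≤ ∑ y ∈ Y, ∑ y' ∈ Y.filter (fun y' => rcell r y' = rcell r y),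
        H * (16 * Q0 * s) ^ β * (tdist δ y y') ^ (-β) * N2 := by
        refine Finset.sum_le_sum fun y _ => Finset.sum_le_sum fun y' hy' => ?_
        exact pairs_bound G δ r ρ β H N2 Q0 hQ0 hδ hδr hβ hH hN2 hG hGy inv y y'
          (Finset.mem_filter.1 hy').2 s hs1 hs2
    _ = ∑ y ∈ Y, H * (16 * Q0 * s) ^ β * N2 *
        ∑ y' ∈ Y.filter (fun y' => rcell r y' = rcell r y), (tdist δ y y') ^ (-β) := by
        refine Finset.sum_congr rfl fun y _ => ?_
        rw [Finset.mul_sum]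
        refine Finset.sum_congr rfl fun y' _ => ?_
        ring
    _ ≤ ∑ y ∈ Y, H * (16 * Q0 * s) ^ β * N2 * (W * N2) := by
        refine Finset.sum_le_sum fun y hy => ?_
        have := hW y hy
        gcongr
    _ = Y.card * (H * (16 * Q0 * s) ^ β * N2 * (W * N2)) := by
        rw [Finset.sum_const, nsmul_eq_mul]
    _ ≤ N2 * (H * (16 * Q0 * s) ^ β * N2 * (W * N2)) := by gcongr
    _ = _ := by ring

open Classical in
lemma cells_line (P : Finset (ℝ × ℝ)) (r u θ x1 x2 : ℝ) (Q0 : ℕ) (hr : 0 < r) (hr1 : r ≤ 1)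
    (hu : ∀ y ∈ P, u ≤ y.2 ∧ y.2 ≤ u + 1) (hθ : |θ| ≤ Q0 + 1)
    (h : ∀ y ∈ P, |y.1 - x1 - θ * (y.2 - x2)| ≤ 4 * r) :
    ((P.image (rcell r)).card : ℝ) ≤ 3 * (2 * Q0 + 11) / r := by
  set R := Finset.Icc ⌊u / r⌋ ⌊(u + 1) / r⌋ with hR
  set cen : ℤ → ℤ := fun k => ⌊(x1 + θ * (k * r - x2)) / r⌋ with hcen
  have hsub : P.image (rcell r) ⊆ R.biUnion (fun k =>
      (Finset.Icc (cen k - (Q0 + 5 : ℕ)) (cen k + (Q0 + 5 : ℕ))).image (fun j => (j, k))) := by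
    intro z hz
    obtain ⟨y, hy, rfl⟩ := Finset.mem_image.1 hz
    obtain ⟨hu1, hu2⟩ := hu y hy
    have hh := h y hy
    rw [Finset.mem_biUnion]
    refine ⟨⌊y.2 / r⌋, ?_, ?_⟩
    · rw [hR, Finset.mem_Icc]
      exact ⟨Int.floor_le_floor (by gcongr), Int.floor_le_floor (by gcongr)⟩
    · rw [Finset.mem_image]
      refine ⟨⌊y.1 / r⌋, ?_, rfl⟩
      rw [Finset.mem_Icc]
      set k := ⌊y.2 / r⌋ with hk
      have k1 : (k : ℝ) * r ≤ y.2 := by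
        have := Int.floor_le (y.2 / r)
        rwa [le_div_iff₀ hr] at this
      have k2 : y.2 ≤ k * r + r := by
        have := (Int.lt_floor_add_one (y.2 / r)).le
        rw [div_le_iff₀ hr] at this
        linarith
      have m1 : |θ * (y.2 - k * r)| ≤ (Q0 + 1) * r := by
        rw [abs_mul]
        have : |y.2 - k * r| ≤ r := by rw [abs_le]; constructor <;> linarith
        gcongr
      have m2 : |y.1 - (x1 + θ * (k * r - x2))| ≤ (Q0 + 5) * r := by
        have e : y.1 - (x1 + θ * (k * r - x2)) =
          (y.1 - x1 - θ * (y.2 - x2)) + θ * (y.2 - k * r) := by ring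
        rw [e]
        refine (abs_add_le _ _).trans ?_
        linarith
      rw [abs_le] at m2
      have f1 : (x1 + θ * (k * r - x2)) / r - (Q0 + 5 : ℕ) ≤ y.1 / r := by
        rw [sub_le_iff_le_add, div_le_iff₀ hr, add_mul, div_mul_cancel₀ _ hr.ne']
        push_cast
        linarith
      have f2 : y.1 / r ≤ (x1 + θ * (k * r - x2)) / r + (Q0 + 5 : ℕ) := by
        rw [div_le_iff₀ hr, add_mul, div_mul_cancel₀ _ hr.ne']
        push_cast
        linarith
      have f3 := Int.floor_le_floor f1
      have f4 := Int.floor_le_floor f2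
      rw [Int.floor_sub_natCast] at f3
      rw [Int.floor_add_natCast] at f4
      exact ⟨f3, f4⟩
  have h1 := Finset.card_le_card hsub
  have h2 := h1.trans (Finset.card_biUnion_le_card_mul R _ (2 * Q0 + 11) (by
    intro k _
    refine Finset.card_image_le.trans ?_
    rw [Int.card_Icc]
    omega))
  have h3 : (R.card : ℝ) ≤ 3 / r := by
    rw [hR, Int.card_Icc]
    have a1 : (⌊(u + 1) / r⌋ : ℝ) ≤ (u + 1) / r := Int.floor_le _
    have a2 : u / r < ⌊u / r⌋ + 1 := Int.lt_floor_add_one _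
    have a3 : ⌊u / r⌋ ≤ ⌊(u + 1) / r⌋ := Int.floor_le_floor (by gcongr; linarith)
    have a4 : (((⌊(u + 1) / r⌋ + 1 - ⌊u / r⌋).toNat : ℤ) : ℝ) = ⌊(u + 1) / r⌋ + 1 - ⌊u / r⌋ := by
      rw [Int.toNat_of_nonneg (by omega)]
      push_cast
      ring
    rw [Int.cast_natCast] at a4
    rw [a4]
    have a5 : 1 ≤ 1 / r := by rwa [le_div_iff₀ hr, one_mul]
    have a6 : (u + 1) / r = u / r + 1 / r := by rw [add_div]
    have a7 : 3 / r = 3 * (1 / r) := by ring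
    rw [a7]
    linarith
  calc ((P.image (rcell r)).card : ℝ) ≤ R.card * (2 * Q0 + 11) := by exact_mod_cast h2
    _ ≤ 3 / r * (2 * Q0 + 11) := by gcongr
    _ = _ := by ring

lemma dyadic_pick (s ρ' : ℝ) (Kd : ℕ) (hKd : 1 ≤ Kd) (hs : ρ' ≤ s) (hs1 : s ≤ 1)
    (hK : (1 / 2 : ℝ) ^ Kd ≤ ρ') : ∃ i < Kd, s ≤ (1 / 2 : ℝ) ^ i ∧ (1 / 2 : ℝ) ^ i ≤ 2 * s := by
  have hex : ∃ n, (1 / 2 : ℝ) ^ n ≤ s := ⟨Kd, hK.trans hs⟩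
  classical
  have hn := Nat.find_spec hex
  have hle : Nat.find hex ≤ Kd := Nat.find_min' hex (hK.trans hs)
  have hmin := @Nat.find_min _ _ hex
  generalize Nat.find hex = n at *
  rcases n with _ | i
  · refine ⟨0, by omega, by simpa using hs1, ?_⟩
    rw [pow_zero] at hn ⊢
    linarith
  · refine ⟨i, by omega, ?_, ?_⟩
    · have := hmin (Nat.lt_succ_self i)
      push Not at this
      exact this.le
    · rw [pow_succ] at hn
      linarith

open Classical in
lemma half_step (Y : Finset (ℝ × ℝ)) (G : Finset ((ℝ × ℝ) × (ℝ × ℝ))) (δ r ρ ρ' β H N2 W κ : ℝ)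
    (Q0 Kd : ℕ)
    (hQ0 : 1 ≤ Q0)
    (hδ : 0 < δ) (hδr : δ ≤ r) (hr1 : r ≤ 1) (hβ : 0 ≤ β) (hβ1 : β ≤ 1) (hH : 1 ≤ H) (hN2 : 0 < N2)
    (hWn : 0 < W)
    (hGY : ∀ g ∈ G, g.1 ∈ Y)
    (hG : ∀ g ∈ G, |g.1.2 - g.2.2| ≤ 4 ∧ g.1.2 - g.2.2 ≠ 0 ∧ |qq g.1 g.2| ≤ Q0)
    (hGy : ∀ y, ((G.filter (fun g => g.1 = y)).card : ℝ) ≤ N2)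
    (hYc : (Y.card : ℝ) ≤ N2)
    (u : ℝ) (hu : ∀ y ∈ Y, u ≤ y.2 ∧ y.2 ≤ u + 1)
    (hW : ∀ y ∈ Y, ∑ y' ∈ Y.filter (fun y' => rcell r y' = rcell r y), (tdist δ y y') ^ (-β) ≤ W * N2)
    (inv : ∀ y θ s, ρ ≤ s → s ≤ 1 →
      ((G.filter (fun g => g.1 = y ∧ |qq g.1 g.2 - θ| ≤ s)).card : ℝ) ≤ H * s ^ β * N2)
    (hρ1 : r * ρ ≤ ρ') (hρ2 : δ ≤ ρ') (hρr : ρ ≤ r) (hKd1 : 1 ≤ Kd) (hKd : (1 / 2 : ℝ) ^ Kd ≤ ρ')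
    (hκ : 0 < κ) (hsmall : 3 * (2 * Q0 + 11) * (Kd / κ) * (32 * Q0) * W ≤ r) :
    ∃ G' ⊆ G, ((G \ G').card : ℝ) ≤ κ * N2 ^ 2 ∧ ∀ x θ s, ρ' ≤ s → s ≤ ρ →
      ((G'.filter (fun g => g.2 = x ∧ |qq g.1 g.2 - θ| ≤ s)).card : ℝ) ≤ H * s ^ β * N2 := by
  have hr : 0 < r := by linarith
  have hQr : (1 : ℝ) ≤ Q0 := by exact_mod_cast hQ0
  have hKdr : (1 : ℝ) ≤ Kd := by exact_mod_cast hKd1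
  set lam : ℝ := Kd / κ with hlam
  have hlam0 : 0 < lam := by positivity
  set X : ℕ → ℝ := fun i => H * (16 * Q0 * (1 / 2 : ℝ) ^ i) ^ β * W * N2 with hX
  have hX0 : ∀ i, 0 < X i := fun i => by simp only [hX]; positivity
  set I := (Finset.range Kd).filter (fun i => ρ' ≤ (1 / 2 : ℝ) ^ i) with hI
  set Bad : ℕ → Finset ((ℝ × ℝ) × (ℝ × ℝ)) := fun i =>
    G.filter (fun g => lam * X i < Zc Y G r ((1 / 2 : ℝ) ^ i) g) with hBad
  have hBadc : ∀ i ∈ I, ((Bad i).card : ℝ) ≤ N2 ^ 2 / lam := by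
    intro i hi
    rw [hI, Finset.mem_filter] at hi
    have hs := sum_Z Y G δ r ρ β H N2 W Q0 hQ0 hδ hδr hβ hH hN2.le hWn.le hGY hG hGy hYc hW inv
      ((1 / 2 : ℝ) ^ i) (hρ1.trans hi.2) (hρ2.trans hi.2)
    have hm : ((Bad i).card : ℝ) * (lam * X i) ≤ X i * N2 ^ 2 := by
      refine le_trans ?_ hs
      calc ((Bad i).card : ℝ) * (lam * X i) = ∑ g ∈ Bad i, lam * X i := by
            rw [Finset.sum_const, nsmul_eq_mul]
        _ ≤ ∑ g ∈ Bad i, (Zc Y G r ((1 / 2 : ℝ) ^ i) g : ℝ) :=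
            Finset.sum_le_sum fun g hg => (Finset.mem_filter.1 hg).2.le
        _ ≤ _ := Finset.sum_le_sum_of_subset_of_nonneg (Finset.filter_subset _ _)
            (fun _ _ _ => by positivity)
    rw [le_div_iff₀ hlam0]
    have h0 := hX0 i
    have : X i * (((Bad i).card : ℝ) * lam) ≤ X i * N2 ^ 2 := by linarith
    exact le_of_mul_le_mul_left this h0
  refine ⟨G \ I.biUnion Bad, Finset.sdiff_subset, ?_, ?_⟩
  · have hs : G \ (G \ I.biUnion Bad) ⊆ I.biUnion Bad := by
      intro g hg
      rw [Finset.mem_sdiff, Finset.mem_sdiff] at hg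
      by_contra hcon
      exact hg.2 ⟨hg.1, hcon⟩
    have h1 : ((G \ (G \ I.biUnion Bad)).card : ℝ) ≤ ∑ i ∈ I, ((Bad i).card : ℝ) := by
      exact_mod_cast (Finset.card_le_card hs).trans Finset.card_biUnion_le
    refine h1.trans ((Finset.sum_le_sum hBadc).trans ?_)
    rw [Finset.sum_const, nsmul_eq_mul]
    have h2 : (I.card : ℝ) ≤ Kd := by
      have := Finset.card_le_card (Finset.filter_subset (fun i => ρ' ≤ (1 / 2 : ℝ) ^ i) (Finset.range Kd))
      rw [Finset.card_range] at this
      exact_mod_cast this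
    calc (I.card : ℝ) * (N2 ^ 2 / lam) ≤ Kd * (N2 ^ 2 / lam) := by gcongr
      _ = κ * N2 ^ 2 := by rw [hlam]; field_simp
  · intro x θ s hs1 hs2
    have hs0 : 0 < s := by linarith
    obtain ⟨i, hiK, hi1, hi2⟩ := dyadic_pick s ρ' Kd hKd1 hs1 (by linarith) hKd
    have hiI : i ∈ I := by
      rw [hI, Finset.mem_filter, Finset.mem_range]
      exact ⟨hiK, hs1.trans hi1⟩
    set V := (G \ I.biUnion Bad).filter (fun g => g.2 = x ∧ |qq g.1 g.2 - θ| ≤ s) with hV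
    have hVm : ∀ g ∈ V, g ∈ G ∧ (Zc Y G r ((1 / 2 : ℝ) ^ i) g : ℝ) ≤ lam * X i ∧ g.2 = x ∧
        |qq g.1 g.2 - θ| ≤ s := by
      intro g hg
      rw [hV, Finset.mem_filter, Finset.mem_sdiff] at hg
      refine ⟨hg.1.1, ?_, hg.2⟩
      by_contra hcon
      push Not at hcon
      exact hg.1.2 (Finset.mem_biUnion.2 ⟨i, hiI, Finset.mem_filter.2 ⟨hg.1.1, hcon⟩⟩)
    rcases V.eq_empty_or_nonempty with hVe | ⟨g1, hg1⟩
    · rw [hVe]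
      simp only [Finset.card_empty, Nat.cast_zero]
      positivity
    have hθ : |θ| ≤ Q0 + 1 := by
      obtain ⟨a1, a2, a3, a4⟩ := hVm g1 hg1
      have a5 := (hG g1 a1).2.2
      rw [abs_le] at a4 a5 ⊢
      constructor <;> linarith
    have hfib := Finset.card_le_mul_card_image (f := fun g : (ℝ × ℝ) × (ℝ × ℝ) => rcell r g.1)
      V ⌊lam * X i⌋₊ (by
        intro z hz
        obtain ⟨g0, hg0, rfl⟩ := Finset.mem_image.1 hz
        obtain ⟨a1, a2, a3, a4⟩ := hVm g0 hg0
        refine le_trans ?_ (Nat.le_floor a2)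
        unfold Zc
        apply Finset.card_le_card_of_injOn (fun g => g.1)
        · intro g hg
          rw [Finset.mem_coe, Finset.mem_filter] at hg
          obtain ⟨b1, b2, b3, b4⟩ := hVm g hg.1
          rw [Finset.mem_coe, Finset.mem_filter]
          refine ⟨hGY g b1, hg.2, ?_, ?_⟩
          · rw [a3, ← b3]; exact b1
          · rw [a3, ← b3]
            rw [b3] at b4 ⊢
            rw [a3] at a4
            rw [abs_le] at a4 b4 ⊢
            constructor <;> linarith
        · intro g hg g' hg' he
          rw [Finset.mem_coe, Finset.mem_filter] at hg hg'
          have b := (hVm g hg.1).2.2.1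
          have b' := (hVm g' hg'.1).2.2.1
          exact Prod.ext he (b.trans b'.symm))
    have hcell := cells_line (V.image Prod.fst) r u θ x.1 x.2 Q0 hr hr1
      (by
        intro y hy
        obtain ⟨g, hg, rfl⟩ := Finset.mem_image.1 hy
        exact hu _ (hGY g (hVm g hg).1)) hθ
      (by
        intro y hy
        obtain ⟨g, hg, rfl⟩ := Finset.mem_image.1 hy
        obtain ⟨b1, b2, b3, b4⟩ := hVm g hg
        obtain ⟨c1, c2, c3⟩ := hG g b1
        rw [b3] at b4 c1 c2 c3
        have e : g.1.1 - x.1 - θ * (g.1.2 - x.2) = (qq g.1 x - θ) * (g.1.2 - x.2) := by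
          unfold qq; field_simp
        rw [e, abs_mul]
        calc _ ≤ s * 4 := by gcongr
          _ ≤ r * 4 := by gcongr; linarith
          _ = _ := by ring)
    rw [Finset.image_image] at hcell
    have hXi : X i ≤ H * (32 * Q0 * s ^ β) * W * N2 := by
      simp only [hX]
      have : (16 * Q0 * (1 / 2 : ℝ) ^ i) ^ β ≤ 32 * Q0 * s ^ β := by
        calc (16 * Q0 * (1 / 2 : ℝ) ^ i) ^ β ≤ (16 * Q0 * (2 * s)) ^ β := by gcongr
          _ = (32 * Q0 * s) ^ β := by ring_nf
          _ = (32 * Q0) ^ β * s ^ β := Real.mul_rpow (by positivity) hs0.le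
          _ ≤ (32 * Q0) ^ (1 : ℝ) * s ^ β := by
            gcongr
            linarith
          _ = _ := by rw [Real.rpow_one]
      gcongr
    calc (V.card : ℝ) ≤ (⌊lam * X i⌋₊ : ℝ) * ((V.image (fun g => rcell r g.1)).card : ℝ) := by
          exact_mod_cast hfib
      _ ≤ (lam * X i) * (3 * (2 * Q0 + 11) / r) := by
          gcongr
          · exact Nat.floor_le (mul_nonneg hlam0.le (hX0 i).le)
          · exact hcell
      _ ≤ (lam * (H * (32 * Q0 * s ^ β) * W * N2)) * (3 * (2 * Q0 + 11) / r) := by gcongr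
      _ = (3 * (2 * Q0 + 11) * lam * (32 * Q0) * W / r) * (H * s ^ β * N2) := by ring
      _ ≤ 1 * (H * s ^ β * N2) := by
          gcongr
          rwa [div_le_one hr]
      _ = _ := one_mul _

open Classical in
lemma fst_fib (Y X : Finset (ℝ × ℝ)) (G : Finset ((ℝ × ℝ) × (ℝ × ℝ))) (h : G ⊆ Y ×ˢ X) (y : ℝ × ℝ) :
    (G.filter (fun g => g.1 = y)).card ≤ X.card := by
  apply Finset.card_le_card_of_injOn (fun g => g.2)
  · intro g hg
    rw [Finset.mem_coe, Finset.mem_filter] at hg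
    exact (Finset.mem_product.1 (h hg.1)).2
  · intro g hg g' hg' he
    rw [Finset.mem_coe, Finset.mem_filter] at hg hg'
    exact Prod.ext (hg.2.trans hg'.2.symm) he

open Classical in
/-- direction regularity seen from the first points -/
def InvY (G : Finset ((ℝ × ℝ) × (ℝ × ℝ))) (H β N2 a b : ℝ) : Prop :=
  ∀ y θ s, a ≤ s → s ≤ b →
      ((G.filter (fun g => g.1 = y ∧ |qq g.1 g.2 - θ| ≤ s)).card : ℝ) ≤ H * s ^ β * N2

open Classical in
/-- direction regularity seen from the second points -/
def InvX (G : Finset ((ℝ × ℝ) × (ℝ × ℝ))) (H β N2 a b : ℝ) : Prop :=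
  ∀ y θ s, a ≤ s → s ≤ b →
      ((G.filter (fun g => g.2 = y ∧ |qq g.1 g.2 - θ| ≤ s)).card : ℝ) ≤ H * s ^ β * N2

open Classical in
lemma InvY.mono {G G' : Finset ((ℝ × ℝ) × (ℝ × ℝ))} {H β N2 a b : ℝ} (h : InvY G H β N2 a b)
    (hs : G' ⊆ G) : InvY G' H β N2 a b := by
  intro y θ s h1 h2
  refine le_trans ?_ (h y θ s h1 h2)
  exact Nat.cast_le.2 (Finset.card_le_card (Finset.filter_subset_filter _ hs))

open Classical in
lemma InvX.mono {G G' : Finset ((ℝ × ℝ) × (ℝ × ℝ))} {H β N2 a b : ℝ} (h : InvX G H β N2 a b)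
    (hs : G' ⊆ G) : InvX G' H β N2 a b := by
  intro y θ s h1 h2
  refine le_trans ?_ (h y θ s h1 h2)
  exact Nat.cast_le.2 (Finset.card_le_card (Finset.filter_subset_filter _ hs))

lemma InvX.glue {G : Finset ((ℝ × ℝ) × (ℝ × ℝ))} {H β N2 a b c : ℝ} (h : InvX G H β N2 a b)
    (h' : InvX G H β N2 b c) : InvX G H β N2 a c := by
  intro y θ s h1 h2
  rcases le_total s b with hb | hb
  · exact h y θ s h1 hb
  · exact h' y θ s hb h2

lemma InvY.glue {G : Finset ((ℝ × ℝ) × (ℝ × ℝ))} {H β N2 a b c : ℝ} (h : InvY G H β N2 a b)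
    (h' : InvY G H β N2 b c) : InvY G H β N2 a c := by
  intro y θ s h1 h2
  rcases le_total s b with hb | hb
  · exact h y θ s h1 hb
  · exact h' y θ s hb h2

open Classical in
lemma swap_filter (G : Finset ((ℝ × ℝ) × (ℝ × ℝ))) (y : ℝ × ℝ) (θ s : ℝ) :
    ((G.image Prod.swap).filter (fun g => g.1 = y ∧ |qq g.1 g.2 - θ| ≤ s)).card =
    (G.filter (fun g => g.2 = y ∧ |qq g.1 g.2 - θ| ≤ s)).card := by
  rw [Finset.filter_image, Finset.card_image_of_injective _ Prod.swap_injective]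
  congr 1
  apply Finset.filter_congr
  intro g _
  simp only [Prod.fst_swap, Prod.snd_swap]
  rw [qq_comm]

open Classical in
lemma InvX_swap {G : Finset ((ℝ × ℝ) × (ℝ × ℝ))} {H β N2 a b : ℝ} :
    InvY (G.image Prod.swap) H β N2 a b ↔ InvX G H β N2 a b := by
  unfold InvY InvX
  constructor
  · intro h y θ s h1 h2
    have := h y θ s h1 h2
    rwa [swap_filter] at this
  · intro h y θ s h1 h2
    have := h y θ s h1 h2
    rwa [swap_filter]

open Classical in
lemma image_swap_swap (G : Finset ((ℝ × ℝ) × (ℝ × ℝ))) : (G.image Prod.swap).image Prod.swap = G := by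
  rw [Finset.image_image]
  simp

open Classical in
lemma full_iter (Y X : Finset (ℝ × ℝ)) (G : Finset ((ℝ × ℝ) × (ℝ × ℝ))) (δ r β H N2 W κ : ℝ)
    (Q0 Kd : ℕ)
    (hQ0 : 1 ≤ Q0)
    (hδ : 0 < δ) (hδr : δ ≤ r) (hr1 : r ≤ 1) (hβ : 0 ≤ β) (hβ1 : β ≤ 1) (hH : 1 ≤ H) (hN2 : 0 < N2)
    (hWn : 0 < W)
    (hGYX : G ⊆ Y ×ˢ X)
    (hG : ∀ g ∈ G, |g.1.2 - g.2.2| ≤ 4 ∧ g.1.2 - g.2.2 ≠ 0 ∧ |qq g.1 g.2| ≤ Q0)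
    (hYc : (Y.card : ℝ) ≤ N2) (hXc : (X.card : ℝ) ≤ N2)
    (u : ℝ) (hu : ∀ y ∈ Y, u ≤ y.2 ∧ y.2 ≤ u + 1)
    (v : ℝ) (hv : ∀ y ∈ X, v ≤ y.2 ∧ y.2 ≤ v + 1)
    (hWY : ∀ y ∈ Y, ∑ y' ∈ Y.filter (fun y' => rcell r y' = rcell r y), (tdist δ y y') ^ (-β) ≤ W * N2)
    (hWX : ∀ y ∈ X, ∑ y' ∈ X.filter (fun y' => rcell r y' = rcell r y), (tdist δ y y') ^ (-β) ≤ W * N2)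
    (invY : InvY G H β N2 r 1) (invX : InvX G H β N2 r 1)
    (hKd1 : 1 ≤ Kd) (hKd : (1 / 2 : ℝ) ^ Kd ≤ δ)
    (hκ : 0 < κ) (hsmall : 3 * (2 * Q0 + 11) * (Kd / κ) * (32 * Q0) * W ≤ r) (n : ℕ) :
    ∃ G' ⊆ G, ((G \ G').card : ℝ) ≤ n * (2 * κ) * N2 ^ 2 ∧
      InvY G' H β N2 (max (r ^ (n + 1)) δ) 1 ∧ InvX G' H β N2 (max (r ^ (n + 1)) δ) 1 := by
  have hr : 0 < r := by linarith
  induction n with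
  | zero =>
    refine ⟨G, subset_rfl, ?_, ?_, ?_⟩
    · simp
    · simpa [hδr] using invY
    · simpa [hδr] using invX
  | succ n ih =>
    obtain ⟨G1, hG1, hc1, hY1, hX1⟩ := ih
    set ρ := max (r ^ (n + 1)) δ with hρ
    set ρ' := max (r ^ (n + 1 + 1)) δ with hρ'
    have q1 : r * ρ ≤ ρ' := by
      rw [hρ, mul_max_of_nonneg _ _ hr.le]
      apply max_le
      · rw [← pow_succ']
        exact le_max_left _ _
      · exact le_trans (by nlinarith) (le_max_right _ _)
    have q2 : δ ≤ ρ' := le_max_right _ _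
    have q3 : ρ ≤ r := by
      apply max_le _ hδr
      calc r ^ (n + 1) ≤ r ^ 1 := pow_le_pow_of_le_one hr.le hr1 (by omega)
        _ = r := pow_one r
    have q4 : ρ ≤ 1 := q3.trans hr1
    have hsub1 : G1 ⊆ Y ×ˢ X := hG1.trans hGYX
    obtain ⟨G2, hG2, hc2, hX2⟩ := half_step Y G1 δ r ρ ρ' β H N2 W κ Q0 Kd hQ0 hδ hδr hr1 hβ hβ1 hH
      hN2 hWn (fun g hg => (Finset.mem_product.1 (hsub1 hg)).1) (fun g hg => hG g (hG1 hg))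
      (fun y => le_trans (Nat.cast_le.2 (fst_fib Y X G1 hsub1 y)) hXc) hYc u hu hWY hY1 q1 q2 q3 hKd1
      (hKd.trans q2) hκ hsmall
    have hsub2 : G2 ⊆ Y ×ˢ X := hG2.trans hsub1
    have hsw : G2.image Prod.swap ⊆ X ×ˢ Y := by
      intro g hg
      obtain ⟨g', hg', rfl⟩ := Finset.mem_image.1 hg
      have := Finset.mem_product.1 (hsub2 hg')
      exact Finset.mem_product.2 ⟨this.2, this.1⟩
    obtain ⟨G3, hG3, hc3, hY3⟩ := half_step X (G2.image Prod.swap) δ r ρ ρ' β H N2 W κ Q0 Kd hQ0 hδ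
      hδr hr1 hβ hβ1 hH
      hN2 hWn (fun g hg => (Finset.mem_product.1 (hsw hg)).1)
      (fun g hg => by
        obtain ⟨g', hg', rfl⟩ := Finset.mem_image.1 hg
        obtain ⟨a1, a2, a3⟩ := hG g' (hG1 (hG2 hg'))
        simp only [Prod.fst_swap, Prod.snd_swap]
        rw [qq_comm, abs_sub_comm]
        exact ⟨a1, sub_ne_zero.2 (sub_ne_zero.1 a2).symm, a3⟩)
      (fun y => le_trans (Nat.cast_le.2 (fst_fib X Y _ hsw y)) hYc) hXc v hv hWX
      (InvX_swap.2 (hX1.mono hG2)) q1 q2 q3 hKd1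
      (hKd.trans q2) hκ hsmall
    have hG4 : G3.image Prod.swap ⊆ G2 := by
      rw [← image_swap_swap G2]
      exact Finset.image_subset_image hG3
    have hY4 : InvY (G3.image Prod.swap) H β N2 ρ' ρ := by
      rw [InvX_swap]
      exact hY3
    have hc4 : ((G2 \ G3.image Prod.swap).card : ℝ) ≤ κ * N2 ^ 2 := by
      rw [← Finset.card_image_of_injective _ Prod.swap_injective,
        Finset.image_sdiff _ _ Prod.swap_injective, image_swap_swap]
      exact hc3
    refine ⟨G3.image Prod.swap, hG4.trans (hG2.trans hG1), ?_, ?_, ?_⟩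
    · have hss : G \ G3.image Prod.swap ⊆ ((G \ G1) ∪ (G1 \ G2)) ∪ (G2 \ G3.image Prod.swap) := by
        intro g hg
        simp only [Finset.mem_union, Finset.mem_sdiff] at hg ⊢
        tauto
      have h1 := (Finset.card_le_card hss).trans ((Finset.card_union_le _ _).trans
        (Nat.add_le_add_right (Finset.card_union_le _ _) _))
      have h2 : ((G \ G3.image Prod.swap).card : ℝ) ≤ (G \ G1).card + (G1 \ G2).card +
        (G2 \ G3.image Prod.swap).card := by exact_mod_cast h1
      push_cast
      linarith
    · exact hY4.glue ((hY1.mono hG2).mono hG4)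
    · exact (InvX.mono (show InvX G2 H β N2 ρ' ρ from hX2) hG4).glue ((hX1.mono hG2).mono hG4)

/-- improved non-concentration at scales between `δ` and `r` -/
def BallC (A : Finset ℝ) (δ r C1 ε σ' : ℝ) : Prop :=
  ∀ x t, δ ≤ t → t ≤ r →
    ((A.filter (fun a => |a - x| ≤ t)).card : ℝ) ≤ C1 * r ^ (1 - ε) * (t / r) ^ σ' * A.card

open Classical in
lemma energy (A : Finset ℝ) (δ r C1 ε σ' β : ℝ) (Kd : ℕ) (hδ : 0 < δ) (hδr : δ ≤ r) (hr1 : r ≤ 1)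
    (hC1 : 1 ≤ C1) (hβ : 0 ≤ β) (hβ1 : β ≤ 1) (hβσ : β ≤ 2 * σ')
    (hKd1 : 1 ≤ Kd) (hKd : (1 / 2 : ℝ) ^ Kd ≤ δ) (hA : BallC A δ r C1 ε σ') (y : ℝ × ℝ) :
    ∑ y' ∈ (A ×ˢ A).filter (fun y' => rcell r y' = rcell r y), (tdist δ y y') ^ (-β) ≤
      (2 * C1 ^ 2 * Kd * r ^ (2 - 2 * ε - β)) * (A.card : ℝ) ^ 2 := by
  have hr : 0 < r := by linarith
  set F := (A ×ˢ A).filter (fun y' => rcell r y' = rcell r y) with hF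
  have h1 : ∀ y' ∈ F, (tdist δ y y') ^ (-β) ≤ ∑ i ∈ Finset.range Kd,
      if (tdist δ y y' ≤ r * (1 / 2 : ℝ) ^ i) then 2 * (r * (1 / 2 : ℝ) ^ i) ^ (-β) else 0 := by
    intro y' hy'
    have htr : tdist δ y y' ≤ r := tdist_le hr hδr (Finset.mem_filter.1 hy').2
    have htδ : δ ≤ tdist δ y y' := le_max_right _ _
    set t := tdist δ y y'
    have ht0 : 0 < t := by linarith
    obtain ⟨i, hi, hi1, hi2⟩ := dyadic_pick (t / r) δ Kd hKd1
      (by rw [le_div_iff₀ hr]; nlinarith) (by rwa [div_le_one hr]) hKd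
    rw [div_le_iff₀ hr] at hi1
    have hi3 : r * (1 / 2 : ℝ) ^ i ≤ 2 * t := by
      have := mul_le_mul_of_nonneg_left hi2 hr.le
      have e : r * (2 * (t / r)) = 2 * t := by field_simp
      linarith
    refine le_trans ?_ (Finset.single_le_sum (f := fun i => if (t ≤ r * (1 / 2 : ℝ) ^ i) then
      2 * (r * (1 / 2 : ℝ) ^ i) ^ (-β) else 0) ?_ (Finset.mem_range.2 hi))
    · rw [if_pos (by linarith)]
      calc t ^ (-β) = 2 ^ β * (2 * t) ^ (-β) := by
            rw [Real.mul_rpow (by norm_num) ht0.le, ← mul_assoc, ← Real.rpow_add (by norm_num)]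
            simp
        _ ≤ 2 ^ (1 : ℝ) * (r * (1 / 2 : ℝ) ^ i) ^ (-β) := by
            gcongr ?_ * ?_
            · exact Real.rpow_le_rpow_of_exponent_le (by norm_num) hβ1
            · exact Real.rpow_le_rpow_of_nonpos (by positivity) hi3 (by linarith)
        _ = _ := by rw [Real.rpow_one]
    · intro j _
      split_ifs
      · positivity
      · exact le_rfl
  have h2 : ∀ i ∈ Finset.range Kd, ∑ y' ∈ F, (if (tdist δ y y' ≤ r * (1 / 2 : ℝ) ^ i) then
      2 * (r * (1 / 2 : ℝ) ^ i) ^ (-β) else 0) ≤ 2 * C1 ^ 2 * r ^ (2 - 2 * ε - β) * (A.card : ℝ) ^ 2 := by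
    intro i _
    by_cases hδi : δ ≤ r * (1 / 2 : ℝ) ^ i
    · rw [← Finset.sum_filter, Finset.sum_const, nsmul_eq_mul]
      set p : ℝ := (1 / 2 : ℝ) ^ i with hp
      have hp0 : 0 < p := by positivity
      have hp1 : p ≤ 1 := pow_le_one₀ (by norm_num) (by norm_num)
      have hsub : F.filter (fun y' => tdist δ y y' ≤ r * p) ⊆
          (A.filter (fun a => |a - y.1| ≤ r * p)) ×ˢ (A.filter (fun a => |a - y.2| ≤ r * p)) := by
        intro y' hy'
        rw [Finset.mem_filter, hF, Finset.mem_filter, Finset.mem_product] at hy'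
        obtain ⟨⟨⟨b1, b2⟩, _⟩, b3⟩ := hy'
        unfold tdist at b3
        rw [max_le_iff, max_le_iff, abs_sub_comm, abs_sub_comm y.2] at b3
        rw [Finset.mem_product, Finset.mem_filter, Finset.mem_filter]
        exact ⟨⟨b1, b3.1.1⟩, ⟨b2, b3.1.2⟩⟩
      have hc := Finset.card_le_card hsub
      rw [Finset.card_product] at hc
      have hb : ∀ x, ((A.filter (fun a => |a - x| ≤ r * p)).card : ℝ) ≤
          C1 * r ^ (1 - ε) * p ^ σ' * A.card := by
        intro x
        have := hA x (r * p) hδi (by nlinarith)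
        rwa [mul_div_cancel_left₀ _ hr.ne'] at this
      have hc2 : ((F.filter (fun y' => tdist δ y y' ≤ r * p)).card : ℝ) ≤
          (C1 * r ^ (1 - ε) * p ^ σ' * A.card) * (C1 * r ^ (1 - ε) * p ^ σ' * A.card) := by
        calc ((F.filter (fun y' => tdist δ y y' ≤ r * p)).card : ℝ) ≤
            ((A.filter (fun a => |a - y.1| ≤ r * p)).card : ℝ) *
              ((A.filter (fun a => |a - y.2| ≤ r * p)).card : ℝ) := by exact_mod_cast hc
          _ ≤ _ := mul_le_mul (hb _) (hb _) (by positivity) (by positivity)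
      calc _ ≤ (C1 * r ^ (1 - ε) * p ^ σ' * A.card) * (C1 * r ^ (1 - ε) * p ^ σ' * A.card) *
            (2 * (r * p) ^ (-β)) := by gcongr
        _ = 2 * C1 ^ 2 * (r ^ (1 - ε) * r ^ (1 - ε) * r ^ (-β)) * (A.card : ℝ) ^ 2 *
            (p ^ σ' * p ^ σ' * p ^ (-β)) := by
            rw [Real.mul_rpow hr.le hp0.le]
            ring
        _ = 2 * C1 ^ 2 * r ^ (2 - 2 * ε - β) * (A.card : ℝ) ^ 2 * p ^ (2 * σ' - β) := by
            rw [← Real.rpow_add hr, ← Real.rpow_add hr, ← Real.rpow_add hp0, ← Real.rpow_add hp0]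
            ring_nf
        _ ≤ 2 * C1 ^ 2 * r ^ (2 - 2 * ε - β) * (A.card : ℝ) ^ 2 * 1 := by
            gcongr
            exact Real.rpow_le_one hp0.le hp1 (by linarith)
        _ = _ := mul_one _
    · have : ∀ y' ∈ F, (if (tdist δ y y' ≤ r * (1 / 2 : ℝ) ^ i) then
          2 * (r * (1 / 2 : ℝ) ^ i) ^ (-β) else 0) = 0 := by
        intro y' _
        rw [if_neg]
        have htδ : δ ≤ tdist δ y y' := le_max_right _ _
        intro hh
        exact hδi (htδ.trans hh)
      rw [Finset.sum_congr rfl this, Finset.sum_const_zero]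
      positivity
  calc _ ≤ ∑ y' ∈ F, ∑ i ∈ Finset.range Kd,
      (if (tdist δ y y' ≤ r * (1 / 2 : ℝ) ^ i) then 2 * (r * (1 / 2 : ℝ) ^ i) ^ (-β) else 0) :=
        Finset.sum_le_sum h1
    _ = ∑ i ∈ Finset.range Kd, ∑ y' ∈ F,
      (if (tdist δ y y' ≤ r * (1 / 2 : ℝ) ^ i) then 2 * (r * (1 / 2 : ℝ) ^ i) ^ (-β) else 0) :=
        Finset.sum_comm
    _ ≤ ∑ i ∈ Finset.range Kd, 2 * C1 ^ 2 * r ^ (2 - 2 * ε - β) * (A.card : ℝ) ^ 2 :=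
        Finset.sum_le_sum h2
    _ = _ := by
        rw [Finset.sum_const, Finset.card_range, nsmul_eq_mul]
        ring

open Classical in
/-- covering an interval of radius four s by `r`-intervals -/
lemma cover_count (A : Finset ℝ) (r M z s : ℝ) (hr : 0 < r) (hrs : r ≤ s) (hM : 0 ≤ M)
    (h : ∀ x, ((A.filter (fun a => |a - x| ≤ r)).card : ℝ) ≤ M) :
    ((A.filter (fun a => |a - z| ≤ 4 * s)).card : ℝ) ≤ 10 * (s / r) * M := by
  set V := A.filter (fun a => |a - z| ≤ 4 * s) with hV
  have h1 := Finset.card_le_mul_card_image (f := fun a : ℝ => ⌊a / r⌋) V ⌊M⌋₊ (by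
    intro k hk
    obtain ⟨a0, ha0, rfl⟩ := Finset.mem_image.1 hk
    apply Nat.le_floor
    refine le_trans (Nat.cast_le.2 (Finset.card_le_card ?_)) (h a0)
    intro a ha
    rw [Finset.mem_filter] at ha ⊢
    refine ⟨(Finset.mem_filter.1 ha.1).1, ?_⟩
    have := Int.abs_sub_lt_one_of_floor_eq_floor ha.2
    rw [← sub_div, abs_div, abs_of_pos hr, div_lt_one hr] at this
    exact this.le)
  have h2 : ((V.image (fun a : ℝ => ⌊a / r⌋)).card : ℝ) ≤ 10 * (s / r) := by
    have hsub : V.image (fun a : ℝ => ⌊a / r⌋) ⊆ Finset.Icc ⌊(z - 4 * s) / r⌋ ⌊(z + 4 * s) / r⌋ := by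
      intro k hk
      obtain ⟨a, ha, rfl⟩ := Finset.mem_image.1 hk
      have := (Finset.mem_filter.1 ha).2
      rw [abs_le] at this
      rw [Finset.mem_Icc]
      exact ⟨Int.floor_le_floor (by gcongr; linarith), Int.floor_le_floor (by gcongr; linarith)⟩
    refine le_trans (Nat.cast_le.2 (Finset.card_le_card hsub)) ?_
    rw [Int.card_Icc]
    have a1 : (⌊(z + 4 * s) / r⌋ : ℝ) ≤ (z + 4 * s) / r := Int.floor_le _
    have a2 : (z - 4 * s) / r < ⌊(z - 4 * s) / r⌋ + 1 := Int.lt_floor_add_one _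
    have a3 : ⌊(z - 4 * s) / r⌋ ≤ ⌊(z + 4 * s) / r⌋ := Int.floor_le_floor (by gcongr; linarith)
    have a4 : (((⌊(z + 4 * s) / r⌋ + 1 - ⌊(z - 4 * s) / r⌋).toNat : ℤ) : ℝ) =
        ⌊(z + 4 * s) / r⌋ + 1 - ⌊(z - 4 * s) / r⌋ := by
      rw [Int.toNat_of_nonneg (by omega)]
      push_cast
      ring
    rw [Int.cast_natCast] at a4
    rw [a4]
    have a5 : 1 ≤ s / r := by rwa [le_div_iff₀ hr, one_mul]
    have a6 : (z + 4 * s) / r = (z - 4 * s) / r + 8 * (s / r) := by field_simp; ring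
    linarith
  calc (V.card : ℝ) ≤ (⌊M⌋₊ : ℝ) * ((V.image (fun a : ℝ => ⌊a / r⌋)).card : ℝ) := by exact_mod_cast h1
    _ ≤ M * (10 * (s / r)) := by
        gcongr
        exact Nat.floor_le hM
    _ = _ := by ring

open Classical in
lemma base_inv (B : Finset ℝ) (G : Finset ((ℝ × ℝ) × (ℝ × ℝ))) (δ r C1 ε σ' β : ℝ) (hδ : 0 < δ)
    (hδr : δ ≤ r)
    (hC1 : 1 ≤ C1) (hβ1 : β ≤ 1)
    (hB : BallC B δ r C1 ε σ') (hGB : ∀ g ∈ G, g.2 ∈ B ×ˢ B)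
    (hG : ∀ g ∈ G, |g.1.2 - g.2.2| ≤ 4 ∧ g.1.2 - g.2.2 ≠ 0) :
    InvY G (10 * C1 * r ^ (-ε)) β ((B.card : ℝ) ^ 2) r 1 := by
  intro y θ s hs1 hs2
  have hr : 0 < r := by linarith
  have hs : 0 < s := by linarith
  set V := G.filter (fun g => g.1 = y ∧ |qq g.1 g.2 - θ| ≤ s) with hV
  have hb : ∀ x, ((B.filter (fun a => |a - x| ≤ r)).card : ℝ) ≤ C1 * r ^ (1 - ε) * B.card := by
    intro x
    have := hB x r hδr le_rfl
    rwa [div_self hr.ne', Real.one_rpow, mul_one] at this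
  have hM : 0 ≤ C1 * r ^ (1 - ε) * B.card := by positivity
  set n : ℝ := 10 * (s / r) * (C1 * r ^ (1 - ε) * B.card) with hn
  have hn0 : 0 ≤ n := by positivity
  have h1 := Finset.card_le_mul_card_image (f := fun g : (ℝ × ℝ) × (ℝ × ℝ) => g.2.2) V ⌊n⌋₊ (by
    intro d _
    apply Nat.le_floor
    refine le_trans ?_ (cover_count B r _ (y.1 - θ * (y.2 - d)) s hr hs1 hM hb)
    refine Nat.cast_le.2 ?_
    apply Finset.card_le_card_of_injOn (fun g => g.2.1)
    · intro g hg
      rw [Finset.mem_coe, Finset.mem_filter, hV, Finset.mem_filter] at hg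
      obtain ⟨⟨b1, b2, b3⟩, b4⟩ := hg
      rw [Finset.mem_coe, Finset.mem_filter]
      refine ⟨(Finset.mem_product.1 (hGB g b1)).1, ?_⟩
      obtain ⟨c1, c2⟩ := hG g b1
      rw [b2] at b3 c1 c2
      have e : g.2.1 - (y.1 - θ * (y.2 - d)) = -((qq y g.2 - θ) * (y.2 - g.2.2)) := by
        rw [← b4]
        unfold qq
        field_simp
        ring
      rw [e, abs_neg, abs_mul]
      calc _ ≤ s * 4 := by gcongr
        _ = _ := by ring
    · intro g hg g' hg' he
      rw [Finset.mem_coe, Finset.mem_filter, hV, Finset.mem_filter] at hg hg'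
      exact Prod.ext (hg.1.2.1.trans hg'.1.2.1.symm) (Prod.ext he (hg.2.trans hg'.2.symm)))
  have h2 : (V.image (fun g : (ℝ × ℝ) × (ℝ × ℝ) => g.2.2)).card ≤ B.card := by
    apply Finset.card_le_card
    intro d hd
    obtain ⟨g, hg, rfl⟩ := Finset.mem_image.1 hd
    exact (Finset.mem_product.1 (hGB g (Finset.mem_filter.1 hg).1)).2
  calc (V.card : ℝ) ≤ (⌊n⌋₊ : ℝ) * ((V.image (fun g : (ℝ × ℝ) × (ℝ × ℝ) => g.2.2)).card : ℝ) := by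
        exact_mod_cast h1
    _ ≤ n * B.card := by
        gcongr
        exact Nat.floor_le hn0
    _ = 10 * C1 * (r ^ (1 - ε) / r) * s * (B.card : ℝ) ^ 2 := by
        rw [hn]; field_simp
    _ = 10 * C1 * r ^ (-ε) * s * (B.card : ℝ) ^ 2 := by
        rw [Real.rpow_sub hr, Real.rpow_neg hr.le, Real.rpow_one]
        field_simp
    _ ≤ 10 * C1 * r ^ (-ε) * s ^ β * (B.card : ℝ) ^ 2 := by
        gcongr
        calc s = s ^ (1 : ℝ) := (Real.rpow_one s).symm
          _ ≤ s ^ β := Real.rpow_le_rpow_of_exponent_ge hs hs2 hβ1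

lemma small_pow (M η : ℝ) (hM : 0 < M) (hη : 0 < η) :
    ∃ δ1 : ℝ, 0 < δ1 ∧ δ1 ≤ 1 ∧ ∀ δ, 0 < δ → δ < δ1 → M * δ ^ η ≤ 1 := by
  refine ⟨min 1 ((1 / M) ^ (1 / η)), by positivity, min_le_left _ _, ?_⟩
  intro δ hδ h
  have h1 : δ ≤ (1 / M) ^ (1 / η) := (h.le).trans (min_le_right _ _)
  have h2 : δ ^ η ≤ ((1 / M) ^ (1 / η)) ^ η := by gcongr
  rw [← Real.rpow_mul (by positivity), one_div_mul_cancel hη.ne', Real.rpow_one] at h2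
  calc M * δ ^ η ≤ M * (1 / M) := by gcongr
    _ = 1 := by field_simp

lemma choose_Kd (D η : ℝ) (hD : 0 < D) (hη : 0 < η) :
    ∃ δ1 : ℝ, 0 < δ1 ∧ δ1 ≤ 1 ∧ ∀ δ, 0 < δ → δ < δ1 → ∃ Kd : ℕ, 1 ≤ Kd ∧ (1 / 2 : ℝ) ^ Kd ≤ δ ∧
      D * (Kd : ℝ) ^ 2 * δ ^ (4 * η) ≤ 1 := by
  obtain ⟨δ1, h0, h1, h⟩ := small_pow (D * (2 / η + 2) ^ 2) (2 * η) (by positivity) (by positivity)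
  refine ⟨δ1, h0, h1, fun δ hδ hδ1 => ?_⟩
  have hlog : 0 ≤ Real.log (1 / δ) := by
    apply Real.log_nonneg
    rw [le_div_iff₀ hδ]; linarith
  refine ⟨⌈2 * Real.log (1 / δ)⌉₊ + 1, by omega, ?_, ?_⟩
  · set Kd := ⌈2 * Real.log (1 / δ)⌉₊ + 1 with hKd
    have a1 : 2 * Real.log (1 / δ) ≤ Kd := by
      rw [hKd]; push_cast
      have := Nat.le_ceil (2 * Real.log (1 / δ))
      linarith
    have a2 : Real.log (1 / δ) ≤ Kd * Real.log 2 := by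
      have := Real.log_two_gt_d9
      nlinarith
    rw [← Real.log_pow] at a2
    have a3 := (Real.log_le_log_iff (by positivity) (by positivity)).1 a2
    rw [one_div, inv_pow]
    rw [one_div] at a3
    exact inv_le_of_inv_le₀ hδ a3
  · have a1 : ((⌈2 * Real.log (1 / δ)⌉₊ + 1 : ℕ) : ℝ) ≤ (2 / η + 2) * δ ^ (-η) := by
      push_cast
      have b1 := (Nat.ceil_lt_add_one (a := 2 * Real.log (1 / δ)) (by positivity)).le
      have b2 := Real.log_le_rpow_div (x := 1 / δ) (by positivity) hη
      rw [one_div, Real.inv_rpow hδ.le, ← Real.rpow_neg hδ.le, ← one_div] at b2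
      have b3 : 1 ≤ δ ^ (-η) := Real.one_le_rpow_of_pos_of_le_one_of_nonpos hδ (by linarith) (by linarith)
      have b4 : (2 / η + 2) * δ ^ (-η) = 2 * (δ ^ (-η) / η) + 2 * δ ^ (-η) := by ring
      rw [b4]
      linarith
    calc _ ≤ D * ((2 / η + 2) * δ ^ (-η)) ^ 2 * δ ^ (4 * η) := by gcongr
      _ = D * (2 / η + 2) ^ 2 * (δ ^ (-η) * δ ^ (-η) * δ ^ (4 * η)) := by ring
      _ = D * (2 / η + 2) ^ 2 * δ ^ (2 * η) := by
          rw [← Real.rpow_add hδ, ← Real.rpow_add hδ]; ring_nf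
      _ ≤ 1 := h δ hδ hδ1

open Classical in
lemma refine_G (σ' ε β C1 κ0 : ℝ) (I0 Q0 : ℕ) (hC1 : 1 ≤ C1) (hI0 : 1 ≤ I0) (hQ0 : 1 ≤ Q0)
    (hκ0 : 0 < κ0) (hβ : 0 ≤ β) (hβ1 : β ≤ 1) (hβσ : β ≤ 2 * σ') (hε : 0 ≤ ε)
    (hγ : 0 < 1 - 2 * ε - β) :
    ∃ δ1 : ℝ, 0 < δ1 ∧ δ1 ≤ 1 ∧ ∀ δ r, 0 < δ → δ < δ1 → δ ≤ r → r < 1 → r ^ I0 ≤ δ →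
      ∀ (A B : Finset ℝ) (G : Finset ((ℝ × ℝ) × (ℝ × ℝ))) (u v : ℝ), A.Nonempty → B.card = A.card →
      BallC A δ r C1 ε σ' → BallC B δ r C1 ε σ' →
      (∀ a ∈ A, u ≤ a ∧ a ≤ u + 1) → (∀ a ∈ B, v ≤ a ∧ a ≤ v + 1) →
      G ⊆ (A ×ˢ A) ×ˢ (B ×ˢ B) →
      (∀ g ∈ G, |g.1.2 - g.2.2| ≤ 4 ∧ g.1.2 - g.2.2 ≠ 0 ∧ |qq g.1 g.2| ≤ Q0) →
      ∃ G' ⊆ G, ((G \ G').card : ℝ) ≤ κ0 * (A.card : ℝ) ^ 4 ∧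
        InvX G' (10 * C1 * r ^ (-ε)) β ((A.card : ℝ) ^ 2) δ 1 := by
  have hQr : (1 : ℝ) ≤ Q0 := by exact_mod_cast hQ0
  have hIr : (1 : ℝ) ≤ I0 := by exact_mod_cast hI0
  set κ : ℝ := κ0 / (2 * I0) with hκ
  have hκp : 0 < κ := by positivity
  set γ := 1 - 2 * ε - β with hγd
  set η : ℝ := γ / (4 * I0) with hη
  have hηp : 0 < η := by positivity
  obtain ⟨δ1, h0, h1, h⟩ := choose_Kd (3 * (2 * Q0 + 11) * (1 / κ) * (32 * Q0) * (2 * C1 ^ 2)) η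
    (by positivity) hηp
  refine ⟨δ1, h0, h1, ?_⟩
  intro δ r hδ hδ1 hδr hr1 hrI A B G u v hA hBA hAb hBb hu hv hGs hG
  obtain ⟨Kd, k1, k2, k3⟩ := h δ hδ hδ1
  have hr : 0 < r := by linarith
  have hN : (0 : ℝ) < A.card := by exact_mod_cast hA.card_pos
  have hKr : (1 : ℝ) ≤ Kd := by exact_mod_cast k1
  have hrγ : r ^ γ ≤ δ ^ (4 * η) := by
    have : r ^ γ = (r ^ I0) ^ (4 * η) := by
      rw [← Real.rpow_natCast, ← Real.rpow_mul hr.le]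
      congr 1
      rw [hη]; field_simp
    rw [this]
    gcongr
  have hH : 1 ≤ 10 * C1 * r ^ (-ε) := by
    have : 1 ≤ r ^ (-ε) := Real.one_le_rpow_of_pos_of_le_one_of_nonpos hr hr1.le (by linarith)
    nlinarith
  have hcB : (B.card : ℝ) = A.card := by exact_mod_cast hBA
  set W := 2 * C1 ^ 2 * Kd * r ^ (2 - 2 * ε - β) with hW
  have hsmall : 3 * (2 * Q0 + 11) * (Kd / κ) * (32 * Q0) * W ≤ r := by
    have e : r ^ (2 - 2 * ε - β) = r ^ γ * r := by
      rw [← Real.rpow_add_one hr.ne']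
      congr 1
      rw [hγd]; ring
    calc _ = (3 * (2 * Q0 + 11) * (1 / κ) * (32 * Q0) * (2 * C1 ^ 2) * (Kd : ℝ) ^ 2 * r ^ γ) * r := by
          rw [hW, e]; ring
      _ ≤ (3 * (2 * Q0 + 11) * (1 / κ) * (32 * Q0) * (2 * C1 ^ 2) * (Kd : ℝ) ^ 2 * δ ^ (4 * η)) * r := by
          gcongr
      _ ≤ 1 * r := by gcongr
      _ = r := one_mul r
  obtain ⟨G', hG', hc, _, hX⟩ := full_iter (A ×ˢ A) (B ×ˢ B) G δ r β (10 * C1 * r ^ (-ε))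
    ((A.card : ℝ) ^ 2) W κ Q0 Kd hQ0 hδ hδr hr1.le hβ hβ1 hH (by positivity) (by positivity) hGs hG
    (by rw [Finset.card_product]; push_cast; rw [sq])
    (by rw [Finset.card_product]; push_cast; rw [sq, hcB])
    u (fun y hy => hu _ (Finset.mem_product.1 hy).2) v (fun y hy => hv _ (Finset.mem_product.1 hy).2)
    (fun y _ => energy A δ r C1 ε σ' β Kd hδ hδr hr1.le hC1 hβ hβ1 hβσ k1 k2 hAb y)
    (fun y _ => by
      rw [← hcB]
      exact energy B δ r C1 ε σ' β Kd hδ hδr hr1.le hC1 hβ hβ1 hβσ k1 k2 hBb y)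
    (by
      rw [← hcB]
      exact base_inv B G δ r C1 ε σ' β hδ hδr hC1 hβ1 hBb
        (fun g hg => (Finset.mem_product.1 (hGs hg)).2) (fun g hg => ⟨(hG g hg).1, (hG g hg).2.1⟩))
    (by
      rw [← InvX_swap]
      refine base_inv A _ δ r C1 ε σ' β hδ hδr hC1 hβ1 hAb ?_ ?_
      · intro g hg
        obtain ⟨g', hg', rfl⟩ := Finset.mem_image.1 hg
        exact (Finset.mem_product.1 (hGs hg')).1
      · intro g hg
        obtain ⟨g', hg', rfl⟩ := Finset.mem_image.1 hg
        obtain ⟨a1, a2, a3⟩ := hG g' hg'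
        simp only [Prod.fst_swap, Prod.snd_swap]
        rw [abs_sub_comm]
        exact ⟨a1, sub_ne_zero.2 (sub_ne_zero.1 a2).symm⟩)
    k1 k2 hκp hsmall I0
  refine ⟨G', hG', ?_, ?_⟩
  · refine hc.trans (le_of_eq ?_)
    rw [hκ]
    field_simp
  · have : max (r ^ (I0 + 1)) δ = δ := by
      apply max_eq_right
      calc r ^ (I0 + 1) ≤ r ^ I0 := pow_le_pow_of_le_one hr.le hr1.le (by omega)
        _ ≤ δ := hrI
    rwa [this] at hX

lemma abs_sub_le_log (X p q : ℝ) (hp : 0 < p) (hq : 0 < q) (hpX : p ≤ X) (hqX : q ≤ X) :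
    |p - q| ≤ X * |Real.log p - Real.log q| := by
  have h1 : p - q ≤ p * (Real.log p - Real.log q) := by
    have := Real.one_sub_inv_le_log_of_pos (div_pos hp hq)
    rw [Real.log_div hp.ne' hq.ne', inv_div] at this
    have h := mul_le_mul_of_nonneg_left this hp.le
    have e : p * (1 - q / p) = p - q := by field_simp
    linarith
  have h2 : q - p ≤ q * (Real.log q - Real.log p) := by
    have := Real.one_sub_inv_le_log_of_pos (div_pos hq hp)
    rw [Real.log_div hq.ne' hp.ne', inv_div] at this
    have h := mul_le_mul_of_nonneg_left this hq.le
    have e : q * (1 - p / q) = q - p := by field_simp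
    linarith
  have h3 := le_abs_self (Real.log p - Real.log q)
  have h4 := neg_abs_le (Real.log p - Real.log q)
  have h5 := abs_nonneg (Real.log p - Real.log q)
  rw [abs_le]
  constructor <;> nlinarith

lemma key_log (δ a : ℝ) (hδ : 0 < δ) :
    (key δ a : ℝ) * δ ≤ Real.log a ∧ Real.log a ≤ (key δ a : ℝ) * δ + δ := by
  unfold key
  have h1 := Int.floor_le (Real.log a / δ)
  have h2 := (Int.lt_floor_add_one (Real.log a / δ)).le
  rw [le_div_iff₀ hδ] at h1
  rw [div_le_iff₀ hδ] at h2
  constructor <;> linarith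

lemma twin {δ a b a' b' : ℝ} (hδ : 0 < δ) (ha : a ∈ Set.Icc (1 : ℝ) 2) (hb : b ∈ Set.Icc (1 : ℝ) 2)
    (ha' : a' ∈ Set.Icc (1 : ℝ) 2) (hb' : b' ∈ Set.Icc (1 : ℝ) 2)
    (h : key δ a' - key δ b' = key δ a - key δ b) : |b' - a' / a * b| ≤ 8 * δ := by
  obtain ⟨a1, a2⟩ := ha
  obtain ⟨b1, b2⟩ := hb
  obtain ⟨c1, c2⟩ := ha'
  obtain ⟨d1, d2⟩ := hb'
  have hp : 0 < a' / a * b := by positivity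
  have hle : a' / a * b ≤ 4 := by
    have : a' / a ≤ 2 := by rw [div_le_iff₀ (by linarith)]; linarith
    nlinarith
  refine (abs_sub_le_log 4 b' (a' / a * b) (by linarith) hp (by linarith) hle).trans ?_
  rw [Real.log_mul (by positivity) (by positivity), Real.log_div (by positivity) (by positivity)]
  have hr : (key δ a' : ℝ) - key δ b' = key δ a - key δ b := by exact_mod_cast h
  have k1 := key_log δ a hδ
  have k2 := key_log δ b hδ
  have k3 := key_log δ a' hδ
  have k4 := key_log δ b' hδ
  have hr' : (key δ a' : ℝ) * δ - key δ b' * δ = key δ a * δ - key δ b * δ := by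
    linear_combination δ * hr
  have : |Real.log b' - (Real.log a' - Real.log a + Real.log b)| ≤ 2 * δ := by
    rw [abs_le]
    constructor <;> linarith [k1.1, k1.2, k2.1, k2.2, k3.1, k3.2, k4.1, k4.2]
  linarith

lemma ratio_close {δ a c a' c' b d b' d' : ℝ} (hδ : 0 < δ)
    (ha : a ∈ Set.Icc (1 : ℝ) 2) (hc : c ∈ Set.Icc (1 : ℝ) 2)
    (ha' : a' ∈ Set.Icc (1 : ℝ) 2) (hc' : c' ∈ Set.Icc (1 : ℝ) 2)
    (hb : b ∈ Set.Icc (1 : ℝ) 2) (hd : d ∈ Set.Icc (1 : ℝ) 2)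
    (hb' : b' ∈ Set.Icc (1 : ℝ) 2) (hd' : d' ∈ Set.Icc (1 : ℝ) 2)
    (h : (key δ c' + key δ a) - (key δ a' + key δ c) = (key δ d' + key δ b) - (key δ b' + key δ d)) :
    |(c' / c) / (a' / a) - (d' / d) / (b' / b)| ≤ 16 * δ := by
  obtain ⟨a1, a2⟩ := ha
  obtain ⟨b1, b2⟩ := hb
  obtain ⟨c1, c2⟩ := hc
  obtain ⟨d1, d2⟩ := hd
  obtain ⟨a1', a2'⟩ := ha'
  obtain ⟨b1', b2'⟩ := hb'
  obtain ⟨c1', c2'⟩ := hc'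
  obtain ⟨d1', d2'⟩ := hd'
  have hp1 : 0 < (c' / c) / (a' / a) := by positivity
  have hp2 : 0 < (d' / d) / (b' / b) := by positivity
  have hX1 : (c' / c) / (a' / a) ≤ 4 := by
    rw [div_div_div_eq, div_le_iff₀ (by positivity)]
    nlinarith
  have hX2 : (d' / d) / (b' / b) ≤ 4 := by
    rw [div_div_div_eq, div_le_iff₀ (by positivity)]
    nlinarith
  refine (abs_sub_le_log 4 _ _ hp1 hp2 hX1 hX2).trans ?_
  rw [Real.log_div (by positivity) (by positivity), Real.log_div (by positivity) (by positivity),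
    Real.log_div (by positivity) (by positivity), Real.log_div (by positivity) (by positivity),
    Real.log_div (by positivity) (by positivity), Real.log_div (by positivity) (by positivity)]
  have hr : ((key δ c' : ℝ) + key δ a) - (key δ a' + key δ c) =
    (key δ d' + key δ b) - (key δ b' + key δ d) := by exact_mod_cast h
  have hr' : ((key δ c' : ℝ) * δ + key δ a * δ) - (key δ a' * δ + key δ c * δ) =
    (key δ d' * δ + key δ b * δ) - (key δ b' * δ + key δ d * δ) := by linear_combination δ * hr
  obtain ⟨k1, l1⟩ := key_log δ a hδ
  obtain ⟨k2, l2⟩ := key_log δ b hδ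
  obtain ⟨k3, l3⟩ := key_log δ c hδ
  obtain ⟨k4, l4⟩ := key_log δ d hδ
  obtain ⟨k5, l5⟩ := key_log δ a' hδ
  obtain ⟨k6, l6⟩ := key_log δ b' hδ
  obtain ⟨k7, l7⟩ := key_log δ c' hδ
  obtain ⟨k8, l8⟩ := key_log δ d' hδ
  have : |Real.log c' - Real.log c - (Real.log a' - Real.log a) -
      (Real.log d' - Real.log d - (Real.log b' - Real.log b))| ≤ 4 * δ := by
    rw [abs_le]
    constructor <;> linarith
  linarith

lemma q_close {δ d0 X1 X2 Z1 Z2 l1 l2 m1 m2 : ℝ} (hδ : 0 < δ) (hd0 : 0 < d0) (hd1 : d0 ≤ 1)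
    (hX1 : |X1| ≤ 4) (hX2 : |X2| ≤ 4) (hZ1 : d0 ≤ |Z1|) (hZ2 : d0 ≤ |Z2|)
    (hl1 : l1 ∈ Set.Icc (1 / 2 : ℝ) 2) (hl2 : l2 ∈ Set.Icc (1 / 2 : ℝ) 2)
    (hm1 : m1 ∈ Set.Icc (1 / 2 : ℝ) 2) (hm2 : m2 ∈ Set.Icc (1 / 2 : ℝ) 2)
    (hE : |l1 * X1 - l2 * X2| ≤ 17 * δ) (hF : |m1 * Z1 - m2 * Z2| ≤ 17 * δ)
    (hR : |m1 / l1 - m2 / l2| ≤ 16 * δ) : |X1 / Z1 - X2 / Z2| ≤ 3000 / d0 ^ 2 * δ := by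
  obtain ⟨a1, a2⟩ := hl1
  obtain ⟨b1, b2⟩ := hl2
  obtain ⟨c1, c2⟩ := hm1
  obtain ⟨e1, e2⟩ := hm2
  have zp1 : 0 < |Z1| := by linarith
  have zp2 : 0 < |Z2| := by linarith
  have z1 : Z1 ≠ 0 := abs_pos.1 zp1
  have z2 : Z2 ≠ 0 := abs_pos.1 zp2
  have hl1 : 0 < l1 := by linarith
  have hl2 : 0 < l2 := by linarith
  have hm1 : 0 < m1 := by linarith
  have hm2 : 0 < m2 := by linarith
  set E1 := l1 * X1 with hE1
  set E2 := l2 * X2 with hE2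
  set F1 := m1 * Z1 with hF1
  set F2 := m2 * Z2 with hF2
  set R1 := m1 / l1 with hR1
  set R2 := m2 / l2 with hR2
  have i1 : X1 / Z1 = R1 * E1 / F1 := by rw [hR1, hE1, hF1]; field_simp
  have i2 : X2 / Z2 = R2 * E2 / F2 := by rw [hR2, hE2, hF2]; field_simp
  have f1 : F1 ≠ 0 := by rw [hF1]; positivity
  have f2 : F2 ≠ 0 := by rw [hF2]; positivity
  have fb1 : d0 / 2 ≤ |F1| := by rw [hF1, abs_mul, abs_of_pos hm1]; nlinarith
  have fb2 : d0 / 2 ≤ |F2| := by rw [hF2, abs_mul, abs_of_pos hm2]; nlinarith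
  have eb1 : |E1| ≤ 8 := by
    rw [hE1, abs_mul, abs_of_pos hl1]
    have := abs_nonneg X1
    nlinarith
  have eb2 : |E2| ≤ 8 := by
    rw [hE2, abs_mul, abs_of_pos hl2]
    have := abs_nonneg X2
    nlinarith
  have rp : 0 < R2 := by positivity
  have rb : |R2| ≤ 4 := by
    rw [abs_of_pos rp, hR2, div_le_iff₀ hl2]
    linarith
  have key : X1 / Z1 - X2 / Z2 = (R1 - R2) * E1 / F1 + R2 * (E1 - E2) / F1 +
      R2 * E2 * (F2 - F1) / (F1 * F2) := by
    rw [i1, i2]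
    field_simp
    ring
  have t1 : |(R1 - R2) * E1 / F1| ≤ (16 * δ) * 8 / (d0 / 2) := by
    rw [abs_div, abs_mul]
    gcongr
  have t2 : |R2 * (E1 - E2) / F1| ≤ 4 * (17 * δ) / (d0 / 2) := by
    rw [abs_div, abs_mul]
    gcongr
  have t3 : |R2 * E2 * (F2 - F1) / (F1 * F2)| ≤ 4 * 8 * (17 * δ) / ((d0 / 2) * (d0 / 2)) := by
    rw [abs_div, abs_mul (R2 * E2), abs_mul R2 E2, abs_mul F1 F2, abs_sub_comm]
    gcongr
  rw [key]
  refine (abs_add_le _ _).trans ((add_le_add_left (abs_add_le _ _) _).trans ?_)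
  refine (add_le_add (add_le_add t1 t2) t3).trans ?_
  have hh : (16 * δ) * 8 / (d0 / 2) + 4 * (17 * δ) / (d0 / 2) + 4 * 8 * (17 * δ) / ((d0 / 2) * (d0 / 2))
      = (392 * d0 + 2176) / d0 ^ 2 * δ := by field_simp; ring
  rw [hh]
  gcongr
  linarith

lemma four_close {δ d0 Z l1 l2 m1 m2 : ℝ} (hδ : 0 < δ) (hd0 : 0 < d0) (hd1 : d0 ≤ 1)
    (hZ : d0 ≤ |Z|)
    (hl1 : l1 ∈ Set.Icc (1 / 2 : ℝ) 2) (hl2 : l2 ∈ Set.Icc (1 / 2 : ℝ) 2)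
    (hm1 : m1 ∈ Set.Icc (1 / 2 : ℝ) 2) (hm2 : m2 ∈ Set.Icc (1 / 2 : ℝ) 2)
    (hF : |m1 * Z - m2 * Z| ≤ 17 * δ)
    (hR : |m1 / l1 - m2 / l2| ≤ 16 * δ) : |m1 - m2| ≤ 17 / d0 * δ ∧ |l1 - l2| ≤ 580 / d0 * δ := by
  obtain ⟨a1, a2⟩ := hl1
  obtain ⟨b1, b2⟩ := hl2
  obtain ⟨c1, c2⟩ := hm1
  obtain ⟨e1, e2⟩ := hm2
  have h1 : |m1 - m2| ≤ 17 / d0 * δ := by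
    rw [← sub_mul, abs_mul] at hF
    have := abs_nonneg (m1 - m2)
    rw [div_mul_eq_mul_div, le_div_iff₀ hd0]
    nlinarith
  refine ⟨h1, ?_⟩
  have hl1 : 0 < l1 := by linarith
  have hl2 : 0 < l2 := by linarith
  have hm1 : 0 < m1 := by linarith
  -- l1 - l2 = (l1/m1) * ((m1 - m2) - l2 * (m1/l1 - m2/l2))
  have e : l1 - l2 = (l1 / m1) * ((m1 - m2) - l2 * (m1 / l1 - m2 / l2)) := by
    field_simp; ring
  have h2 : |l1 / m1| ≤ 4 := by
    rw [abs_of_pos (by positivity), div_le_iff₀ hm1]; linarith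
  have h3 : |(m1 - m2) - l2 * (m1 / l1 - m2 / l2)| ≤ 17 / d0 * δ + 2 * (16 * δ) := by
    refine (abs_sub _ _).trans ?_
    rw [abs_mul, abs_of_pos hl2]
    gcongr
  have h4 : δ ≤ 1 / d0 * δ := by
    have : 1 ≤ 1 / d0 := by rw [le_div_iff₀ hd0]; linarith
    nlinarith
  rw [e, abs_mul]
  calc _ ≤ 4 * (17 / d0 * δ + 2 * (16 * δ)) := by gcongr
    _ ≤ 4 * (17 / d0 * δ + 2 * (16 * (1 / d0 * δ))) := by gcongr
    _ = 196 / d0 * δ := by ring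
    _ ≤ _ := by gcongr; norm_num

lemma quo_mem {a b : ℝ} (ha : a ∈ Set.Icc (1 : ℝ) 2) (hb : b ∈ Set.Icc (1 : ℝ) 2) :
    a / b ∈ Set.Icc (1 / 2 : ℝ) 2 := by
  obtain ⟨a1, a2⟩ := ha
  obtain ⟨b1, b2⟩ := hb
  constructor
  · rw [le_div_iff₀ (by linarith)]; linarith
  · rw [div_le_iff₀ (by linarith)]; linarith

lemma lam_close {δ τ a b a1 b1 e x : ℝ} (hτ : |τ| = 1) (ha : a ≠ 0)
    (h : |b1 - a1 / a * b| ≤ 8 * δ) (he : e = a1 - τ * b1) (hx1 : x ≤ e) (hx2 : e ≤ x + δ) :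
    |a1 / a * (a - τ * b) - (x + δ / 2)| ≤ 8 * δ + δ / 2 := by
  have e1 : a1 / a * (a - τ * b) - (x + δ / 2) = τ * (b1 - a1 / a * b) + (e - (x + δ / 2)) := by
    rw [he]; field_simp; ring
  rw [e1]
  refine (abs_add_le _ _).trans ?_
  rw [abs_mul, hτ, one_mul]
  have : |e - (x + δ / 2)| ≤ δ / 2 := by rw [abs_le]; constructor <;> linarith
  linarith

open Classical in
lemma cost (δ d0 τ : ℝ) (A : Finset ℝ) (U : Finset (ℝ × ℝ)) (b d : ℝ) (n0 m : ℕ) (t : Finset ℝ)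
    (hδ : 0 < δ) (hd0 : 0 < d0) (hd1 : d0 ≤ 1) (hτ : |τ| = 1) (hA : IsSep δ A)
    (hA12 : ∀ a ∈ A, a ∈ Set.Icc (1 : ℝ) 2) (hb : b ∈ A) (hd : d ∈ A) (hU : U ⊆ A ×ˢ A)
    (hUd : ∀ g ∈ U, d0 ≤ |g.2 - τ * d|)
    (hUs : ∀ g ∈ U, ∀ g' ∈ U,
      |(g.1 - τ * b) / (g.2 - τ * d) - (g'.1 - τ * b) / (g'.2 - τ * d)| ≤ 3000 / d0 ^ 2 * δ → g = g')
    (ht : ∀ a ∈ A, ∀ b ∈ A, ∃ x ∈ t, x ≤ a - τ * b ∧ a - τ * b ≤ x + δ)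
    (hm : 1300 / d0 ≤ m)
    (hrep : ∀ g ∈ U,
      n0 ≤ ((A ×ˢ A).filter (fun p => key δ p.1 - key δ p.2 = key δ g.1 - key δ b)).card ∧
      n0 ≤ ((A ×ˢ A).filter (fun p => key δ p.1 - key δ p.2 = key δ g.2 - key δ d)).card) :
    U.card * n0 ^ 2 ≤ (2 * m + 1) ^ 4 *
      (t.card ^ 2 * (2 • keys δ A - 2 • keys δ A).card) := by
  have ht' : ∀ p : ℝ × ℝ, ∃ x : ℝ, p ∈ A ×ˢ A → x ∈ t ∧ x ≤ p.1 - τ * p.2 ∧ p.1 - τ * p.2 ≤ x + δ := by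
    intro p
    by_cases hp : p ∈ A ×ˢ A
    · obtain ⟨x, h⟩ := ht p.1 (Finset.mem_product.1 hp).1 p.2 (Finset.mem_product.1 hp).2
      exact ⟨x, fun _ => h⟩
    · exact ⟨0, fun h => absurd h hp⟩
  choose cx hcx using ht'
  set Ω : Finset ((_ : ℝ × ℝ) × ((ℝ × ℝ) × (ℝ × ℝ))) := U.sigma (fun g =>
    ((A ×ˢ A).filter (fun p => key δ p.1 - key δ p.2 = key δ g.1 - key δ b)) ×ˢ
    ((A ×ˢ A).filter (fun p => key δ p.1 - key δ p.2 = key δ g.2 - key δ d))) with hΩ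
  have hΩc : U.card * n0 ^ 2 ≤ Ω.card := by
    rw [hΩ, Finset.card_sigma]
    rw [← smul_eq_mul]
    apply Finset.card_nsmul_le_sum
    intro g hg
    rw [Finset.card_product, sq]
    exact Nat.mul_le_mul (hrep g hg).1 (hrep g hg).2
  have hmem : ∀ w ∈ Ω, w.1 ∈ U ∧ (w.2.1.1 ∈ A ∧ w.2.1.2 ∈ A ∧
      key δ w.2.1.1 - key δ w.2.1.2 = key δ w.1.1 - key δ b) ∧ (w.2.2.1 ∈ A ∧ w.2.2.2 ∈ A ∧
      key δ w.2.2.1 - key δ w.2.2.2 = key δ w.1.2 - key δ d) := by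
    intro w hw
    rw [hΩ, Finset.mem_sigma, Finset.mem_product, Finset.mem_filter, Finset.mem_filter,
      Finset.mem_product, Finset.mem_product] at hw
    tauto
  set f : ((_ : ℝ × ℝ) × ((ℝ × ℝ) × (ℝ × ℝ))) → (ℝ × ℝ) × ℤ := fun w =>
    ((cx w.2.1, cx w.2.2), (key δ w.2.2.1 + key δ w.1.1) - (key δ w.2.1.1 + key δ w.1.2)) with hf
  have hmaps : ∀ w ∈ Ω, f w ∈ (t ×ˢ t) ×ˢ (2 • keys δ A - 2 • keys δ A) := by
    intro w hw
    obtain ⟨h1, ⟨h2, h3, _⟩, ⟨h4, h5, _⟩⟩ := hmem w hw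
    have h6 := Finset.mem_product.1 (hU h1)
    have ki : ∀ a ∈ A, key δ a ∈ keys δ A := fun a ha => Finset.mem_image_of_mem _ ha
    rw [Finset.mem_product, Finset.mem_product]
    refine ⟨⟨(hcx _ (Finset.mem_product.2 ⟨h2, h3⟩)).1, (hcx _ (Finset.mem_product.2 ⟨h4, h5⟩)).1⟩, ?_⟩
    rw [two_nsmul]
    exact Finset.sub_mem_sub (Finset.add_mem_add (ki _ h4) (ki _ h6.1))
      (Finset.add_mem_add (ki _ h2) (ki _ h6.2))
  have hcl : ∀ w ∈ Ω, ∀ w' ∈ Ω, f w = f w' → w.1 = w'.1 ∧ |w.2.1.1 - w'.2.1.1| ≤ m * δ ∧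
      |w.2.1.2 - w'.2.1.2| ≤ m * δ ∧ |w.2.2.1 - w'.2.2.1| ≤ m * δ ∧ |w.2.2.2 - w'.2.2.2| ≤ m * δ := by
    rintro ⟨⟨a, c⟩, ⟨a1, b1⟩, ⟨c1, d1⟩⟩ hw ⟨⟨a', c'⟩, ⟨a1', b1'⟩, ⟨c1', d1'⟩⟩ hw' hff
    obtain ⟨hu, ⟨h1, h2, h3⟩, ⟨h4, h5, h6⟩⟩ := hmem _ hw
    obtain ⟨hu', ⟨h1', h2', h3'⟩, ⟨h4', h5', h6'⟩⟩ := hmem _ hw'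
    simp only at hu h1 h2 h3 h4 h5 h6 hu' h1' h2' h3' h4' h5' h6' ⊢
    simp only [hf, Prod.mk.injEq] at hff
    obtain ⟨⟨hf1, hf2⟩, hf3⟩ := hff
    have hac := Finset.mem_product.1 (hU hu)
    have hac' := Finset.mem_product.1 (hU hu')
    simp only at hac hac'
    have Ia := hA12 _ hac.1
    have Ic := hA12 _ hac.2
    have Ia' := hA12 _ hac'.1
    have Ic' := hA12 _ hac'.2
    have Ib := hA12 _ hb
    have Id := hA12 _ hd
    have Ia1 := hA12 _ h1
    have Ib1 := hA12 _ h2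
    have Ic1 := hA12 _ h4
    have Id1 := hA12 _ h5
    have Ia1' := hA12 _ h1'
    have Ib1' := hA12 _ h2'
    have Ic1' := hA12 _ h4'
    have Id1' := hA12 _ h5'
    have T1 := twin hδ Ia Ib Ia1 Ib1 h3
    have T2 := twin hδ Ic Id Ic1 Id1 h6
    have T1' := twin hδ Ia' Ib Ia1' Ib1' h3'
    have T2' := twin hδ Ic' Id Ic1' Id1' h6'
    have RR := ratio_close hδ Ia Ic Ia1 Ic1 Ia' Ic' Ia1' Ic1' hf3
    have na : a ≠ 0 := by linarith [Ia.1]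
    have nc : c ≠ 0 := by linarith [Ic.1]
    have na' : a' ≠ 0 := by linarith [Ia'.1]
    have nc' : c' ≠ 0 := by linarith [Ic'.1]
    have X1 := hcx (a1, b1) (Finset.mem_product.2 ⟨h1, h2⟩)
    have X2 := hcx (c1, d1) (Finset.mem_product.2 ⟨h4, h5⟩)
    have X1' := hcx (a1', b1') (Finset.mem_product.2 ⟨h1', h2'⟩)
    have X2' := hcx (c1', d1') (Finset.mem_product.2 ⟨h4', h5'⟩)
    rw [← hf1] at X1'
    rw [← hf2] at X2'
    have L1 := lam_close hτ na T1 rfl X1.2.1 X1.2.2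
    have L1' := lam_close hτ na' T1' rfl X1'.2.1 X1'.2.2
    have L2 := lam_close hτ nc T2 rfl X2.2.1 X2.2.2
    have L2' := lam_close hτ nc' T2' rfl X2'.2.1 X2'.2.2
    have E : |a1 / a * (a - τ * b) - a1' / a' * (a' - τ * b)| ≤ 17 * δ := by
      rw [abs_le] at L1 L1' ⊢
      constructor <;> linarith
    have F : |c1 / c * (c - τ * d) - c1' / c' * (c' - τ * d)| ≤ 17 * δ := by
      rw [abs_le] at L2 L2' ⊢
      constructor <;> linarith
    have B4 : ∀ x y : ℝ, x ∈ Set.Icc (1 : ℝ) 2 → y ∈ Set.Icc (1 : ℝ) 2 → |x - τ * y| ≤ 4 := by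
      intro x y hx hy
      refine (abs_sub _ _).trans ?_
      rw [abs_mul, hτ, one_mul, abs_of_pos (by linarith [hx.1]), abs_of_pos (by linarith [hy.1])]
      linarith [hx.2, hy.2]
    have hD := hUd _ hu
    have hD' := hUd _ hu'
    simp only at hD hD'
    have QC := q_close hδ hd0 hd1 (B4 _ _ Ia Ib) (B4 _ _ Ia' Ib) hD hD'
      (quo_mem Ia1 Ia) (quo_mem Ia1' Ia') (quo_mem Ic1 Ic) (quo_mem Ic1' Ic') E F RR
    have heq := hUs _ hu _ hu' QC
    rw [Prod.mk.injEq] at heq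
    obtain ⟨rfl, rfl⟩ := heq
    obtain ⟨M1, M2⟩ := four_close hδ hd0 hd1 hD (quo_mem Ia1 Ia) (quo_mem Ia1' Ia') (quo_mem Ic1 Ic)
      (quo_mem Ic1' Ic') F RR
    have hdδ : δ ≤ 1 / d0 * δ := by
      have : 1 ≤ 1 / d0 := by rw [le_div_iff₀ hd0]; linarith
      nlinarith
    have hmδ : 1300 * (1 / d0 * δ) ≤ m * δ := by
      have := mul_le_mul_of_nonneg_right hm hδ.le
      calc _ = 1300 / d0 * δ := by ring
        _ ≤ _ := this
    have hpos : 0 < 1 / d0 * δ := by positivity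
    have hM1 : |c1 / c - c1' / c| ≤ 580 * (1 / d0 * δ) := by
      refine M1.trans ?_
      calc 17 / d0 * δ = 17 * (1 / d0 * δ) := by ring
        _ ≤ _ := by linarith
    have hM2 : |a1 / a - a1' / a| ≤ 580 * (1 / d0 * δ) := by
      refine M2.trans (le_of_eq ?_)
      ring
    have gen : ∀ x y y' z : ℝ, z ∈ Set.Icc (1 : ℝ) 2 → |x - x| ≤ 1 → |y - y'| ≤ 580 * (1 / d0 * δ) →
        |y * z - y' * z| ≤ 1160 * (1 / d0 * δ) := by
      intro x y y' z hz _ hy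
      have hz0 : 0 < z := by linarith [hz.1]
      rw [← sub_mul, abs_mul, abs_of_pos hz0]
      have := abs_nonneg (y - y')
      nlinarith [hz.1, hz.2]
    have g1 := gen 0 _ _ a Ia (by simp) hM2
    have g2 := gen 0 _ _ b Ib (by simp) hM2
    have g3 := gen 0 _ _ c Ic (by simp) hM1
    have g4 := gen 0 _ _ d Id (by simp) hM1
    rw [div_mul_cancel₀ _ na, div_mul_cancel₀ _ na] at g1
    rw [div_mul_cancel₀ _ nc, div_mul_cancel₀ _ nc] at g3
    refine ⟨rfl, by linarith, ?_, by linarith, ?_⟩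
    · rw [abs_le] at T1 T1' g2 ⊢
      constructor <;> linarith
    · rw [abs_le] at T2 T2' g4 ⊢
      constructor <;> linarith
  have hfib := Finset.card_le_mul_card_image_of_maps_to hmaps ((2 * m + 1) ^ 4) (by
    intro z _
    rcases (Ω.filter (fun w => f w = z)).eq_empty_or_nonempty with he | ⟨w0, hw0⟩
    · rw [he]; simp
    rw [Finset.mem_filter] at hw0
    set Bl : ℝ → Finset ℝ := fun x => A.filter (fun a => |a - x| ≤ m * δ) with hBl
    have hB : ∀ x, (Bl x).card ≤ 2 * m + 1 := fun x =>
      sep_count hδ hA (Bl x) (Finset.filter_subset _ _) x m (fun a ha => (Finset.mem_filter.1 ha).2)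
    have h1 : (Ω.filter (fun w => f w = z)).card ≤
        ((Bl w0.2.1.1 ×ˢ Bl w0.2.1.2) ×ˢ (Bl w0.2.2.1 ×ˢ Bl w0.2.2.2)).card := by
      apply Finset.card_le_card_of_injOn (fun w => w.2)
      · intro w hw
        rw [Finset.mem_coe, Finset.mem_filter] at hw
        obtain ⟨_, k1, k2, k3, k4⟩ := hcl w hw.1 w0 hw0.1 (hw.2.trans hw0.2.symm)
        obtain ⟨_, ⟨h1, h2, _⟩, ⟨h4, h5, _⟩⟩ := hmem _ hw.1
        rw [Finset.mem_coe, Finset.mem_product, Finset.mem_product, Finset.mem_product]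
        simp only [hBl, Finset.mem_filter]
        exact ⟨⟨⟨h1, k1⟩, ⟨h2, k2⟩⟩, ⟨⟨h4, k3⟩, ⟨h5, k4⟩⟩⟩
      · intro w hw w' hw' he
        rw [Finset.mem_coe, Finset.mem_filter] at hw hw'
        obtain ⟨k0, _⟩ := hcl w hw.1 w' hw'.1 (hw.2.trans hw'.2.symm)
        obtain ⟨w1, w2⟩ := w
        obtain ⟨w1', w2'⟩ := w'
        simp only at k0 he
        rw [k0, he]
    refine h1.trans ?_
    rw [Finset.card_product, Finset.card_product, Finset.card_product]
    calc _ ≤ ((2 * m + 1) * (2 * m + 1)) * ((2 * m + 1) * (2 * m + 1)) :=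
          Nat.mul_le_mul (Nat.mul_le_mul (hB _) (hB _)) (Nat.mul_le_mul (hB _) (hB _))
      _ = _ := by ring)
  refine hΩc.trans (hfib.trans (le_of_eq ?_))
  rw [Finset.card_product, Finset.card_product]
  ring

open Classical in
lemma greedy_sep {α : Type*} (f : α → ℝ) (s : ℝ) (hs : 0 ≤ s) (m : ℕ) (n : ℕ) :
    ∀ V : Finset α, V.card = n → (∀ θ, (V.filter (fun v => |f v - θ| ≤ s)).card ≤ m) →
    ∃ U ⊆ V, V.card ≤ m * U.card ∧ ∀ g ∈ U, ∀ g' ∈ U, |f g - f g'| ≤ s → g = g' := by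
  induction n using Nat.strong_induction_on with
  | _ n ih =>
    intro V hV h
    rcases V.eq_empty_or_nonempty with he | ⟨v, hv⟩
    · exact ⟨∅, by simp, by simp [he], by simp⟩
    set V' := V.filter (fun w => ¬ |f w - f v| ≤ s) with hV'
    have hvV : v ∉ V' := by
      rw [hV', Finset.mem_filter]
      rintro ⟨_, h2⟩
      apply h2
      simpa using hs
    have hsub : V' ⊆ V := Finset.filter_subset _ _
    have hlt : V'.card < n := by
      rw [← hV]
      exact Finset.card_lt_card ⟨hsub, fun hh => hvV (hh hv)⟩
    obtain ⟨U, hU, hc, hsep⟩ := ih _ hlt V' rfl (fun θ =>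
      (Finset.card_le_card (Finset.filter_subset_filter _ hsub)).trans (h θ))
    have hvU : v ∉ U := fun hh => hvV (hU hh)
    refine ⟨insert v U, Finset.insert_subset hv (hU.trans hsub), ?_, ?_⟩
    · rw [Finset.card_insert_of_notMem hvU]
      have h1 := Finset.card_filter_add_card_filter_not (s := V) (fun w => |f w - f v| ≤ s)
      have h2 := h (f v)
      rw [← hV'] at h1
      rw [Nat.mul_add, mul_one]
      omega
    · intro g hg g' hg' hgg
      rw [Finset.mem_insert] at hg hg'
      rcases hg with rfl | hg <;> rcases hg' with rfl | hg'
      · rfl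
      · exfalso
        have := (Finset.mem_filter.1 (hU hg')).2
        rw [abs_sub_comm] at hgg
        exact this hgg
      · exfalso
        exact (Finset.mem_filter.1 (hU hg)).2 hgg
      · exact hsep g hg g' hg' hgg

open Classical in
lemma unpopular (δ : ℝ) (A : Finset ℝ) (n0 : ℕ) :
    ((A ×ˢ A).filter (fun p => ((A ×ˢ A).filter
      (fun p' => key δ p'.1 - key δ p'.2 = key δ p.1 - key δ p.2)).card < n0)).card ≤
      n0 * (keys δ A - keys δ A).card := by
  apply Finset.card_le_mul_card_image_of_maps_to (f := fun p : ℝ × ℝ => key δ p.1 - key δ p.2)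
  · intro p hp
    have := Finset.mem_product.1 (Finset.mem_filter.1 hp).1
    exact Finset.sub_mem_sub (Finset.mem_image_of_mem _ this.1) (Finset.mem_image_of_mem _ this.2)
  · intro z _
    rcases (Finset.filter (fun p : ℝ × ℝ => key δ p.1 - key δ p.2 = z)
      ((A ×ˢ A).filter (fun p => ((A ×ˢ A).filter
      (fun p' => key δ p'.1 - key δ p'.2 = key δ p.1 - key δ p.2)).card < n0))).eq_empty_or_nonempty
      with he | ⟨p, hp⟩
    · rw [he]; simp
    · rw [Finset.mem_filter, Finset.mem_filter] at hp
      obtain ⟨⟨h1, h2⟩, h3⟩ := hp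
      refine le_trans (Finset.card_le_card ?_) h2.le
      intro p' hp'
      rw [Finset.mem_filter, Finset.mem_filter] at hp'
      rw [Finset.mem_filter]
      exact ⟨hp'.1.1, hp'.2.trans h3.symm⟩

open Classical in
lemma closepairs (τ d0 X : ℝ) (A : Finset ℝ) (hX : 0 ≤ X)
    (h : ∀ x, ((A.filter (fun a => |a - x| ≤ d0)).card : ℝ) ≤ X) :
    (((A ×ˢ A).filter (fun p => |p.1 - τ * p.2| < d0)).card : ℝ) ≤ X * A.card := by
  have h1 : ((A ×ˢ A).filter (fun p => |p.1 - τ * p.2| < d0)).card ≤ ⌊X⌋₊ * A.card := by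
    apply Finset.card_le_mul_card_image_of_maps_to (f := fun p : ℝ × ℝ => p.2)
    · intro p hp
      exact (Finset.mem_product.1 (Finset.mem_filter.1 hp).1).2
    · intro z _
      apply Nat.le_floor
      refine le_trans (Nat.cast_le.2 ?_) (h (τ * z))
      apply Finset.card_le_card_of_injOn (fun p => p.1)
      · intro p hp
        rw [Finset.mem_coe, Finset.mem_filter, Finset.mem_filter] at hp
        rw [Finset.mem_coe, Finset.mem_filter]
        obtain ⟨⟨h1, h2⟩, h3⟩ := hp
        rw [h3] at h2
        exact ⟨(Finset.mem_product.1 h1).1, h2.le⟩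
      · intro p hp p' hp' he
        rw [Finset.mem_coe, Finset.mem_filter] at hp hp'
        exact Prod.ext he (hp.2.trans hp'.2.symm)
  calc _ ≤ (⌊X⌋₊ : ℝ) * A.card := by exact_mod_cast h1
    _ ≤ _ := by
      gcongr
      exact Nat.floor_le hX

open Classical in
lemma ballC_image {A : Finset ℝ} {δ r C1 ε σ' τ : ℝ} (hτ : |τ| = 1) (h : BallC A δ r C1 ε σ') :
    (A.image (fun a => τ * a)).card = A.card ∧ BallC (A.image (fun a => τ * a)) δ r C1 ε σ' := by
  have hτ0 : τ ≠ 0 := by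
    intro h0; rw [h0] at hτ; simp at hτ
  have hinj : Function.Injective (fun a : ℝ => τ * a) := mul_right_injective₀ hτ0
  have hc : (A.image (fun a => τ * a)).card = A.card := Finset.card_image_of_injective _ hinj
  refine ⟨hc, ?_⟩
  intro x t h1 h2
  rw [hc]
  refine le_trans (Nat.cast_le.2 ?_) (h (x / τ) t h1 h2)
  rw [Finset.filter_image, Finset.card_image_of_injective _ hinj]
  apply Finset.card_le_card
  intro a ha
  rw [Finset.mem_filter] at ha ⊢
  refine ⟨ha.1, ?_⟩
  have e : τ * a - x = τ * (a - x / τ) := by field_simp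
  have := ha.2
  rwa [e, abs_mul, hτ, one_mul] at this

open Classical in
lemma goodset (δ τ d0 : ℝ) (A : Finset ℝ) (n0 : ℕ) (N : ℝ) (hN : N = A.card)
    (h1 : (n0 : ℝ) * (keys δ A - keys δ A).card ≤ N ^ 2 / 8)
    (h2 : ∀ x, ((A.filter (fun a => |a - x| ≤ d0)).card : ℝ) ≤ N / 8) :
    ∃ P ⊆ A ×ˢ A, 3 / 4 * N ^ 2 ≤ P.card ∧ ∀ p ∈ P, d0 ≤ |p.1 - τ * p.2| ∧
      n0 ≤ ((A ×ˢ A).filter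
      (fun p' => key δ p'.1 - key δ p'.2 = key δ p.1 - key δ p.2)).card := by
  set B1 := (A ×ˢ A).filter (fun p => ((A ×ˢ A).filter
      (fun p' => key δ p'.1 - key δ p'.2 = key δ p.1 - key δ p.2)).card < n0) with hB1
  set B2 := (A ×ˢ A).filter (fun p => |p.1 - τ * p.2| < d0) with hB2
  have hN0 : 0 ≤ N := by rw [hN]; positivity
  have c1 : (B1.card : ℝ) ≤ N ^ 2 / 8 := by
    refine le_trans ?_ h1
    exact_mod_cast unpopular δ A n0
  have c2 : (B2.card : ℝ) ≤ N ^ 2 / 8 := by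
    have := closepairs τ d0 (N / 8) A (by positivity) h2
    rw [← hN] at this
    linarith
  refine ⟨(A ×ˢ A) \ (B1 ∪ B2), Finset.sdiff_subset, ?_, ?_⟩
  · have h3 : (A ×ˢ A).card ≤ ((A ×ˢ A) \ (B1 ∪ B2)).card + (B1.card + B2.card) := by
      have := Finset.le_card_sdiff (B1 ∪ B2) (A ×ˢ A)
      have := Finset.card_union_le B1 B2
      omega
    rw [Finset.card_product] at h3
    have h4 : (A.card : ℝ) * A.card ≤ ((A ×ˢ A) \ (B1 ∪ B2)).card + (B1.card + B2.card) := by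
      exact_mod_cast h3
    rw [← hN] at h4
    nlinarith
  · intro p hp
    rw [Finset.mem_sdiff, Finset.mem_union, not_or, hB1, hB2, Finset.mem_filter, Finset.mem_filter] at hp
    obtain ⟨hp1, hp2, hp3⟩ := hp
    constructor
    · by_contra hcon
      exact hp3 ⟨hp1, not_le.1 hcon⟩
    · by_contra hcon
      exact hp2 ⟨hp1, not_le.1 hcon⟩

open Classical in
lemma buildG (A : Finset ℝ) (P : Finset (ℝ × ℝ)) (τ d0 : ℝ) (Q0 : ℕ) (hτ : |τ| = 1)
    (hA12 : ∀ a ∈ A, a ∈ Set.Icc (1 : ℝ) 2) (hP : P ⊆ A ×ˢ A) (hd0 : 0 < d0)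
    (hPd : ∀ p ∈ P, d0 ≤ |p.1 - τ * p.2|) (hQ : 4 / d0 ≤ Q0) :
    ∃ G ⊆ (A ×ˢ A) ×ˢ ((A.image (fun a => τ * a)) ×ˢ (A.image (fun a => τ * a))),
      G.card = P.card ^ 2 ∧
      (∀ g ∈ G, |g.1.2 - g.2.2| ≤ 4 ∧ g.1.2 - g.2.2 ≠ 0 ∧ |qq g.1 g.2| ≤ Q0) ∧
      ∀ g ∈ G, ∃ b d, g.2 = (τ * b, τ * d) ∧ (g.1.1, b) ∈ P ∧ (g.1.2, d) ∈ P := by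
  have hτ0 : τ ≠ 0 := by
    intro h0; rw [h0] at hτ; simp at hτ
  have h4 : ∀ p ∈ P, |p.1 - τ * p.2| ≤ 4 := by
    intro p hp
    have hp' := Finset.mem_product.1 (hP hp)
    have h1 := hA12 _ hp'.1
    have h2 := hA12 _ hp'.2
    calc |p.1 - τ * p.2| ≤ |p.1| + |τ * p.2| := abs_sub _ _
      _ = |p.1| + |p.2| := by rw [abs_mul, hτ, one_mul]
      _ ≤ 4 := by
        rw [abs_of_nonneg (by linarith [h1.1]), abs_of_nonneg (by linarith [h2.1])]
        linarith [h1.2, h2.2]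
  refine ⟨(P ×ˢ P).image (fun p => ((p.1.1, p.2.1), (τ * p.1.2, τ * p.2.2))), ?_, ?_, ?_, ?_⟩
  · intro g hg
    obtain ⟨p, hp, rfl⟩ := Finset.mem_image.1 hg
    have hp' := Finset.mem_product.1 hp
    have h1 := Finset.mem_product.1 (hP hp'.1)
    have h2 := Finset.mem_product.1 (hP hp'.2)
    simp only [Finset.mem_product]
    exact ⟨⟨h1.1, h2.1⟩, Finset.mem_image_of_mem _ h1.2, Finset.mem_image_of_mem _ h2.2⟩
  · rw [Finset.card_image_of_injective, Finset.card_product, sq]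
    rintro ⟨⟨a, b⟩, ⟨c, d⟩⟩ ⟨⟨a', b'⟩, ⟨c', d'⟩⟩ h
    simp only [Prod.mk.injEq, mul_eq_mul_left_iff, hτ0, or_false] at h ⊢
    tauto
  · intro g hg
    obtain ⟨p, hp, rfl⟩ := Finset.mem_image.1 hg
    have hp' := Finset.mem_product.1 hp
    have hb := hPd _ hp'.2
    refine ⟨h4 _ hp'.2, ?_, ?_⟩
    · intro h0
      simp only at h0
      rw [h0, abs_zero] at hb
      linarith
    · simp only [qq]
      rw [abs_div]
      refine le_trans ?_ hQ
      exact div_le_div₀ (by norm_num) (h4 _ hp'.1) hd0 hb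
  · intro g hg
    obtain ⟨p, hp, rfl⟩ := Finset.mem_image.1 hg
    have hp' := Finset.mem_product.1 hp
    exact ⟨p.1.2, p.2.2, rfl, hp'.1, hp'.2⟩

open Classical in
lemma pigeonG (G : Finset ((ℝ × ℝ) × (ℝ × ℝ))) (X : Finset (ℝ × ℝ)) (N : ℝ) (hN : 0 < N)
    (hG : ∀ g ∈ G, g.2 ∈ X) (hX : (X.card : ℝ) = N ^ 2) (hc : N ^ 4 / 4 ≤ G.card) :
    ∃ x ∈ X, N ^ 2 / 4 ≤ ((G.filter (fun g => g.2 = x)).card : ℝ) := by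
  by_contra hcon
  push Not at hcon
  have h1 := Finset.card_eq_sum_card_fiberwise (f := Prod.snd) (s := G) (t := X) hG
  have hXne : X.Nonempty := by
    rw [← Finset.card_pos]
    have : (0 : ℝ) < X.card := by rw [hX]; positivity
    exact_mod_cast this
  have h2 : (G.card : ℝ) < ∑ x ∈ X, N ^ 2 / 4 := by
    rw [h1]
    push_cast
    exact Finset.sum_lt_sum_of_nonempty hXne hcon
  rw [Finset.sum_const, nsmul_eq_mul, hX] at h2
  nlinarith

lemma combine_arith (N H sb Mu n0 : ℝ) (Λ : ℕ) (m1 T S2 Vc : ℝ) (hNp : 0 < N) (hH : 0 ≤ H) (hsb : 0 ≤ sb)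
    (hMu0 : 0 ≤ Mu) (hm1 : 0 ≤ m1) (hΛ : 1 ≤ Λ) (hn0 : N ≤ 16 * Λ ^ 2 * n0) (hS : S2 ≤ Λ ^ 4 * N)
    (hcost : Mu * n0 ^ 2 ≤ m1 ^ 4 * (T ^ 2 * S2)) (hVU : Vc ≤ H * sb * N ^ 2 * Mu)
    (hxc : N ^ 2 / 4 ≤ Vc) :
    N ≤ 4 * H * sb * (256 * Λ ^ 8 * m1 ^ 4) * T ^ 2 := by
  have k1 : Mu * N ≤ 256 * Λ ^ 8 * m1 ^ 4 * T ^ 2 := by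
    have e1 : Mu * N ^ 2 ≤ Mu * (16 * Λ ^ 2 * n0) ^ 2 := by gcongr
    have e2 : Mu * n0 ^ 2 ≤ m1 ^ 4 * (T ^ 2 * (Λ ^ 4 * N)) := by
      refine hcost.trans ?_
      gcongr
    have e3 : Mu * N * N ≤ 256 * Λ ^ 8 * m1 ^ 4 * T ^ 2 * N := by
      calc Mu * N * N = Mu * N ^ 2 := by ring
        _ ≤ Mu * (16 * Λ ^ 2 * n0) ^ 2 := e1
        _ = 256 * Λ ^ 4 * (Mu * n0 ^ 2) := by ring
        _ ≤ 256 * Λ ^ 4 * (m1 ^ 4 * (T ^ 2 * (Λ ^ 4 * N))) := by gcongr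
        _ = _ := by ring
    exact le_of_mul_le_mul_right e3 hNp
  have k2 : 1 ≤ 4 * H * sb * Mu := by
    have : N ^ 2 / 4 ≤ H * sb * N ^ 2 * Mu := hxc.trans hVU
    have hN2 : 0 < N ^ 2 := by positivity
    by_contra hc
    push Not at hc
    nlinarith
  have hq : 0 ≤ 4 * H * sb := by positivity
  calc N = 1 * N := by ring
    _ ≤ 4 * H * sb * Mu * N := by gcongr
    _ = 4 * H * sb * (Mu * N) := by ring
    _ ≤ 4 * H * sb * (256 * Λ ^ 8 * m1 ^ 4 * T ^ 2) := by gcongr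
    _ = _ := by ring

open Classical in
lemma combine (A : Finset ℝ) (P : Finset (ℝ × ℝ)) (G : Finset ((ℝ × ℝ) × (ℝ × ℝ)))
    (δ τ d0 H β s : ℝ) (n0 m Λ : ℕ) (t : Finset ℝ) (N : ℝ) (hN : N = A.card) (hNp : 0 < N)
    (hΛ : 1 ≤ Λ) (hδ : 0 < δ) (hd0 : 0 < d0) (hd1 : d0 ≤ 1) (hτ : |τ| = 1) (hA : IsSep δ A)
    (hA12 : ∀ a ∈ A, a ∈ Set.Icc (1 : ℝ) 2) (hP : P ⊆ A ×ˢ A)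
    (hPd : ∀ p ∈ P, d0 ≤ |p.1 - τ * p.2| ∧ n0 ≤ ((A ×ˢ A).filter
      (fun p' => key δ p'.1 - key δ p'.2 = key δ p.1 - key δ p.2)).card)
    (hG : ∀ g ∈ G, g.2 ∈ ((A.image (fun a => τ * a)) ×ˢ (A.image (fun a => τ * a))))
    (hGP : ∀ g ∈ G, ∃ b d, g.2 = (τ * b, τ * d) ∧ (g.1.1, b) ∈ P ∧ (g.1.2, d) ∈ P)
    (hGc : N ^ 4 / 4 ≤ G.card) (hH : 0 ≤ H) (hI : InvX G H β (N ^ 2) δ 1)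
    (hs : s = 3000 / d0 ^ 2 * δ) (hs1 : s ≤ 1)
    (ht : ∀ a ∈ A, ∀ b ∈ A, ∃ x ∈ t, x ≤ a - τ * b ∧ a - τ * b ≤ x + δ)
    (hm : 1300 / d0 ≤ m) (hn0 : N ≤ 16 * Λ ^ 2 * n0)
    (hS : ((2 • keys δ A - 2 • keys δ A).card : ℝ) ≤ Λ ^ 4 * N) :
    N ≤ 4 * H * s ^ β * (256 * Λ ^ 8 * (2 * m + 1) ^ 4) * (t.card : ℝ) ^ 2 := by
  have hτ0 : τ ≠ 0 := by
    intro h0; rw [h0] at hτ; simp at hτ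
  have hinj : Function.Injective (fun a : ℝ => τ * a) := mul_right_injective₀ hτ0
  have hδs : δ ≤ s := by
    rw [hs]
    have : 1 ≤ 3000 / d0 ^ 2 := by
      rw [le_div_iff₀ (by positivity)]
      nlinarith
    nlinarith
  have hsp : 0 < s := by linarith
  obtain ⟨x, hx, hxc⟩ := pigeonG G _ N hNp hG (by
    rw [Finset.card_product, Finset.card_image_of_injective _ hinj, hN]; push_cast; ring) hGc
  set V := G.filter (fun g => g.2 = x) with hV
  rw [Finset.mem_product] at hx
  obtain ⟨b, hb, hb'⟩ := Finset.mem_image.1 hx.1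
  obtain ⟨d, hd, hd'⟩ := Finset.mem_image.1 hx.2
  have hxe : x = (τ * b, τ * d) := by
    rw [hb', hd']
  set M0 : ℝ := H * s ^ β * N ^ 2 with hM0
  have hM0n : 0 ≤ M0 := by positivity
  obtain ⟨U0, hU0V, hU0c, hU0s⟩ := greedy_sep (fun g : (ℝ × ℝ) × (ℝ × ℝ) => qq g.1 g.2) s hsp.le
    ⌊M0⌋₊ V.card V rfl (by
      intro θ
      apply Nat.le_floor
      refine le_trans (Nat.cast_le.2 (Finset.card_le_card ?_)) (hI x θ s hδs hs1)
      intro g hg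
      rw [hV, Finset.mem_filter, Finset.mem_filter] at hg
      rw [Finset.mem_filter]
      exact ⟨hg.1.1, hg.1.2, hg.2⟩)
  have hUV : ∀ g ∈ U0, g.2 = (τ * b, τ * d) ∧ (g.1.1, b) ∈ P ∧ (g.1.2, d) ∈ P := by
    intro g hg
    have hg' := Finset.mem_filter.1 (hU0V hg)
    obtain ⟨b1, d1, h1, h2, h3⟩ := hGP g hg'.1
    have h4 : g.2 = (τ * b, τ * d) := hg'.2.trans hxe
    rw [h4, Prod.mk.injEq] at h1
    have e1 := mul_left_cancel₀ hτ0 h1.1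
    have e2 := mul_left_cancel₀ hτ0 h1.2
    rw [← e1] at h2
    rw [← e2] at h3
    exact ⟨h4, h2, h3⟩
  have hUcard : (U0.image Prod.fst).card = U0.card := by
    apply Finset.card_image_of_injOn
    intro g hg g' hg' he
    exact Prod.ext he ((hUV g hg).1.trans (hUV g' hg').1.symm)
  have hcost := cost δ d0 τ A (U0.image Prod.fst) b d n0 m t hδ hd0 hd1 hτ hA hA12 hb hd
    (by
      intro y hy
      obtain ⟨g, hg, rfl⟩ := Finset.mem_image.1 hy
      have := hUV g hg
      exact Finset.mem_product.2 ⟨(Finset.mem_product.1 (hP this.2.1)).1,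
        (Finset.mem_product.1 (hP this.2.2)).1⟩)
    (by
      intro y hy
      obtain ⟨g, hg, rfl⟩ := Finset.mem_image.1 hy
      exact (hPd _ (hUV g hg).2.2).1)
    (by
      intro y hy y' hy' hyy
      obtain ⟨g, hg, rfl⟩ := Finset.mem_image.1 hy
      obtain ⟨g', hg', rfl⟩ := Finset.mem_image.1 hy'
      have := hU0s g hg g' hg' (by
        simp only [qq]
        rw [(hUV g hg).1, (hUV g' hg').1, hs]
        exact hyy)
      rw [this])
    ht hm
    (by
      intro y hy
      obtain ⟨g, hg, rfl⟩ := Finset.mem_image.1 hy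
      exact ⟨(hPd _ (hUV g hg).2.1).2, (hPd _ (hUV g hg).2.2).2⟩)
  rw [hUcard] at hcost
  have hcost' : (U0.card : ℝ) * (n0 : ℝ) ^ 2 ≤ (2 * m + 1) ^ 4 * ((t.card : ℝ) ^ 2 *
      (2 • keys δ A - 2 • keys δ A).card) := by exact_mod_cast hcost
  have hVU : (V.card : ℝ) ≤ M0 * U0.card := by
    calc (V.card : ℝ) ≤ (⌊M0⌋₊ : ℝ) * U0.card := by exact_mod_cast hU0c
      _ ≤ _ := mul_le_mul_of_nonneg_right (Nat.floor_le hM0n) (Nat.cast_nonneg _)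
  exact combine_arith N H (s ^ β) U0.card n0 Λ (2 * m + 1) t.card _ V.card hNp hH
    (Real.rpow_nonneg hsp.le _) (Nat.cast_nonneg _) (by linarith [Nat.cast_nonneg (α := ℝ) m]) hΛ hn0 hS hcost' hVU hxc

set_option maxHeartbeats 800000 in
open Classical in
lemma main_est (σ σ' ε β K : ℝ) (Λ : ℕ) (hσ' : 0 < σ') (hσσ : σ' < σ) (hσ1 : σ ≤ 1)
    (hε0 : 0 < ε) (hε1 : ε < 1) (hK : 1 ≤ K) (hΛ : 1 ≤ Λ) (hβ : 0 ≤ β) (hβ1 : β ≤ 1)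
    (hβσ : β ≤ 2 * σ') (hγ : 0 < 1 - 2 * ε - β) :
    ∃ C δ2 : ℝ, 0 < C ∧ 0 < δ2 ∧ ∀ δ : ℝ, 0 < δ → δ < δ2 → ∀ A : Finset ℝ, IsSep δ A → A.Nonempty →
      (∀ a ∈ A, a ∈ Set.Icc (1:ℝ) 2) →
      (∀ (x r : ℝ), δ ≤ r →
        ((A.filter (fun a => |a - x| ≤ r)).card : ℝ) ≤ K * r ^ σ * (A.card : ℝ)) →
      δ ^ (-σ) ≤ K * (A.card : ℝ) →
      (keys δ A + keys δ A).card ≤ Λ * (keys δ A).card →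
      ∀ (τ : ℝ) (t : Finset ℝ), (τ = 1 ∨ τ = -1) →
      (∀ a ∈ A, ∀ b ∈ A, ∃ x ∈ t, x ≤ a - τ * b ∧ a - τ * b ≤ x + δ) →
      (A.card : ℝ) ≤ C * δ ^ (β - ε) * (t.card : ℝ) ^ 2 := by
  have hσ0 : 0 < σ := by linarith
  have hKp : 0 < K := by linarith
  have hΛr : (1 : ℝ) ≤ Λ := by exact_mod_cast hΛ
  obtain ⟨C1, δ0, I0, hC1, hδ0, hI0, hprop⟩ := prop2 σ σ' ε K Λ hσ' hσσ hσ1 hε0 hε1 hKp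
  set d0 : ℝ := (1 / (8 * K)) ^ (1 / σ) with hd0d
  have hd0 : 0 < d0 := by positivity
  have hd1 : d0 ≤ 1 := by
    apply Real.rpow_le_one (by positivity)
    · rw [div_le_one (by positivity)]; linarith
    · positivity
  have hd0σ : K * d0 ^ σ = 1 / 8 := by
    rw [hd0d, ← Real.rpow_mul (by positivity), one_div_mul_cancel hσ0.ne', Real.rpow_one]
    field_simp
  set Q0 : ℕ := ⌈4 / d0⌉₊ with hQ0
  have hQ0' : 4 / d0 ≤ Q0 := Nat.le_ceil _
  have hQ01 : 1 ≤ Q0 := by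
    rw [hQ0, Nat.one_le_ceil_iff]; positivity
  obtain ⟨δ1, hδ1, hδ11, href⟩ := refine_G σ' ε β C1 (1 / 4) I0 Q0 hC1 hI0 hQ01 (by norm_num) hβ hβ1
    hβσ hε0.le hγ
  obtain ⟨δ3, hδ3, hδ31, hpow⟩ := small_pow (8 * Λ ^ 2 * K) σ (by positivity) hσ0
  set m : ℕ := ⌈1300 / d0⌉₊ with hm
  have hm' : 1300 / d0 ≤ m := Nat.le_ceil _
  set C4 : ℝ := 3000 / d0 ^ 2 with hC4
  have hC4p : 0 < C4 := by positivity
  refine ⟨4 * (10 * C1) * C4 ^ β * (256 * Λ ^ 8 * (2 * m + 1) ^ 4),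
    min (min δ0 δ1) (min δ3 (d0 ^ 2 / 3000)), by positivity, by positivity, ?_⟩
  intro δ hδ hδ2 A hA hAne hA12 hF hNlow hdoub τ t hτ ht
  simp only [lt_min_iff] at hδ2
  obtain ⟨⟨hδ0', hδ1'⟩, hδ3', hδd⟩ := hδ2
  obtain ⟨r, hδr, hr1, hrI, hball⟩ := hprop δ hδ hδ0' A hA hAne hA12 hF hdoub
  have hball' : BallC A δ r C1 ε σ' := hball
  have hr : 0 < r := by linarith
  have hτ1 : |τ| = 1 := by rcases hτ with h | h <;> simp [h]
  set N : ℝ := (A.card : ℝ) with hN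
  have hNp : 0 < N := by
    rw [hN]; exact_mod_cast hAne.card_pos
  have hN8 : 8 * (Λ : ℝ) ^ 2 ≤ N := by
    have h1 := hpow δ hδ hδ3'
    have hp : 0 < δ ^ σ := by positivity
    have h2 : δ ^ (-σ) * δ ^ σ = 1 := by
      rw [← Real.rpow_add hδ]; simp
    have h3 : 1 ≤ K * N * δ ^ σ := by
      rw [← h2]; gcongr
    have h4 : (8 * (Λ : ℝ) ^ 2) * (K * δ ^ σ) ≤ N * (K * δ ^ σ) := by linarith
    exact le_of_mul_le_mul_right h4 (by positivity)
  set n0 : ℕ := A.card / (8 * Λ ^ 2) with hn0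
  have hn0a : (n0 : ℝ) * (8 * Λ ^ 2) ≤ N := by
    rw [hN]; exact_mod_cast Nat.div_mul_le_self A.card (8 * Λ ^ 2)
  have hn0b : N ≤ 16 * Λ ^ 2 * n0 := by
    have hpos : 0 < 8 * Λ ^ 2 := by positivity
    have h1 : A.card < (8 * Λ ^ 2) * (n0 + 1) := by
      rw [mul_comm]
      exact Nat.lt_mul_of_div_lt (Nat.lt_succ_self _) hpos
    have h2 : 1 ≤ n0 := by
      rw [hn0, Nat.one_le_div_iff hpos]
      rw [hN] at hN8
      exact_mod_cast hN8
    have h3 : A.card ≤ 16 * Λ ^ 2 * n0 := by nlinarith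
    rw [hN]; exact_mod_cast h3
  have hSne : (keys δ A).Nonempty := hAne.image _
  have hSN : ((keys δ A).card : ℝ) ≤ N := by
    rw [hN]; exact_mod_cast card_keys_le δ A
  have hS1 : ((keys δ A - keys δ A).card : ℝ) ≤ Λ ^ 2 * N := by
    have := plun Λ (keys δ A) hSne hdoub 1 1
    rw [one_nsmul] at this
    calc ((keys δ A - keys δ A).card : ℝ) ≤ (Λ : ℝ) ^ (1 + 1) * (keys δ A).card := by
          exact_mod_cast this
      _ ≤ _ := by gcongr
  have hS2 : ((2 • keys δ A - 2 • keys δ A).card : ℝ) ≤ Λ ^ 4 * N := by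
    have := plun Λ (keys δ A) hSne hdoub 2 2
    calc ((2 • keys δ A - 2 • keys δ A).card : ℝ) ≤ (Λ : ℝ) ^ (2 + 2) * (keys δ A).card := by
          exact_mod_cast this
      _ ≤ _ := by gcongr
  have hδd0 : δ ≤ d0 := by nlinarith
  obtain ⟨P, hP, hPc, hPd⟩ := goodset δ τ d0 A n0 N hN
    (by
      calc (n0 : ℝ) * (keys δ A - keys δ A).card ≤ n0 * (Λ ^ 2 * N) := by gcongr
        _ = (n0 * (8 * Λ ^ 2)) * N / 8 := by ring
        _ ≤ N * N / 8 := by gcongr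
        _ = _ := by ring)
    (by
      intro x
      have := hF x d0 hδd0
      rw [hd0σ] at this
      linarith)
  obtain ⟨G, hGs, hGc, hGq, hGP⟩ := buildG A P τ d0 Q0 hτ1 hA12 hP hd0 (fun p hp => (hPd p hp).1) hQ0'
  obtain ⟨hBc, hBb⟩ := ballC_image hτ1 hball'
  obtain ⟨G', hG'G, hG'c, hInv⟩ := href δ r hδ hδ1' hδr hr1 hrI A (A.image (fun a => τ * a)) G 1
    (if τ = 1 then 1 else -2) hAne hBc hball' hBb
    (fun a ha => ⟨(hA12 a ha).1, by linarith [(hA12 a ha).2]⟩)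
    (by
      intro a ha
      obtain ⟨a', ha', rfl⟩ := Finset.mem_image.1 ha
      have := hA12 a' ha'
      rcases hτ with h | h
      · rw [h]; simp only [if_true]
        constructor <;> linarith [this.1, this.2]
      · rw [h, if_neg (by norm_num)]
        constructor <;> linarith [this.1, this.2])
    hGs hGq
  have hG'card : N ^ 4 / 4 ≤ G'.card := by
    have h1 : (G'.card : ℝ) + (G \ G').card = G.card := by
      have := Finset.card_sdiff_add_card_eq_card hG'G
      rw [add_comm]; exact_mod_cast this
    have h2 : (G.card : ℝ) = (P.card : ℝ) ^ 2 := by rw [hGc]; push_cast; rfl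
    have h3 : (3 / 4 * N ^ 2) ^ 2 ≤ (P.card : ℝ) ^ 2 := by gcongr
    have h4 : 0 ≤ N ^ 4 := pow_nonneg hNp.le 4
    have h5 : (3 / 4 * N ^ 2) ^ 2 = 9 / 16 * N ^ 4 := by ring
    have h6 : ((G \ G').card : ℝ) ≤ 1 / 4 * N ^ 4 := hG'c
    linarith
  have hres := combine A P G' δ τ d0 (10 * C1 * r ^ (-ε)) β (C4 * δ) n0 m Λ t N hN hNp hΛ hδ hd0 hd1 hτ1
    hA hA12 hP hPd (fun g hg => (Finset.mem_product.1 (hGs (hG'G hg))).2)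
    (fun g hg => hGP g (hG'G hg)) hG'card (by positivity) hInv rfl
    (by
      have : C4 * δ ≤ C4 * (d0 ^ 2 / 3000) := by gcongr
      refine this.trans (le_of_eq ?_)
      rw [hC4]; field_simp) ht hm' hn0b hS2
  refine hres.trans ?_
  have hrε : r ^ (-ε) ≤ δ ^ (-ε) := Real.rpow_le_rpow_of_nonpos hδ hδr (by linarith)
  calc _ ≤ 4 * (10 * C1 * δ ^ (-ε)) * (C4 * δ) ^ β * (256 * Λ ^ 8 * (2 * m + 1) ^ 4) * (t.card : ℝ) ^ 2 := by
        gcongr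
    _ = _ := by
      rw [Real.mul_rpow hC4p.le hδ.le, sub_eq_add_neg β ε, Real.rpow_add hδ]
      ring

lemma final_est (σ c K : ℝ) (Λ : ℕ) (hσ0 : 0 < σ) (hσ1 : σ < 1)
    (hc0 : 0 < c) (hc : c < min (σ / 2) ((1 - σ) / 2)) (hK : 1 ≤ K) (hΛ : 1 ≤ Λ) :
    ∃ C : ℝ, 0 < C ∧ ∀ δ : ℝ, 0 < δ → ∀ A : Finset ℝ, IsSep δ A → A.Nonempty →
      (∀ a ∈ A, a ∈ Set.Icc (1:ℝ) 2) → (A.card : ℝ) ≤ K * δ ^ (-σ) →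
      δ ^ (-σ) ≤ K * (A.card : ℝ) →
      (∀ (x r : ℝ), δ ≤ r →
        ((A.filter (fun a => |a - x| ≤ r)).card : ℝ) ≤ K * r ^ σ * (A.card : ℝ)) →
      (keys δ A + keys δ A).card ≤ Λ * (keys δ A).card →
      ∀ (τ : ℝ) (t : Finset ℝ), (τ = 1 ∨ τ = -1) →
      (∀ a ∈ A, ∀ b ∈ A, ∃ x ∈ t, x ≤ a - τ * b ∧ a - τ * b ≤ x + δ) →
      C * δ ^ (-c) * (A.card : ℝ) ≤ (t.card : ℝ) := by
  obtain ⟨hc1, hc2⟩ := lt_min_iff.1 hc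
  obtain ⟨g, hg0, hg1, hg2⟩ : ∃ g : ℝ, 0 < g ∧ g ≤ σ - 2 * c ∧ g ≤ 1 - σ - 2 * c := by
    refine ⟨min (σ - 2 * c) (1 - σ - 2 * c), lt_min (by linarith) (by linarith), min_le_left _ _,
      min_le_right _ _⟩
  obtain ⟨C, δ2, hC, hδ2, hmain⟩ := main_est σ (σ - g / 4) (g / 8) (σ + 2 * c + g / 2) K Λ
    (by linarith) (by linarith) hσ1.le (by linarith) (by linarith) hK hΛ (by linarith) (by linarith)
    (by linarith) (by linarith)
  have hKp : 0 < K := by linarith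
  set δ3 := min δ2 1 with hδ3
  have hδ3p : 0 < δ3 := lt_min hδ2 one_pos
  set Ca : ℝ := 1 / (1 + K * C) with hCa
  set Cb : ℝ := 1 / (K * δ3 ^ (-σ) * δ3 ^ (-c)) with hCb
  have hCap : 0 < Ca := by positivity
  have hCbp : 0 < Cb := by positivity
  refine ⟨min Ca Cb, lt_min hCap hCbp, ?_⟩
  intro δ hδ A hA hAne hA12 hNu hNl hF hdoub τ t hτ ht
  set N : ℝ := (A.card : ℝ) with hN
  have hNp : 0 < N := by
    rw [hN]; exact_mod_cast hAne.card_pos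
  have hpc : 0 < δ ^ (-c) := by positivity
  rcases lt_or_ge δ δ3 with hlt | hge
  · have hlt2 := lt_min_iff.1 hlt
    have hm := hmain δ hδ hlt2.1 A hA hAne hA12 hF hNl hdoub τ t hτ ht
    set T : ℝ := (t.card : ℝ) with hT
    have hT0 : 0 ≤ T := Nat.cast_nonneg _
    have h1 : min Ca Cb * δ ^ (-c) * N ≤ Ca * δ ^ (-c) * N := by
      gcongr
      exact min_le_left _ _
    refine h1.trans ?_
    apply le_of_sq_le_sq _ hT0
    set e : ℝ := σ + 2 * c + g / 2 - g / 8 with he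
    have hpow : (δ ^ (-c)) ^ 2 * (δ ^ (-σ) * δ ^ e) ≤ 1 := by
      rw [sq, ← Real.rpow_add hδ, ← Real.rpow_add hδ, ← Real.rpow_add hδ]
      apply Real.rpow_le_one hδ.le hlt2.2.le
      rw [he]; linarith
    have hCC : Ca * (K * C) ≤ 1 := by
      rw [hCa, one_div_mul_eq_div, div_le_one (by positivity)]
      linarith
    have hCa1 : Ca ≤ 1 := by
      rw [hCa, div_le_one (by positivity)]
      have : 0 < K * C := by positivity
      linarith
    calc (Ca * δ ^ (-c) * N) ^ 2 = Ca ^ 2 * (δ ^ (-c)) ^ 2 * (N * N) := by ring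
      _ ≤ Ca ^ 2 * (δ ^ (-c)) ^ 2 * ((K * δ ^ (-σ)) * (C * δ ^ e * T ^ 2)) := by gcongr
      _ = Ca * (Ca * (K * C)) * ((δ ^ (-c)) ^ 2 * (δ ^ (-σ) * δ ^ e)) * T ^ 2 := by ring
      _ ≤ 1 * 1 * 1 * T ^ 2 := by gcongr
      _ = T ^ 2 := by ring
  · obtain ⟨a, ha⟩ := hAne
    obtain ⟨x, hx, _⟩ := ht a ha a ha
    have hT1 : (1 : ℝ) ≤ t.card := by
      exact_mod_cast Finset.card_pos.2 ⟨x, hx⟩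
    refine le_trans ?_ hT1
    have e1 : δ ^ (-c) ≤ δ3 ^ (-c) := Real.rpow_le_rpow_of_nonpos hδ3p hge (by linarith)
    have e2 : δ ^ (-σ) ≤ δ3 ^ (-σ) := Real.rpow_le_rpow_of_nonpos hδ3p hge (by linarith)
    calc min Ca Cb * δ ^ (-c) * N ≤ Cb * δ3 ^ (-c) * (K * δ3 ^ (-σ)) := by
          gcongr
          · exact min_le_right _ _
          · exact hNu.trans (by gcongr)
      _ = 1 := by
        rw [hCb]
        have h1 : 0 < δ3 ^ (-c) := by positivity
        have h2 : 0 < δ3 ^ (-σ) := by positivity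
        field_simp

theorem closed_under_multiplication_case (σ c : ℝ) (hσ0 : 0 < σ) (hσ1 : σ < 1)
    (hc0 : 0 < c) (hc : c < min (σ / 2) ((1 - σ) / 2))
    (K L : ℝ) (hK : 1 ≤ K) (hL : 1 ≤ L) :
    ∃ C : ℝ, 0 < C ∧ ∀ δ : ℝ, 0 < δ → ∀ A : Finset ℝ,
      (A : Set ℝ) ⊆ Set.Icc 1 2 → IsDeltaSigmaSet K δ σ A →
      ((coveringNumber δ ((A : Set ℝ) * (A : Set ℝ)) : ℝ) ≤ L * (A.card : ℝ) ∨
        (coveringNumber δ (divSet (A : Set ℝ) (A : Set ℝ)) : ℝ) ≤ L * (A.card : ℝ)) →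
      C * δ ^ (-c) * (A.card : ℝ) ≤
          (coveringNumber δ ((A : Set ℝ) + (A : Set ℝ)) : ℝ) ∧
      C * δ ^ (-c) * (A.card : ℝ) ≤
          (coveringNumber δ ((A : Set ℝ) - (A : Set ℝ)) : ℝ) := by
  obtain ⟨C, hC, hfin⟩ := final_est σ c K ((30 * ⌈L⌉₊) ^ 2) hσ0 hσ1 hc0 hc hK (by
    have : 1 ≤ ⌈L⌉₊ := by rw [Nat.one_le_ceil_iff]; linarith
    exact Nat.one_le_pow _ _ (by omega))
  refine ⟨C, hC, ?_⟩
  intro δ hδ A hA12 hAS hcov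
  obtain ⟨hsep, hNu, hNl, hF⟩ := hAS
  have hL1 : 1 ≤ ⌈L⌉₊ := by rw [Nat.one_le_ceil_iff]; linarith
  have hAne : A.Nonempty := by
    rw [Finset.nonempty_iff_ne_empty]
    intro h0
    have : 0 < δ ^ (-σ) := by positivity
    rw [h0] at hNl
    simp only [Finset.card_empty, Nat.cast_zero, mul_zero] at hNl
    linarith
  have hA12' : ∀ a ∈ A, a ∈ Set.Icc (1 : ℝ) 2 := fun a ha => hA12 (Finset.mem_coe.2 ha)
  have hfA : (A : Set ℝ).Finite := A.finite_toSet
  have hcast : ∀ n : ℕ, (n : ℝ) ≤ L * (A.card : ℝ) → n ≤ ⌈L⌉₊ * A.card := by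
    intro n hn
    have : (n : ℝ) ≤ (⌈L⌉₊ : ℝ) * (A.card : ℝ) :=
      hn.trans (mul_le_mul_of_nonneg_right (Nat.le_ceil L) (Nat.cast_nonneg _))
    exact_mod_cast this
  have hdoub : (keys δ A + keys δ A).card ≤ (30 * ⌈L⌉₊) ^ 2 * (keys δ A).card := by
    rcases hcov with h | h
    · obtain ⟨t, htc, ht⟩ := cov_exists δ hδ.le ((A : Set ℝ) * (A : Set ℝ)) (hfA.mul hfA)
      refine doubling hδ hsep hAne hA12' ⌈L⌉₊ hL1 t ?_ (Or.inl ?_)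
      · apply hcast
        rw [htc]
        exact h
      · intro a ha b hb
        exact ht _ (Set.mul_mem_mul ha hb)
    · have hfd : (divSet (A : Set ℝ) (A : Set ℝ)).Finite := by
        refine (hfA.div hfA).subset ?_
        rintro x ⟨a, ha, b, hb, _, rfl⟩
        exact Set.div_mem_div ha hb
      obtain ⟨t, htc, ht⟩ := cov_exists δ hδ.le _ hfd
      refine doubling hδ hsep hAne hA12' ⌈L⌉₊ hL1 t ?_ (Or.inr ?_)
      · apply hcast
        rw [htc]
        exact h
      · intro a ha b hb
        have hb1 := (hA12' b hb).1
        exact ht _ ⟨a, ha, b, hb, by linarith, rfl⟩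
  constructor
  · obtain ⟨t, htc, ht⟩ := cov_exists δ hδ.le ((A : Set ℝ) + (A : Set ℝ)) (hfA.add hfA)
    have := hfin δ hδ A hsep hAne hA12' hNu hNl hF hdoub (-1) t (Or.inr rfl) (by
      intro a ha b hb
      have e : a - (-1) * b = a + b := by ring
      rw [e]
      exact ht _ (Set.add_mem_add ha hb))
    rw [htc] at this
    exact this
  · obtain ⟨t, htc, ht⟩ := cov_exists δ hδ.le ((A : Set ℝ) - (A : Set ℝ)) (hfA.sub hfA)
    have := hfin δ hδ A hsep hAne hA12' hNu hNl hF hdoub 1 t (Or.inl rfl) (by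
      intro a ha b hb
      have e : a - 1 * b = a - b := by ring
      rw [e]
      exact ht _ (Set.sub_mem_sub ha hb))
    rw [htc] at this
    exact this
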